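/- arXiv:math/9809198 — 2 statements merged into one kernel-verified Lean document; each statement's English description precedes it below -/
import Mathlib

section
/- Assume the continuum hypothesis, 2^ℵ₀ = ℵ₁. Then every abelian group that has a Borel code and is a Whitehead group is a free abelian group. -/
open MeasureTheory Cardinal

/-- Cantor space: `ℕ → Bool` with the product topology. Its product measurable-space
structure coincides with the Borel σ-algebra of the product topology. -/
abbrev Cantor : Type := ℕ → Bool

/-- A Borel code for an abelian group `B`: a Borel set `Bstar ⊆ Cantor`, a Borel set
`E ⊆ Cantor × Cantor` whose restriction to `Bstar × Bstar` is an equivalence relation,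
and a surjection `q : Bstar → B` inducing the group structure, such that the graph of
addition is Borel. -/
structure BorelCode (B : Type*) [AddCommGroup B] where
  Bstar : Set Cantor
  E : Set (Cantor × Cantor)
  q : Cantor → B
  borel_Bstar : MeasurableSet Bstar
  borel_E : MeasurableSet E
  refl : ∀ x ∈ Bstar, (x, x) ∈ E
  symm : ∀ x ∈ Bstar, ∀ y ∈ Bstar, (x, y) ∈ E → (y, x) ∈ E
  trans : ∀ x ∈ Bstar, ∀ y ∈ Bstar, ∀ z ∈ Bstar, (x, y) ∈ E → (y, z) ∈ E → (x, z) ∈ E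
  surj : ∀ b : B, ∃ x ∈ Bstar, q x = b
  q_eq_iff : ∀ x ∈ Bstar, ∀ y ∈ Bstar, (q x = q y ↔ (x, y) ∈ E)
  borel_add : MeasurableSet {p : Cantor × Cantor × Cantor |
    p.1 ∈ Bstar ∧ p.2.1 ∈ Bstar ∧ p.2.2 ∈ Bstar ∧ q p.1 + q p.2.1 = q p.2.2}

/-- An abelian group has a Borel code. -/
def HasBorelCode (B : Type*) [AddCommGroup B] : Prop := Nonempty (BorelCode B)

/-- An abelian group `G` is a Whitehead group if for every abelian group `H` and every
surjective homomorphism `f : H → G` whose kernel is isomorphic to `ℤ`, `f` has a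
right inverse which is a homomorphism (equivalently, `Ext¹(G, ℤ) = 0`). -/
def IsWhitehead (G : Type*) [AddCommGroup G] : Prop :=
  ∀ (H : Type*) [AddCommGroup H] (f : H →+ G), Function.Surjective f →
    Nonempty (f.ker ≃+ ℤ) → ∃ s : G →+ H, f.comp s = AddMonoidHom.id G

theorem Submodule.exists_free_complement {R M : Type*} [Ring R] [AddCommGroup M] [Module R M]
    {P N : Submodule R M} (h : Module.Free R (N ⧸ P.submoduleOf N)) :
    ∃ L : Submodule R M, Module.Free R L ∧ L ≤ N ∧ Disjoint L P ∧ N ≤ L ⊔ P := by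
  obtain ⟨s, hs⟩ := Module.projective_lifting_property (P.submoduleOf N).mkQ
    LinearMap.id (Submodule.mkQ_surjective _)
  have hs' : ∀ x, (P.submoduleOf N).mkQ (s x) = x := fun x => LinearMap.congr_fun hs x
  have hinj : Function.Injective (N.subtype ∘ₗ s) := by
    intro x y hxy
    have : s x = s y := Subtype.ext hxy
    rw [← hs' x, this, hs']
  refine ⟨LinearMap.range (N.subtype ∘ₗ s),
    Module.Free.of_equiv (LinearEquiv.ofInjective _ hinj), ?_, ?_, ?_⟩
  · rintro _ ⟨x, rfl⟩
    exact (s x).2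
  · rw [Submodule.disjoint_def]
    rintro _ ⟨x, rfl⟩ hx
    have : (P.submoduleOf N).mkQ (s x) = 0 := (Submodule.Quotient.mk_eq_zero _).2 hx
    rw [hs'] at this
    simp [this]
  · intro x hx
    have h1 : (⟨x, hx⟩ : N) - s ((P.submoduleOf N).mkQ ⟨x, hx⟩) ∈ P.submoduleOf N := by
      rw [← Submodule.Quotient.mk_eq_zero, ← Submodule.mkQ_apply, map_sub, hs', sub_self]
    rw [Submodule.mem_sup]
    exact ⟨_, ⟨(P.submoduleOf N).mkQ ⟨x, hx⟩, rfl⟩, _, h1, by simp⟩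

theorem Module.Free.of_filtration {R M ι : Type*} [Ring R] [AddCommGroup M] [Module R M]
    [LinearOrder ι] [WellFoundedLT ι] (N : ι → Submodule R M) (htop : ⨆ i, N i = ⊤)
    (hfree : ∀ i, Module.Free R (N i ⧸ (⨆ j < i, N j).submoduleOf (N i))) :
    Module.Free R M := by
  classical
  choose L hLf hLN hLd hNL using fun i =>
    Submodule.exists_free_complement (hfree i)
  have hind : iSupIndep L := by
    apply iSupIndep_of_dfinsupp_lsum_injective
    rw [← LinearMap.ker_eq_bot, LinearMap.ker_eq_bot']
    intro f hf
    by_contra hne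
    have hsne : f.support.Nonempty := by
      rw [Finset.nonempty_iff_ne_empty]
      simpa using hne
    set i := f.support.max' hsne with hi
    have his : i ∈ f.support := Finset.max'_mem _ _
    have hsum : ∑ j ∈ f.support, (f j : M) = 0 := by
      rw [DFinsupp.lsum_apply_apply, DFinsupp.sumAddHom_apply] at hf
      simpa [DFinsupp.sum] using hf
    rw [← Finset.add_sum_erase _ _ his] at hsum
    have hmem : (f i : M) ∈ ⨆ j < i, N j := by
      rw [eq_neg_of_add_eq_zero_left hsum]
      refine neg_mem (sum_mem fun j hj => ?_)
      have hji : j < i := lt_of_le_of_ne (Finset.le_max' _ _ (Finset.mem_of_mem_erase hj))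
        (Finset.ne_of_mem_erase hj)
      exact le_iSup₂_of_le (f := fun j (_ : j < i) => N j) j hji le_rfl (hLN j (f j).2)
    have h0 := Submodule.disjoint_def.1 (hLd i) _ (f i).2 hmem
    exact (DFinsupp.mem_support_iff.1 his) (Subtype.ext h0)
  have hsup : ⨆ i, L i = ⊤ := by
    rw [eq_top_iff, ← htop]
    refine iSup_le fun i => ?_
    induction i using WellFoundedLT.induction with
    | ind i ih =>
      exact (hNL i).trans (sup_le (le_iSup L i) (iSup₂_le ih))
  have h_int := DirectSum.isInternal_submodule_of_iSupIndep_of_iSup_eq_top hind hsup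
  exact Module.Free.of_basis (h_int.collectedBasis fun i => Module.Free.chooseBasis R (L i))

/-- Every homomorphism to `ℚ / ℤ` lifts to `ℚ`. -/
def HasCharacterLifting (G : Type*) [AddCommGroup G] : Prop :=
  ∀ ψ : G →+ AddCircle (1 : ℚ), ∃ h : G →+ ℚ, ∀ x, (h x : AddCircle (1 : ℚ)) = ψ x

theorem IsWhitehead.hasCharacterLifting.{u, v} {G : Type u} [AddCommGroup G] [Small.{v} G]
    (hG : IsWhitehead.{u, v} G) : HasCharacterLifting G := by
  intro ψ
  let K : AddSubgroup (G × ℚ) :=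
    (ψ.comp (AddMonoidHom.fst G ℚ) -
      (QuotientAddGroup.mk' (AddSubgroup.zmultiples (1 : ℚ))).comp (AddMonoidHom.snd G ℚ)).ker
  have hK : ∀ p : G × ℚ, p ∈ K ↔ ψ p.1 = (p.2 : AddCircle (1 : ℚ)) := by
    intro p
    rw [← sub_eq_zero]
    rfl
  let f₀ : K →+ G := (AddMonoidHom.fst G ℚ).comp K.subtype
  have hf₀ : Function.Surjective f₀ := by
    intro x
    obtain ⟨r, hr⟩ := QuotientAddGroup.mk_surjective (ψ x)
    exact ⟨⟨(x, r), (hK _).2 hr.symm⟩, rfl⟩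
  have h_int : ∀ n : ℤ, ((0 : G), (n : ℚ)) ∈ K := by
    intro n
    rw [hK, map_zero, eq_comm, AddCircle.coe_eq_zero_iff]
    exact ⟨n, by simp⟩
  let g : ℤ →+ K :=
    { toFun := fun n => ⟨((0 : G), (n : ℚ)), h_int n⟩
      map_zero' := by ext <;> simp
      map_add' := fun a b => by ext <;> simp }
  have : Small.{v} K := small_of_injective (β := G × ℚ) Subtype.val_injective
  let e : Shrink.{v} K ≃+ K := Shrink.addEquiv
  let f : Shrink.{v} K →+ G := f₀.comp e.toAddMonoidHom
  have hf : Function.Surjective f := hf₀.comp e.surjective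
  have hker : ∀ n, e.symm (g n) ∈ f.ker := by
    intro n
    simp [f, f₀, g]
  let g' : ℤ →+ f.ker := (e.symm.toAddMonoidHom.comp g).codRestrict f.ker hker
  have hg' : Function.Bijective g' := by
    constructor
    · intro a b hab
      have h1 : e.symm (g a) = e.symm (g b) := congrArg Subtype.val hab
      have h2 : g a = g b := e.symm.injective h1
      have h3 : (a : ℚ) = b := congrArg (fun p : K => p.1.2) h2
      exact_mod_cast h3
    · rintro ⟨x, hx⟩
      have hx1 : (e x).1.1 = 0 := hx
      have hx2 := (hK _).1 (e x).2
      rw [hx1, map_zero, eq_comm, AddCircle.coe_eq_zero_iff] at hx2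
      obtain ⟨n, hn⟩ := hx2
      refine ⟨n, Subtype.ext ?_⟩
      change e.symm (g n) = x
      rw [AddEquiv.symm_apply_eq]
      exact Subtype.ext (Prod.ext hx1.symm (by simpa [g] using hn))
  obtain ⟨s, hs⟩ := hG (Shrink.{v} K) f hf ⟨(AddEquiv.ofBijective g' hg').symm⟩
  refine ⟨(AddMonoidHom.snd G ℚ).comp (K.subtype.comp (e.toAddMonoidHom.comp s)), fun x => ?_⟩
  have h1 : (e (s x)).1.1 = x := DFunLike.congr_fun hs x
  have h2 := (hK _).1 (e (s x)).2
  rw [h1] at h2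
  exact h2.symm

section Characters

variable {G : Type*} [AddCommGroup G]

theorem exists_character_extension (S : Submodule ℤ G) (ψ : S →+ AddCircle (1 : ℚ)) :
    ∃ ψ' : G →+ AddCircle (1 : ℚ), ∀ x : S, ψ' x = ψ x := by
  obtain ⟨ψ', h⟩ := CharacterModule.dual_surjective_of_injective S.subtype S.subtype_injective ψ
  exact ⟨ψ', fun x => DFunLike.congr_fun h x⟩

theorem exists_character_separating {S : Submodule ℤ G} {y : G} (hy : y ∉ S) :
    ∃ χ : G →+ AddCircle (1 : ℚ), (∀ x ∈ S, χ x = 0) ∧ χ y ≠ 0 := by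
  have hne : S.mkQ y ≠ 0 := by simpa using hy
  obtain ⟨c, hc⟩ := CharacterModule.exists_character_apply_ne_zero_of_ne_zero hne
  refine ⟨AddMonoidHom.comp (show (G ⧸ S) →+ AddCircle (1 : ℚ) from c) S.mkQ.toAddMonoidHom,
    fun x hx => ?_, hc⟩
  have : S.mkQ x = 0 := by simpa using hx
  change c (S.mkQ x) = 0
  rw [this, map_zero]

theorem exists_character_glue {ι : Type*} [LinearOrder ι] {N : ι → Submodule ℤ G}
    (hN : Monotone N) {ψ : ι → G →+ AddCircle (1 : ℚ)}
    (hψ : ∀ i j, i ≤ j → ∀ x ∈ N i, ψ i x = ψ j x) :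
    ∃ ψ' : G →+ AddCircle (1 : ℚ), ∀ i, ∀ x ∈ N i, ψ' x = ψ i x := by
  let f : ι → G →ₗ.[ℤ] AddCircle (1 : ℚ) := fun i => (ψ i).toIntLinearMap.toPMap (N i)
  have hf : Monotone f := by
    intro i j hij
    refine ⟨hN hij, ?_⟩
    intro x y hxy
    change ψ i x = ψ j y
    rw [← hxy, hψ i j hij x x.2]
  have hc : DirectedOn (· ≤ ·) (Set.range f) := directedOn_range.2 hf.directed_le
  obtain ⟨ψ', h⟩ := exists_character_extension (LinearPMap.sSup _ hc).domain
    (LinearPMap.sSup _ hc).toFun.toAddMonoidHom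
  refine ⟨ψ', fun i x hx => ?_⟩
  have hi : f i ∈ Set.range f := ⟨i, rfl⟩
  have h2 := LinearPMap.sSup_apply hc hi ⟨x, hx⟩
  exact (h ⟨x, (LinearPMap.le_sSup hc hi).1 hx⟩).trans h2

theorem HasCharacterLifting.isTorsionFree (hG : HasCharacterLifting G) :
    Module.IsTorsionFree ℤ G := by
  refine .of_smul_eq_zero fun n x hnx => ?_
  by_contra! hcon
  obtain ⟨χ, -, hχ⟩ := exists_character_separating (S := (⊥ : Submodule ℤ G)) (y := x)
    (by simpa using hcon.2)
  obtain ⟨h, hh⟩ := hG χ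
  have h0 : n • h x = 0 := by rw [← map_zsmul, hnx, map_zero]
  have h1 : h x = 0 := (smul_eq_zero.1 h0).resolve_left hcon.1
  exact hχ (by rw [← hh, h1]; rfl)

/-- The elements `w n, w (n + 1), …` are torsion modulo the subgroup generated by `A` and
`w 0, …, w (n - 1)`, and none lies in the subgroup generated by `A` and its predecessors. -/
def IsNonfreeWitness (A : Submodule ℤ G) (n : ℕ) (w : ℕ → G) : Prop :=
  ∀ k, (∃ m : ℤ, m ≠ 0 ∧ m • w (n + k) ∈ A ⊔ Submodule.span ℤ (w '' Set.Iio n)) ∧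
    w (n + k) ∉ A ⊔ Submodule.span ℤ (w '' Set.Iio (n + k))

theorem IsNonfreeWitness.exists_character {A : Submodule ℤ G} {n : ℕ} {w : ℕ → G}
    (hw : IsNonfreeWitness A n w) :
    ∃ χ : G →+ AddCircle (1 : ℚ), (∀ x ∈ A, χ x = 0) ∧
      ∀ h : G →+ ℚ, (∀ x ∈ A, h x = 0) → ∃ k, (h (w k) : AddCircle (1 : ℚ)) ≠ χ (w k) := by
  by_contra! hcon
  let R : ℕ → Submodule ℤ G := fun j => A ⊔ Submodule.span ℤ (w '' Set.Iio j)
  have hR : Monotone R := fun i j hij =>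
    sup_le_sup_left (Submodule.span_mono (Set.image_mono (Set.Iio_subset_Iio hij))) A
  have hwR : ∀ i j, i < j → w i ∈ R j := fun i j hij =>
    Submodule.mem_sup_right (Submodule.subset_span ⟨i, hij, rfl⟩)
  choose X hX0 hX using fun k => exists_character_separating (hw k).2
  let ψ : (ℕ → Bool) → ℕ → G →+ AddCircle (1 : ℚ) := fun η k =>
    ∑ j ∈ Finset.range k, if η j then X j else 0
  have hψ : ∀ η i j, i ≤ j → ∀ x ∈ R (n + i), ψ η i x = ψ η j x := by
    intro η i j hij x hx
    simp only [ψ, AddMonoidHom.finsetSum_apply]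
    refine Finset.sum_subset (Finset.range_mono hij) fun l _ hl => ?_
    have hil : i ≤ l := by simpa using hl
    split_ifs
    · exact hX0 l x (hR (by omega) hx)
    · rfl
  choose χ hχ using fun η =>
    exists_character_glue (N := fun k => R (n + k)) (fun i j hij => hR (by omega)) (hψ η)
  have hχA : ∀ η, ∀ x ∈ A, χ η x = 0 := by
    intro η x hx
    rw [hχ η 0 x (Submodule.mem_sup_left hx)]
    simp [ψ]
  choose h hA hh using fun η => hcon (χ η) (hχA η)
  obtain ⟨η, η', hηη, hne⟩ : ∃ η η', (fun i : Fin n => h η (w i)) = (fun i : Fin n => h η' (w i)) ∧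
      η ≠ η' := by
    by_contra! hinj
    have : Function.Injective fun (η : ℕ → Bool) (i : Fin n) => h η (w i) := fun a b => hinj a b
    have : Countable (ℕ → Bool) := this.countable
    have hle := Cardinal.mk_le_aleph0 (α := ℕ → Bool)
    rw [← Cardinal.power_def, Cardinal.mk_bool, Cardinal.mk_nat] at hle
    exact (Cardinal.cantor ℵ₀).not_ge hle
  have hRn : ∀ x ∈ R n, h η x = h η' x := by
    intro x hx
    have : R n ≤ LinearMap.eqLocus (h η).toIntLinearMap (h η').toIntLinearMap := by
      refine sup_le (fun y hy => ?_) (Submodule.span_le.2 ?_)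
      · exact (hA η y hy).trans (hA η' y hy).symm
      · rintro _ ⟨i, hi, rfl⟩
        exact congrFun hηη ⟨i, hi⟩
    exact this hx
  have heq : ∀ k, χ η (w (n + k)) = χ η' (w (n + k)) := by
    intro k
    obtain ⟨m, hm, hmk⟩ := (hw k).1
    have h1 := hRn _ hmk
    rw [map_zsmul, map_zsmul] at h1
    rw [← hh, ← hh, smul_right_injective ℚ hm h1]
  obtain ⟨k, hk, hmin⟩ : ∃ k, η k ≠ η' k ∧ ∀ j < k, η j = η' j := by
    have hex : ∃ k, η k ≠ η' k := by
      by_contra! hall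
      exact hne (funext hall)
    classical
    exact ⟨Nat.find hex, Nat.find_spec hex, fun j hj => by simpa using Nat.find_min hex hj⟩
  have h1 := heq k
  rw [hχ η (k + 1) _ (hwR _ _ (by omega)), hχ η' (k + 1) _ (hwR _ _ (by omega))] at h1
  have h2 : ψ η k = ψ η' k :=
    Finset.sum_congr rfl fun j hj => by rw [hmin j (Finset.mem_range.1 hj)]
  simp only [ψ, Finset.sum_range_succ, AddMonoidHom.add_apply] at h1 h2
  rw [h2, add_right_inj] at h1
  have := hX k
  cases ha : η k <;> cases hb : η' k <;> simp_all

end Characters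

theorem exists_wellFounded_recursion {ι α : Type*} [LT ι] [WellFoundedLT ι]
    (F : ι → Set α → α) : ∃ w : ι → α, ∀ i, w i = F i (w '' {j | j < i}) := by
  refine ⟨WellFounded.fix (wellFounded_lt (α := ι)) fun i ih =>
    F i {x | ∃ (j : ι) (h : j < i), ih j h = x}, fun i => ?_⟩
  rw [WellFounded.fix_eq]
  congr 1
  ext x
  simp

section Pontryagin

variable {G : Type*} [AddCommGroup G]

/-- The elements with a nonzero multiple in `S`. -/
def pureClosure (S : Submodule ℤ G) : Submodule ℤ G where
  carrier := {x | ∃ m : ℤ, m ≠ 0 ∧ m • x ∈ S}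
  zero_mem' := ⟨1, one_ne_zero, by simp⟩
  add_mem' := by
    rintro x y ⟨m, hm, hx⟩ ⟨l, hl, hy⟩
    refine ⟨m * l, mul_ne_zero hm hl, ?_⟩
    rw [smul_add, mul_comm m l, mul_smul, mul_comm l m, mul_smul]
    exact add_mem (S.smul_mem _ hx) (S.smul_mem _ hy)
  smul_mem' := by
    rintro c x ⟨m, hm, hx⟩
    refine ⟨m, hm, ?_⟩
    rw [smul_comm]
    exact S.smul_mem _ hx

theorem mem_pureClosure {S : Submodule ℤ G} {x : G} :
    x ∈ pureClosure S ↔ ∃ m : ℤ, m ≠ 0 ∧ m • x ∈ S := Iff.rfl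

theorem le_pureClosure (S : Submodule ℤ G) : S ≤ pureClosure S :=
  fun x hx => ⟨1, one_ne_zero, by simpa using hx⟩

theorem pureClosure_mono {S T : Submodule ℤ G} (h : S ≤ T) : pureClosure S ≤ pureClosure T :=
  fun _ ⟨m, hm, hx⟩ => ⟨m, hm, h hx⟩

theorem mem_pureClosure_of_smul_mem {S : Submodule ℤ G} {x : G} {m : ℤ} (hm : m ≠ 0)
    (h : m • x ∈ pureClosure S) : x ∈ pureClosure S := by
  obtain ⟨l, hl, hx⟩ := h
  exact ⟨l * m, mul_ne_zero hl hm, by rwa [mul_smul]⟩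

theorem pureClosure_bot [Module.IsTorsionFree ℤ G] : pureClosure (⊥ : Submodule ℤ G) = ⊥ := by
  rw [eq_bot_iff]
  rintro x ⟨m, hm, hx⟩
  exact (smul_eq_zero.1 ((Submodule.mem_bot ℤ).1 hx)).resolve_left hm

theorem fg_pureClosure_span (h : ∀ n w, ¬ IsNonfreeWitness (⊥ : Submodule ℤ G) n w)
    (c : ℕ → G) (n : ℕ) : (pureClosure (Submodule.span ℤ (c '' Set.Iio n))).FG := by
  classical
  by_contra hfg
  set P := pureClosure (Submodule.span ℤ (c '' Set.Iio n)) with hP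
  obtain ⟨w, hw⟩ := exists_wellFounded_recursion (ι := ℕ) (fun j (s : Set G) =>
    if j < n then c j else if hs : ∃ y ∈ P, y ∉ Submodule.span ℤ s then hs.choose else 0)
  have hlt : ∀ j < n, w j = c j := fun j hj => by rw [hw, if_pos hj]
  have himg : w '' Set.Iio n = c '' Set.Iio n := Set.image_congr fun j hj => hlt j hj
  have hwP : ∀ j, w j ∈ P := by
    intro j
    rw [hw]
    split_ifs with h1 h2
    · exact le_pureClosure _ (Submodule.subset_span ⟨j, h1, rfl⟩)
    · exact h2.choose_spec.1
    · exact zero_mem _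
  have hnot : ∀ j, n ≤ j → w j ∉ Submodule.span ℤ (w '' Set.Iio j) := by
    intro j hj
    have hex : ∃ y ∈ P, y ∉ Submodule.span ℤ (w '' Set.Iio j) := by
      by_contra! hcon
      refine hfg ((Submodule.fg_def).2 ⟨w '' Set.Iio j, (Set.finite_Iio j).image w, ?_⟩)
      refine le_antisymm (Submodule.span_le.2 ?_) hcon
      rintro _ ⟨i, -, rfl⟩
      exact hwP i
    have : w j = hex.choose := by
      rw [hw, if_neg hj.not_gt]
      exact dif_pos hex
    rw [this]
    exact hex.choose_spec.2
  refine h n w fun k => ⟨?_, ?_⟩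
  · rw [bot_sup_eq, himg]
    exact hwP (n + k)
  · rw [bot_sup_eq]
    exact hnot (n + k) (by omega)

theorem free_of_countable_of_forall_not_isNonfreeWitness [Countable G] [Module.IsTorsionFree ℤ G]
    (h : ∀ n w, ¬ IsNonfreeWitness (⊥ : Submodule ℤ G) n w) : Module.Free ℤ G := by
  obtain ⟨c, hc⟩ := exists_surjective_nat G
  let P : ℕ → Submodule ℤ G := fun n => pureClosure (Submodule.span ℤ (c '' Set.Iio n))
  have hP : Monotone P := fun i j hij =>
    pureClosure_mono (Submodule.span_mono (Set.image_mono (Set.Iio_subset_Iio hij)))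
  have hsup : ∀ n, ⨆ m < n, P (m + 1) = P n := by
    intro n
    refine le_antisymm (iSup₂_le fun m hm => hP hm) ?_
    cases n with
    | zero =>
      have : P 0 = ⊥ := by simp [P, pureClosure_bot]
      simp [this]
    | succ n => exact le_iSup₂_of_le (f := fun m (_ : m < n + 1) => P (m + 1)) n (by omega) le_rfl
  refine Module.Free.of_filtration (fun n => P (n + 1)) ?_ fun n => ?_
  · rw [eq_top_iff]
    rintro x -
    obtain ⟨n, rfl⟩ := hc x
    exact Submodule.mem_iSup_of_mem n
      (le_pureClosure _ (Submodule.subset_span ⟨n, Nat.lt_succ_self n, rfl⟩))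
  · rw [hsup]
    have : Module.Finite ℤ (P (n + 1)) := Module.Finite.iff_fg.2 (fg_pureClosure_span h c (n + 1))
    have : Module.IsTorsionFree ℤ (P (n + 1) ⧸ (P n).submoduleOf (P (n + 1))) := by
      refine .of_smul_eq_zero fun m x hmx => ?_
      obtain ⟨x, rfl⟩ := Submodule.mkQ_surjective _ x
      rw [← map_smul, Submodule.mkQ_apply, Submodule.Quotient.mk_eq_zero] at hmx
      by_cases hm : m = 0
      · exact Or.inl hm
      · refine Or.inr ((Submodule.Quotient.mk_eq_zero _).2 ?_)
        exact mem_pureClosure_of_smul_mem (S := Submodule.span ℤ (c '' Set.Iio n)) hm hmx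
    exact Module.free_of_finite_type_torsion_free'

theorem free_quotient_of_forall_not_isNonfreeWitness {A C : Submodule ℤ G} (hAC : A ≤ C)
    [Countable C] (hpure : ∀ m : ℤ, m ≠ 0 → ∀ x, m • x ∈ A → x ∈ A)
    (h : ∀ n w, ¬ IsNonfreeWitness A n w) : Module.Free ℤ (C ⧸ A.submoduleOf C) := by
  set π := (A.submoduleOf C).mkQ with hπ
  have hmem : ∀ (u : ℕ → C) (s : Set ℕ) (x : C),
      π x ∈ (⊥ : Submodule ℤ _) ⊔ Submodule.span ℤ ((fun i => π (u i)) '' s) ↔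
        (x : G) ∈ A ⊔ Submodule.span ℤ ((fun i => (u i : G)) '' s) := by
    intro u s x
    have h1 : (fun i => π (u i)) '' s = π '' (u '' s) := (Set.image_image _ _ _).symm
    have h2 : (fun i => (u i : G)) '' s = C.subtype '' (u '' s) := (Set.image_image _ _ _).symm
    have h3 : A = (A.submoduleOf C).map C.subtype := by
      rw [Submodule.submoduleOf, Submodule.map_comap_subtype, inf_eq_right.2 hAC]
    rw [bot_sup_eq, h1, h2, ← Submodule.map_span, ← Submodule.map_span, ← Submodule.mem_comap,
      Submodule.comap_map_eq, hπ, Submodule.ker_mkQ]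
    conv_rhs => rw [h3, ← Submodule.map_sup]
    rw [sup_comm]
    exact (C.subtype_injective.mem_set_image
      (s := (A.submoduleOf C ⊔ Submodule.span ℤ (u '' s) : Submodule ℤ C))).symm
  have : Countable (C ⧸ A.submoduleOf C) := (Submodule.mkQ_surjective (A.submoduleOf C)).countable
  have : Module.IsTorsionFree ℤ (C ⧸ A.submoduleOf C) := by
    refine .of_smul_eq_zero fun m x hmx => ?_
    obtain ⟨x, rfl⟩ := Submodule.mkQ_surjective _ x
    rw [← map_smul, Submodule.mkQ_apply, Submodule.Quotient.mk_eq_zero] at hmx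
    by_cases hm : m = 0
    · exact Or.inl hm
    · exact Or.inr ((Submodule.Quotient.mk_eq_zero _).2 (hpure m hm x hmx))
  refine free_of_countable_of_forall_not_isNonfreeWitness fun n w hw => ?_
  choose u hu using fun i => Submodule.mkQ_surjective (A.submoduleOf C) (w i)
  obtain rfl : (fun i => π (u i)) = w := funext hu
  refine h n (fun i => (u i : G)) fun k => ⟨?_, ?_⟩
  · obtain ⟨m, hm, hmk⟩ := (hw k).1
    refine ⟨m, hm, ?_⟩
    rw [← map_smul, hmem u] at hmk
    exact hmk
  · exact fun hk => (hw k).2 ((hmem u _ _).2 hk)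

end Pontryagin

section Coding

variable {G : Type*} [AddCommGroup G] {I : Type} [LinearOrder I]

theorem eq_on_sSup_insert {T : Type*} [AddCommGroup T] {A₀ : Submodule ℤ G}
    {S : Set (Submodule ℤ G)} {f g : G →+ T} (h₀ : ∀ x ∈ A₀, f x = g x)
    (h : ∀ N ∈ S, ∀ x ∈ N, f x = g x) : ∀ x ∈ sSup (insert A₀ S), f x = g x := by
  intro x hx
  have : sSup (insert A₀ S) ≤ LinearMap.eqLocus f.toIntLinearMap g.toIntLinearMap := by
    refine sSup_le ?_
    rintro N (rfl | hN) y hy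
    · exact h₀ y hy
    · exact h N hN y hy
  exact this hx

/-- `ψ` vanishes on `A₀`, and for `k ∈ s` its restriction to `A k` is the `E k`-normalised extension
of its restriction to the predecessors of `A k`, shifted by `χ k` exactly when `k ∈ η`. -/
def IsCodedBy (A₀ : Submodule ℤ G) (A : I → Submodule ℤ G) (χ : I → G →+ AddCircle (1 : ℚ))
    (E : I → (G →+ AddCircle (1 : ℚ)) → G →+ AddCircle (1 : ℚ)) (η s : Set I)
    (ψ : G →+ AddCircle (1 : ℚ)) : Prop :=
  (∀ x ∈ A₀, ψ x = 0) ∧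
    ∀ k ∈ s, ∀ x ∈ A k, ψ x = E k ψ x + Set.indicator η (fun k => χ k x) k

theorem exists_isCodedBy [WellFoundedLT I] {A₀ : Submodule ℤ G} {A : I → Submodule ℤ G}
    {χ : I → G →+ AddCircle (1 : ℚ)}
    {E : I → (G →+ AddCircle (1 : ℚ)) → G →+ AddCircle (1 : ℚ)}
    (hBA : ∀ i, sSup (insert A₀ (A '' {j | j < i})) ≤ A i)
    (hχ : ∀ i, ∀ x ∈ sSup (insert A₀ (A '' {j | j < i})), χ i x = 0)
    (hE : ∀ i ψ, ∀ x ∈ sSup (insert A₀ (A '' {j | j < i})), E i ψ x = ψ x)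
    (hE' : ∀ i ψ ψ', (∀ x ∈ sSup (insert A₀ (A '' {j | j < i})), ψ x = ψ' x) → E i ψ = E i ψ')
    (η : Set I) : ∃ ψ, IsCodedBy A₀ A χ E η Set.univ ψ := by
  have hAB : ∀ i j, j < i → A j ≤ sSup (insert A₀ (A '' {j | j < i})) := fun i j hj =>
    le_sSup (Or.inr ⟨j, hj, rfl⟩)
  have hA₀ : ∀ i, A₀ ≤ A i := fun i =>
    le_trans (le_sSup (Set.mem_insert _ _)) (hBA i)
  have hA : Monotone A := by
    intro i j hij
    rcases hij.eq_or_lt with rfl | hlt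
    · exact le_rfl
    · exact (hAB j i hlt).trans (hBA j)
  have huniq : ∀ s : Set I, IsLowerSet s → ∀ ψ ψ', IsCodedBy A₀ A χ E η s ψ →
      IsCodedBy A₀ A χ E η s ψ' → ∀ k ∈ s, ∀ x ∈ A k, ψ x = ψ' x := by
    intro s hs ψ ψ' h h' k
    induction k using WellFoundedLT.induction with
    | ind k ih =>
      intro hk x hx
      rw [h.2 k hk x hx, h'.2 k hk x hx, hE' k ψ ψ']
      refine eq_on_sSup_insert (fun y hy => (h.1 y hy).trans (h'.1 y hy).symm) ?_
      rintro _ ⟨j, hj, rfl⟩ y hy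
      exact ih j hj (hs (le_of_lt hj) hk) y hy
  have hglue : ∀ s : Set I, IsLowerSet s →
      (∀ j ∈ s, ∃ ψ, IsCodedBy A₀ A χ E η (Set.Iic j) ψ) → ∃ ψ, IsCodedBy A₀ A χ E η s ψ := by
    intro s hs hj
    rcases s.eq_empty_or_nonempty with rfl | ⟨j₀, hj₀⟩
    · exact ⟨0, fun _ _ => rfl, fun k hk => absurd hk (Set.notMem_empty k)⟩
    choose! φ hφ using hj
    obtain ⟨ψ, hψ⟩ := exists_character_glue (ι := s) (N := fun j => A j)
      (fun i j hij => hA hij) (ψ := fun j => φ j) (fun i j hij =>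
        huniq (Set.Iic i) (isLowerSet_Iic _) _ _ (hφ i i.2)
          ⟨(hφ j j.2).1, fun k hk => (hφ j j.2).2 k (le_trans hk hij)⟩ i le_rfl)
    refine ⟨ψ, fun x hx => ?_, fun k hk x hx => ?_⟩
    · rw [hψ ⟨j₀, hj₀⟩ x (hA₀ _ hx)]
      exact (hφ j₀ hj₀).1 x hx
    · rw [hψ ⟨k, hk⟩ x hx, (hφ k hk).2 k le_rfl x hx, hE' k ψ (φ k)]
      exact fun y hy => hψ ⟨k, hk⟩ y (hBA k hy)
  refine hglue Set.univ isLowerSet_univ fun i _ => ?_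
  induction i using WellFoundedLT.induction with
  | ind i ih =>
    obtain ⟨ψ, hψ⟩ := hglue (Set.Iio i) (isLowerSet_Iio i) fun j hj => ih j hj trivial
    classical
    set ψ' : G →+ AddCircle (1 : ℚ) := E i ψ + if i ∈ η then χ i else 0 with hψ'
    have happ : ∀ x, ψ' x = E i ψ x + Set.indicator η (fun k => χ k x) i := by
      intro x
      rw [hψ', AddMonoidHom.add_apply, Set.indicator_apply]
      split_ifs <;> rfl
    have hagree : ∀ x ∈ sSup (insert A₀ (A '' {j | j < i})), ψ' x = ψ x := by
      intro x hx
      rw [happ, hE i ψ x hx, Set.indicator_apply, hχ i x hx, ite_self, add_zero]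
    refine ⟨ψ', fun x hx => ?_, fun k hk x hx => ?_⟩
    · rw [hagree x (Submodule.mem_sSup_of_mem (Set.mem_insert _ _) hx), hψ.1 x hx]
    · rcases (Set.mem_Iic.1 hk).eq_or_lt with rfl | hlt
      · rw [happ, hE' k ψ' ψ hagree]
      · rw [hagree x (hAB i k hlt hx), hψ.2 k hlt x hx, hE' k ψ' ψ]
        exact fun y hy => hagree y (hAB i k hlt (hBA k hy))

theorem exists_normalised_extension (B : Submodule ℤ G) :
    ∃ E : (G →+ AddCircle (1 : ℚ)) → G →+ AddCircle (1 : ℚ),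
      (∀ ψ, ∀ x ∈ B, E ψ x = ψ x) ∧ ∀ ψ ψ', (∀ x ∈ B, ψ x = ψ' x) → E ψ = E ψ' := by
  let s : Setoid (G →+ AddCircle (1 : ℚ)) :=
    { r := fun ψ ψ' => ∀ x ∈ B, ψ x = ψ' x
      iseqv := ⟨fun _ _ _ => rfl, fun h x hx => (h x hx).symm,
        fun h h' x hx => (h x hx).trans (h' x hx)⟩ }
  exact ⟨fun ψ => (Quotient.mk s ψ).out, fun ψ => Quotient.mk_out (s := s) ψ,
    fun ψ ψ' h => congrArg Quotient.out (Quotient.sound (s := s) h)⟩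

theorem not_hasCharacterLifting_of_nonlifting_steps [WellFoundedLT I]
    (hI : ∀ i : I, {j | j < i}.Countable) (hcard : Cardinal.continuum < #(Set I))
    (𝒞 : Set (Submodule ℤ G)) (hcount : ∀ A ∈ 𝒞, (A : Set G).Countable) (hne : 𝒞.Nonempty)
    (hsup : ∀ S ⊆ 𝒞, S.Nonempty → S.Countable → IsChain (· ≤ ·) S → sSup S ∈ 𝒞)
    (hnext : ∀ A ∈ 𝒞, ∃ A' ∈ 𝒞, A ≤ A' ∧ ∃ χ : G →+ AddCircle (1 : ℚ), (∀ x ∈ A, χ x = 0) ∧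
      ∀ h : G →+ ℚ, (∀ x ∈ A, h x = 0) → ∃ x ∈ A', (h x : AddCircle (1 : ℚ)) ≠ χ x) :
    ¬ HasCharacterLifting G := by
  intro hG
  obtain ⟨A₀, hA₀⟩ := hne
  choose! next hnext𝒞 hle X hX hXlift using hnext
  obtain ⟨A, hA⟩ := exists_wellFounded_recursion (ι := I)
    (fun _ (S : Set (Submodule ℤ G)) => next (sSup (insert A₀ S)))
  set B : I → Submodule ℤ G := fun i => sSup (insert A₀ (A '' {j | j < i})) with hB
  have hAB : ∀ i j, j < i → A j ≤ B i := fun i j hj => le_sSup (Or.inr ⟨j, hj, rfl⟩)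
  have hmem : ∀ i, B i ∈ 𝒞 ∧ A i ∈ 𝒞 ∧ B i ≤ A i := by
    intro i
    induction i using WellFoundedLT.induction with
    | ind i ih =>
      have hlt : ∀ j l, j < l → l < i → A j ≤ A l := fun j l hjl hl =>
        (hAB l j hjl).trans (ih l hl).2.2
      have hBi : B i ∈ 𝒞 := by
        refine hsup _ ?_ (Set.insert_nonempty _ _) (((hI i).image A).insert A₀) ?_
        · rintro _ (rfl | ⟨j, hj, rfl⟩)
          · exact hA₀
          · exact (ih j hj).2.1
        · refine IsChain.insert ?_ ?_
          · rintro _ ⟨j, hj, rfl⟩ _ ⟨l, hl, rfl⟩ hne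
            rcases lt_trichotomy j l with h | rfl | h
            · exact Or.inl (hlt j l h hl)
            · exact absurd rfl hne
            · exact Or.inr (hlt l j h hj)
          · rintro _ ⟨j, hj, rfl⟩ -
            exact Or.inl (le_trans (le_sSup (Set.mem_insert _ _)) (ih j hj).2.2)
      rw [hA i]
      exact ⟨hBi, hnext𝒞 _ hBi, hle _ hBi⟩
  let χ : I → G →+ AddCircle (1 : ℚ) := fun i => X (B i)
  have hχ : ∀ i, ∀ x ∈ B i, χ i x = 0 := fun i => hX _ (hmem i).1
  have hχlift : ∀ i, ∀ h : G →+ ℚ, (∀ x ∈ B i, h x = 0) →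
      ∃ x ∈ A i, (h x : AddCircle (1 : ℚ)) ≠ χ i x := by
    intro i
    rw [hA i]
    exact hXlift _ (hmem i).1
  choose E hE hE' using fun i => exists_normalised_extension (B i)
  choose ψ hψ using exists_isCodedBy (fun i => (hmem i).2.2) hχ hE hE'
  choose h hh using fun η => hG (ψ η)
  obtain ⟨e₀, he₀⟩ := (hcount A₀ hA₀).exists_eq_range ⟨0, zero_mem A₀⟩
  choose e he using fun i => (hcount _ (hmem i).2.1).exists_eq_range ⟨0, zero_mem (A i)⟩
  obtain ⟨d, hd⟩ := exists_surjective_nat ℚ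
  let code : ℕ → Set I → Set I := fun k η => {i | h η (e i k.unpair.1) = d k.unpair.2}
  let Φ : Set I → List ℕ → ℕ → ℚ := fun η σ n => h (σ.foldr code η) (e₀ n)
  have hΦ : Function.Injective Φ := by
    intro η η' heq
    have hbase : ∀ σ : List ℕ, ∀ x ∈ A₀, h (σ.foldr code η) x = h (σ.foldr code η') x := by
      intro σ x hx
      obtain ⟨n, rfl⟩ : x ∈ Set.range e₀ := he₀ ▸ hx
      exact congrFun (congrFun heq σ) n
    have key : ∀ i, ∀ σ : List ℕ, (i ∈ σ.foldr code η ↔ i ∈ σ.foldr code η') ∧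
        ∀ x ∈ A i, h (σ.foldr code η) x = h (σ.foldr code η') x := by
      intro i
      induction i using WellFoundedLT.induction with
      | ind i ih =>
        have hBeq : ∀ σ : List ℕ, ∀ x ∈ B i, h (σ.foldr code η) x = h (σ.foldr code η') x := by
          intro σ
          refine eq_on_sSup_insert (hbase σ) ?_
          rintro _ ⟨j, hj, rfl⟩
          exact (ih j hj σ).2
        have hEeq : ∀ σ : List ℕ, E i (ψ (σ.foldr code η)) = E i (ψ (σ.foldr code η')) := by
          intro σ
          refine hE' i _ _ fun x hx => ?_
          rw [← hh, ← hh, hBeq σ x hx]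
        have hstep : ∀ ζ ζ' : Set I, (∀ x ∈ B i, h ζ x = h ζ' x) → E i (ψ ζ) = E i (ψ ζ') →
            i ∈ ζ → i ∈ ζ' := by
          intro ζ ζ' hB hEζ hi
          by_contra hi'
          obtain ⟨x, hx, hne⟩ := hχlift i (h ζ - h ζ') fun x hx => by
            rw [AddMonoidHom.sub_apply, hB x hx, sub_self]
          apply hne
          rw [AddMonoidHom.sub_apply, AddCircle.coe_sub, hh, hh, (hψ ζ).2 i trivial x hx,
            (hψ ζ').2 i trivial x hx, hEζ, Set.indicator_of_mem hi, Set.indicator_of_notMem hi']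
          simp
        have hbit : ∀ σ : List ℕ, i ∈ σ.foldr code η ↔ i ∈ σ.foldr code η' := fun σ =>
          ⟨hstep _ _ (hBeq σ) (hEeq σ),
            hstep _ _ (fun x hx => (hBeq σ x hx).symm) (hEeq σ).symm⟩
        refine fun σ => ⟨hbit σ, fun x hx => ?_⟩
        obtain ⟨a, rfl⟩ : x ∈ Set.range (e i) := he i ▸ hx
        obtain ⟨b, hb⟩ := hd (h (σ.foldr code η) (e i a))
        have h1 : i ∈ (Nat.pair a b :: σ).foldr code η := by
          simp only [List.foldr_cons, code, Set.mem_ofPred_eq, Nat.unpair_pair]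
          exact hb.symm
        have h2 := (hbit _).1 h1
        simp only [List.foldr_cons, code, Set.mem_ofPred_eq, Nat.unpair_pair] at h2
        rw [h2, hb]
    ext i
    exact (key i []).1
  have hle := Cardinal.mk_le_of_injective hΦ
  refine hcard.not_ge (hle.trans_eq ?_)
  simp

end Coding

section Analytic

instance : PolishSpace Cantor := {}

theorem analyticSet_inter {X : Type*} [TopologicalSpace X] [T2Space X] {s t : Set X}
    (hs : AnalyticSet s) (ht : AnalyticSet t) : AnalyticSet (s ∩ t) := by
  rw [Set.inter_eq_iInter]
  exact AnalyticSet.iInter fun b => by cases b <;> simpa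

theorem analyticSet_exists {X Y : Type*} [TopologicalSpace X] [TopologicalSpace Y]
    {s : Set (X × Y)} (hs : AnalyticSet s) : AnalyticSet {x | ∃ y, (x, y) ∈ s} := by
  convert hs.image_of_continuous continuous_fst
  ext x
  simp

theorem analyticSet_forall {X ι : Type*} [Countable ι] [Nonempty ι] [TopologicalSpace X]
    [T2Space X] {p : ι → X → Prop} (hp : ∀ i, AnalyticSet {x | p i x}) :
    AnalyticSet {x | ∀ i, p i x} := by
  convert AnalyticSet.iInter hp
  ext x
  simp

theorem analyticSet_exists_countable {X ι : Type*} [Countable ι] [TopologicalSpace X]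
    {p : ι → X → Prop} (hp : ∀ i, AnalyticSet {x | p i x}) :
    AnalyticSet {x | ∃ i, p i x} := by
  convert AnalyticSet.iUnion hp
  ext x
  simp

namespace BorelCode

variable {B : Type*} [AddCommGroup B] (c : BorelCode B)

theorem analyticSet_Bstar : AnalyticSet {x | x ∈ c.Bstar} := c.borel_Bstar.analyticSet

theorem analyticSet_eq :
    AnalyticSet {p : Cantor × Cantor | (p.1 ∈ c.Bstar ∧ p.2 ∈ c.Bstar) ∧ c.q p.1 = c.q p.2} := by
  convert analyticSet_inter
    (analyticSet_inter (c.analyticSet_Bstar.preimage continuous_fst)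
      (c.analyticSet_Bstar.preimage continuous_snd)) c.borel_E.analyticSet using 1
  ext p
  exact and_congr_right fun h => c.q_eq_iff _ h.1 _ h.2

theorem analyticSet_ne :
    AnalyticSet {p : Cantor × Cantor | (p.1 ∈ c.Bstar ∧ p.2 ∈ c.Bstar) ∧ c.q p.1 ≠ c.q p.2} := by
  convert analyticSet_inter
    (analyticSet_inter (c.analyticSet_Bstar.preimage continuous_fst)
      (c.analyticSet_Bstar.preimage continuous_snd)) c.borel_E.compl.analyticSet using 1
  ext p
  exact and_congr_right fun h => not_congr (c.q_eq_iff _ h.1 _ h.2)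

variable {ι : Type} [Countable ι]

theorem analyticSet_forall_mem_Bstar [Nonempty ι] :
    AnalyticSet {v : ι → Cantor | ∀ i, v i ∈ c.Bstar} :=
  analyticSet_forall fun i => c.analyticSet_Bstar.preimage (continuous_apply i)

/-- The graph of evaluation of a formal integer combination at coded elements is analytic. -/
theorem analyticSet_linearCombination_eq [Nonempty ι] (l : ι →₀ ℤ) :
    AnalyticSet {p : (ι → Cantor) × Cantor | (∀ i, p.1 i ∈ c.Bstar) ∧ p.2 ∈ c.Bstar ∧
      Finsupp.linearCombination ℤ (c.q ∘ p.1) l = c.q p.2} := by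
  obtain ⟨z, hz, hz0⟩ := c.surj 0
  have hadd := c.borel_add.analyticSet
  let S : AddSubgroup (ι →₀ ℤ) :=
    { carrier := {l | AnalyticSet {p : (ι → Cantor) × Cantor | (∀ i, p.1 i ∈ c.Bstar) ∧
        p.2 ∈ c.Bstar ∧ Finsupp.linearCombination ℤ (c.q ∘ p.1) l = c.q p.2}}
      zero_mem' := by
        have h1 := c.analyticSet_eq.preimage
          (f := fun p : (ι → Cantor) × Cantor => (p.2, z)) (by fun_prop)
        have h2 := analyticSet_inter (c.analyticSet_forall_mem_Bstar.preimage continuous_fst) h1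
        change AnalyticSet _
        convert h2 using 1
        ext p
        simp [hz, hz0, eq_comm]
      add_mem' := by
        intro l₁ l₂ h₁ h₂
        have h3 := analyticSet_exists 
          (analyticSet_inter (h₁.preimage (f := fun r : ((ι → Cantor) × Cantor) × Cantor × Cantor =>
            (r.1.1, r.2.1)) (by fun_prop)) (analyticSet_inter (h₂.preimage
            (f := fun r : ((ι → Cantor) × Cantor) × Cantor × Cantor =>
            (r.1.1, r.2.2)) (by fun_prop)) (hadd.preimage
            (f := fun r : ((ι → Cantor) × Cantor) × Cantor × Cantor =>
            (r.2.1, r.2.2, r.1.2)) (by fun_prop))))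
        change AnalyticSet _
        convert h3 using 1
        ext p
        constructor
        · rintro ⟨hv, hy, he⟩
          obtain ⟨y₁, hy₁, e₁⟩ := c.surj (Finsupp.linearCombination ℤ (c.q ∘ p.1) l₁)
          obtain ⟨y₂, hy₂, e₂⟩ := c.surj (Finsupp.linearCombination ℤ (c.q ∘ p.1) l₂)
          refine ⟨(y₁, y₂), ⟨hv, hy₁, e₁.symm⟩, ⟨hv, hy₂, e₂.symm⟩, hy₁, hy₂, hy, ?_⟩
          change c.q y₁ + c.q y₂ = c.q p.2
          rw [e₁, e₂, ← he, map_add]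
        · rintro ⟨y, ⟨hv, hy₁, e₁⟩, ⟨-, hy₂, e₂⟩, -, -, hy, he⟩
          refine ⟨hv, hy, ?_⟩
          rw [map_add]
          exact (congrArg₂ (· + ·) e₁ e₂).trans he
      neg_mem' := by
        intro l h
        have h3 := analyticSet_exists 
          (analyticSet_inter (h.preimage (f := fun r : ((ι → Cantor) × Cantor) × Cantor =>
            (r.1.1, r.2)) (by fun_prop)) (hadd.preimage
            (f := fun r : ((ι → Cantor) × Cantor) × Cantor =>
            (r.2, r.1.2, z)) (by fun_prop)))
        change AnalyticSet _
        convert h3 using 1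
        ext p
        constructor
        · rintro ⟨hv, hy, he⟩
          obtain ⟨y₁, hy₁, e₁⟩ := c.surj (Finsupp.linearCombination ℤ (c.q ∘ p.1) l)
          refine ⟨y₁, ⟨hv, hy₁, e₁.symm⟩, hy₁, hy, hz, ?_⟩
          change c.q y₁ + c.q p.2 = c.q z
          rw [e₁, ← he, map_neg, hz0, add_neg_cancel]
        · rintro ⟨y, ⟨hv, hy₁, e₁⟩, -, hy, -, he⟩
          refine ⟨hv, hy, ?_⟩
          rw [map_neg, neg_eq_iff_add_eq_zero, ← hz0]
          exact (congrArg (· + _) e₁).trans he }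
  have hsingle : ∀ i, Finsupp.single i 1 ∈ S := by
    intro i
    have h1 := c.analyticSet_eq.preimage
      (f := fun p : (ι → Cantor) × Cantor => (p.1 i, p.2)) (by fun_prop)
    change AnalyticSet _
    convert analyticSet_inter (c.analyticSet_forall_mem_Bstar.preimage continuous_fst) h1 using 1
    ext p
    simp only [Set.mem_ofPred_eq, Finsupp.linearCombination_single, one_smul]
    exact ⟨fun h => ⟨h.1, ⟨h.1 i, h.2.1⟩, h.2.2⟩, fun h => ⟨h.1, h.2.1.2, h.2.2⟩⟩
  change l ∈ S
  induction l using Finsupp.induction_linear with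
  | zero => exact zero_mem S
  | add f g hf hg => exact add_mem hf hg
  | single i m =>
    have := zsmul_mem (hsingle i) m
    simpa using this

theorem analyticSet_linearCombination_eq_zero [Nonempty ι] (l : ι →₀ ℤ) :
    AnalyticSet {v : ι → Cantor | (∀ i, v i ∈ c.Bstar) ∧
      Finsupp.linearCombination ℤ (c.q ∘ v) l = 0} := by
  obtain ⟨z, hz, hz0⟩ := c.surj 0
  convert (c.analyticSet_linearCombination_eq l).preimage
    (f := fun v : ι → Cantor => (v, z)) (by fun_prop) using 1
  ext v
  simp [hz, hz0]

theorem analyticSet_linearCombination_ne_zero [Nonempty ι] (l : ι →₀ ℤ) :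
    AnalyticSet {v : ι → Cantor | (∀ i, v i ∈ c.Bstar) ∧
      Finsupp.linearCombination ℤ (c.q ∘ v) l ≠ 0} := by
  obtain ⟨z, hz, hz0⟩ := c.surj 0
  have h := analyticSet_exists
    (analyticSet_inter (c.analyticSet_linearCombination_eq l) (c.analyticSet_ne.preimage
    (f := fun r : (ι → Cantor) × Cantor => (r.2, z)) (by fun_prop)))
  convert h using 1
  ext v
  constructor
  · rintro ⟨hv, hne⟩
    obtain ⟨y, hy, e⟩ := c.surj (Finsupp.linearCombination ℤ (c.q ∘ v) l)
    exact ⟨y, ⟨hv, hy, e.symm⟩, ⟨hy, hz⟩, by rwa [hz0, e]⟩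
  · rintro ⟨y, ⟨hv, hy, e⟩, -, hne⟩
    refine ⟨hv, ?_⟩
    rw [e, ← hz0]
    exact hne

/-- The index set of the generators of `A ⊔ span (w '' Iio j)`, where `A` is generated by the
left summand. -/
def generatorIndices (j : ℕ) : Set (ℕ ⊕ ℕ) := Set.range Sum.inl ∪ Sum.inr '' Set.Iio j

theorem mem_span_sup_span_iff {u : ℕ ⊕ ℕ → B} {j : ℕ} {x : B} :
    x ∈ Submodule.span ℤ (Set.range (u ∘ Sum.inl)) ⊔
      Submodule.span ℤ ((u ∘ Sum.inr) '' Set.Iio j) ↔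
    ∃ l : Finsupp.supported ℤ ℤ (generatorIndices j),
      Finsupp.linearCombination ℤ u l = x := by
  rw [← Submodule.span_union, Set.range_comp, Set.image_comp, ← Set.image_union,
    Finsupp.mem_span_image_iff_linearCombination]
  simp [generatorIndices]

theorem analyticSet_isNonfreeWitness :
    AnalyticSet {s : ℕ → Cantor | (∀ i, s i ∈ c.Bstar) ∧ ∃ n w,
      IsNonfreeWitness (Submodule.span ℤ (Set.range (c.q ∘ s))) n w} := by
  have h1 : AnalyticSet {v : ℕ ⊕ ℕ → Cantor | ∃ n : ℕ, ∀ k : ℕ,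
      (∃ (m : {m : ℤ // m ≠ 0}) (l : Finsupp.supported ℤ ℤ (generatorIndices n)),
        (∀ i, v i ∈ c.Bstar) ∧ Finsupp.linearCombination ℤ (c.q ∘ v)
          (l.1 - Finsupp.single (Sum.inr (n + k)) m.1) = 0) ∧
      ∀ l : Finsupp.supported ℤ ℤ (generatorIndices (n + k)),
        (∀ i, v i ∈ c.Bstar) ∧ Finsupp.linearCombination ℤ (c.q ∘ v)
          (l.1 - Finsupp.single (Sum.inr (n + k)) 1) ≠ 0} :=
    analyticSet_exists_countable fun n => analyticSet_forall fun k =>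
      analyticSet_inter (analyticSet_exists_countable fun m => analyticSet_exists_countable fun l =>
        c.analyticSet_linearCombination_eq_zero _)
        (analyticSet_forall fun l => c.analyticSet_linearCombination_ne_zero _)
  convert h1.image_of_continuous (f := fun v i => v (Sum.inl i)) (by fun_prop) using 1
  have key : ∀ (v : ℕ ⊕ ℕ → Cantor) (n : ℕ),
      IsNonfreeWitness (Submodule.span ℤ (Set.range ((c.q ∘ v) ∘ Sum.inl))) n
        ((c.q ∘ v) ∘ Sum.inr) ↔ ∀ k : ℕ,
      (∃ (m : {m : ℤ // m ≠ 0}) (l : Finsupp.supported ℤ ℤ (generatorIndices n)),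
        Finsupp.linearCombination ℤ (c.q ∘ v)
          (l.1 - Finsupp.single (Sum.inr (n + k)) m.1) = 0) ∧
      ∀ l : Finsupp.supported ℤ ℤ (generatorIndices (n + k)),
        Finsupp.linearCombination ℤ (c.q ∘ v)
          (l.1 - Finsupp.single (Sum.inr (n + k)) 1) ≠ 0 := by
    intro v n
    simp only [IsNonfreeWitness, mem_span_sup_span_iff, map_sub, sub_eq_zero,
      Finsupp.linearCombination_single, one_smul, not_exists, ne_eq]
    simp only [Function.comp_apply, Subtype.exists, exists_prop]
  ext s
  constructor
  · rintro ⟨hs, n, w, hw⟩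
    choose y hy hyw using fun i => c.surj (w i)
    obtain rfl : c.q ∘ y = w := funext hyw
    refine ⟨Sum.elim s y, ⟨n, fun k => ?_⟩, rfl⟩
    have hB : ∀ i, Sum.elim s y i ∈ c.Bstar := by rintro (i | i) <;> simp [hs, hy]
    obtain ⟨⟨m, l, h⟩, h'⟩ := (key (Sum.elim s y) n).1 hw k
    exact ⟨⟨m, l, hB, h⟩, fun l => ⟨hB, h' l⟩⟩
  · rintro ⟨v, ⟨n, h⟩, rfl⟩
    have hB := ((h 0).2 0).1
    refine ⟨fun i => hB _, n, c.q ∘ v ∘ Sum.inr, (key v n).2 fun k => ?_⟩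
    obtain ⟨⟨m, l, -, h0⟩, h'⟩ := h k
    exact ⟨⟨m, l, h0⟩, fun l => (h' l).2⟩

end BorelCode

end Analytic

section Dichotomy

/-- The list `l` is an initial segment of the sequence `s`. -/
def IsInitialSegment {α : Type*} (l : List α) (s : ℕ → α) : Prop :=
  ∀ i a, l[i]? = some a → s i = a

theorem isInitialSegment_nil {α : Type*} (s : ℕ → α) : IsInitialSegment [] s := by
  intro i a h
  simp at h

theorem IsInitialSegment.of_isPrefix {α : Type*} {l l' : List α} {s : ℕ → α} (h : l <+: l')
    (hl' : IsInitialSegment l' s) : IsInitialSegment l s := fun i a hi =>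
  hl' i a (by
    obtain ⟨t, rfl⟩ := h
    rw [List.getElem?_append_left (List.getElem?_eq_some_iff.1 hi).1, hi])

theorem IsInitialSegment.concat {α : Type*} {l : List α} {s : ℕ → α} (h : IsInitialSegment l s) :
    IsInitialSegment (l ++ [s l.length]) s := by
  intro i a hi
  rcases lt_trichotomy i l.length with h1 | rfl | h1
  · rw [List.getElem?_append_left h1] at hi
    exact h i a hi
  · simpa using hi
  · rw [List.getElem?_eq_none (by simp; omega)] at hi
    cases hi

theorem IsInitialSegment.isPrefix {α : Type*} {l l' : List α} {s : ℕ → α}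
    (h : IsInitialSegment l s) (h' : IsInitialSegment l' s) (hlen : l.length ≤ l'.length) :
    l <+: l' := by
  rw [List.prefix_iff_getElem?]
  intro i hi
  rw [List.getElem?_eq_getElem (hi.trans_le hlen), ← h i l[i] (List.getElem?_eq_getElem hi),
    h' i _ (List.getElem?_eq_getElem (hi.trans_le hlen))]

theorem IsInitialSegment.mem_range {α : Type*} {l : List α} {s : ℕ → α}
    (h : IsInitialSegment l s) {a : α} (ha : a ∈ l) : a ∈ Set.range s := by
  obtain ⟨i, hi⟩ := List.mem_iff_getElem?.1 ha
  exact ⟨i, h i a hi⟩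

theorem exists_isInitialSegment {α : Type*} (l : ℕ → List α) (hl : ∀ k, l k <+: l (k + 1))
    (hlen : ∀ k, k ≤ (l k).length) :
    ∃ s : ℕ → α, (∀ k, IsInitialSegment (l k) s) ∧ ∀ i, s i ∈ l (i + 1) := by
  have hmono : ∀ j k, j ≤ k → l j <+: l k := fun j k hjk => by
    induction hjk with
    | refl => exact List.prefix_rfl
    | step _ ih => exact ih.trans (hl _)
  refine ⟨fun i => (l (i + 1))[i]'(hlen (i + 1)), fun k i a hi => ?_, fun i => by simp⟩
  have hext : ∀ j k : ℕ, j ≤ k → ∀ (i : ℕ) (a : α), (l j)[i]? = some a → (l k)[i]? = some a := by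
    intro j k hjk i a hi
    obtain ⟨t, ht⟩ := hmono j k hjk
    rw [← ht, List.getElem?_append_left (List.getElem?_eq_some_iff.1 hi).1, hi]
  have h1 := hext _ _ (le_max_left k (i + 1)) i a hi
  have h2 := hext _ _ (le_max_right k (i + 1)) i _ (List.getElem?_eq_getElem (hlen (i + 1)))
  rw [h1] at h2
  exact (Option.some_injective _ h2).symm

theorem exists_generic_enumeration {α : Type*} {A : Set α} (hA : A.Countable) (hne : A.Nonempty)
    (D : ℕ → List α → List α) (hD : ∀ n l, l <+: D n l)
    (hDA : ∀ n l, (∀ x ∈ l, x ∈ A) → ∀ x ∈ D n l, x ∈ A) :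
    ∃ s : ℕ → α, Set.range s = A ∧ ∀ n N, ∃ l : List α, N ≤ l.length ∧ (∀ x ∈ l, x ∈ A) ∧
      IsInitialSegment (D n l) s := by
  obtain ⟨e, rfl⟩ := hA.exists_eq_range hne
  let l : ℕ → List α := fun k => Nat.rec [] (fun k p => D k.unpair.1 p ++ [e k.unpair.2]) k
  have hsucc : ∀ k, l (k + 1) = D k.unpair.1 (l k) ++ [e k.unpair.2] := fun k => rfl
  have hlA : ∀ k, ∀ x ∈ l k, x ∈ Set.range e := by
    intro k
    induction k with
    | zero => simp [l]
    | succ k ih =>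
      intro x hx
      rw [hsucc, List.mem_append, List.mem_singleton] at hx
      rcases hx with hx | rfl
      · exact hDA _ _ ih x hx
      · exact ⟨_, rfl⟩
  have hlen : ∀ k, k ≤ (l k).length := by
    intro k
    induction k with
    | zero => simp
    | succ k ih =>
      have := (hD k.unpair.1 (l k)).length_le
      rw [hsucc, List.length_append, List.length_singleton]
      omega
  have hDl : ∀ k, D k.unpair.1 (l k) <+: l (k + 1) := fun k => by
    rw [hsucc]
    exact List.prefix_append _ _
  obtain ⟨s, hs, hs'⟩ := exists_isInitialSegment l (fun k => (hD _ _).trans (hDl k)) hlen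
  refine ⟨s, Set.Subset.antisymm ?_ ?_, fun n N => ⟨l (Nat.pair n N),
    (Nat.right_le_pair n N).trans (hlen _), hlA _, ?_⟩⟩
  · rintro _ ⟨i, rfl⟩
    exact hlA (i + 1) _ (hs' i)
  · rintro _ ⟨m, rfl⟩
    refine (hs (Nat.pair 0 m + 1)).mem_range ?_
    simp [hsucc]
  · have := (hs (Nat.pair n N + 1)).of_isPrefix (hDl (Nat.pair n N))
    rwa [Nat.unpair_pair] at this

universe u

variable {α : Type u} {Y : Type*} (ρ : α → Y) (f : (ℕ → ℕ) → ℕ → Y)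

/-- The pair `(r, t)` lies in the tree of finite approximations to a pair `(s, x)` with
`f x = ρ ∘ s`. -/
def IsCompatible (r : List α) (t : List ℕ) : Prop :=
  ∃ x, IsInitialSegment t x ∧ ∀ i a, r[i]? = some a → f x i = ρ a

/-- Generically, no extension of `(p, t)` yields a solution of `f x = ρ ∘ s`; the ordinal bounds
the rank of the derivation. -/
inductive IsNegligible : Ordinal.{u} → List α → List ℕ → Prop
  | intro (o : Ordinal.{u}) (p : List α) (t : List ℕ) (r : List α → List α)
      (o' : List α → ℕ → Ordinal.{u}) (hr : ∀ q, p <+: q → q <+: r q)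
      (ho' : ∀ q, p <+: q → IsCompatible ρ f (r q) t → ∀ n, o' q n < o)
      (h : ∀ q, p <+: q → IsCompatible ρ f (r q) t → ∀ n,
        IsNegligible (o' q n) (r q) (t ++ [n])) : IsNegligible o p t

theorem isNegligible_iff {o : Ordinal.{u}} {p : List α} {t : List ℕ} :
    IsNegligible ρ f o p t ↔ ∀ q, p <+: q → ∃ r, q <+: r ∧
      (IsCompatible ρ f r t → ∀ n, ∃ o' < o, IsNegligible ρ f o' r (t ++ [n])) := by
  constructor
  · rintro ⟨_, _, _, r, o', hr, ho', h⟩ q hq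
    exact ⟨r q, hr q hq, fun hc n => ⟨o' q n, ho' q hq hc n, h q hq hc n⟩⟩
  · intro h
    choose! r hr h using h
    choose! o' ho' h using h
    exact .intro o p t r o' hr ho' h

theorem exists_isNegligible_of_forall {p : List α} {t : List ℕ}
    (h : ∀ q, p <+: q → ∃ r, q <+: r ∧
      (IsCompatible ρ f r t → ∀ n, ∃ o, IsNegligible ρ f o r (t ++ [n]))) :
    ∃ o, IsNegligible ρ f o p t := by
  choose! r hr h using h
  choose! o' h using h
  refine ⟨⨆ z : List α × ℕ, Order.succ (o' z.1 z.2), (isNegligible_iff ρ f).2 fun q hq =>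
    ⟨r q, hr q hq, fun hc n => ⟨o' q n, ?_, h q hq hc n⟩⟩⟩
  exact (Order.lt_succ _).trans_le
    (Ordinal.le_iSup (fun z : List α × ℕ => Order.succ (o' z.1 z.2)) (q, n))

/-- A set is closed under `Φ` if it contains `Φ l` for every list `l` of its elements. -/
def IsClosedUnder (Φ : List α → Set α) (A : Set α) : Prop :=
  ∀ l : List α, (∀ x ∈ l, x ∈ A) → Φ l ⊆ A

theorem exists_closure_of_isNegligible {o₀ : Ordinal.{u}} (h₀ : IsNegligible ρ f o₀ [] []) :
    ∃ Φ : List α → Set α, (∀ l, (Φ l).Countable) ∧ ∀ A : Set α, A.Countable → A.Nonempty →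
      IsClosedUnder Φ A → ∃ s : ℕ → α, Set.range s = A ∧ ρ ∘ s ∉ Set.range f := by
  have hR : ∀ (q : List α) (t : List ℕ), ∃ r, q <+: r ∧ ∀ p o, p <+: q → IsNegligible ρ f o p t →
      IsCompatible ρ f r t → ∀ n, ∃ o' < o, IsNegligible ρ f o' r (t ++ [n]) := by
    intro q t
    by_cases hex : ∃ o, ∃ r, q <+: r ∧
        (IsCompatible ρ f r t → ∀ n, ∃ o' < o, IsNegligible ρ f o' r (t ++ [n]))
    · obtain ⟨m, ⟨r, hr, h⟩, hmin⟩ := WellFounded.has_min wellFounded_lt {o : Ordinal.{u} | _} hex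
      refine ⟨r, hr, fun p o hp hn hc n => ?_⟩
      obtain ⟨o', ho', h'⟩ := h hc n
      refine ⟨o', ho'.trans_le ?_, h'⟩
      exact not_lt.1 (hmin o ((isNegligible_iff ρ f).1 hn q hp))
    · exact ⟨q, List.prefix_rfl, fun p o hp hn => absurd ⟨o, (isNegligible_iff ρ f).1 hn q hp⟩ hex⟩
  choose R hqR hR using hR
  refine ⟨fun q => ⋃ t, {a | a ∈ R q t}, fun q => Set.countable_iUnion fun t =>
    (List.finite_toSet _).countable, fun A hA hne hcl => ?_⟩
  obtain ⟨d, hd⟩ := exists_surjective_nat (List ℕ)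
  obtain ⟨s, hs, hgen⟩ := exists_generic_enumeration hA hne (fun n l => R l (d n))
    (fun n l => hqR _ _) (fun n l hl x hx => hcl l hl (Set.mem_iUnion.2 ⟨d n, hx⟩))
  refine ⟨s, hs, ?_⟩
  rintro ⟨x, hx⟩
  have key : ∀ o p t, IsNegligible ρ f o p t → IsInitialSegment p s → ¬ IsInitialSegment t x := by
    intro o
    induction o using WellFoundedLT.induction with
    | ind o ih =>
      intro p t hn hp ht
      obtain ⟨n, rfl⟩ := hd t
      obtain ⟨l, hlen, -, hl⟩ := hgen n p.length
      have hpl : p <+: l := hp.isPrefix (hl.of_isPrefix (hqR _ _)) hlen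
      have hc : IsCompatible ρ f (R l (d n)) (d n) :=
        ⟨x, ht, fun i a hi => by rw [hx, Function.comp_apply, hl i a hi]⟩
      obtain ⟨o', ho', h'⟩ := hR l (d n) p o hpl hn hc (x (d n).length)
      exact ih o' ho' _ _ h' hl ht.concat
  exact key o₀ [] [] h₀ (isInitialSegment_nil s) (isInitialSegment_nil x)

theorem exists_closure_of_not_isNegligible [TopologicalSpace Y] [T2Space Y] (hf : Continuous f)
    (h₀ : ∀ o, ¬ IsNegligible ρ f o [] []) :
    ∃ Φ : List α → Set α, (∀ l, (Φ l).Countable) ∧ ∀ A : Set α, A.Countable → A.Nonempty →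
      IsClosedUnder Φ A → ∃ s : ℕ → α, Set.range s = A ∧ ρ ∘ s ∈ Set.range f := by
  have hQ : ∀ (p : List α) (t : List ℕ), ∃ q, (∀ o, ¬ IsNegligible ρ f o p t) → p <+: q ∧
      ∀ r, q <+: r → IsCompatible ρ f r t ∧ ∃ n, ∀ o, ¬ IsNegligible ρ f o r (t ++ [n]) := by
    intro p t
    by_contra! hcon
    refine absurd (exists_isNegligible_of_forall ρ f fun q hq => ?_)
      (not_exists.2 (hcon []).1)
    obtain ⟨r, hr, h⟩ := (hcon q).2 hq
    exact ⟨r, hr, h⟩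
  choose Q hQ using hQ
  refine ⟨fun q => ⋃ t, {a | a ∈ Q q t}, fun q => Set.countable_iUnion fun t =>
    (List.finite_toSet _).countable, fun A hA hne hcl => ?_⟩
  obtain ⟨e, rfl⟩ := hA.exists_eq_range hne
  let S := {z : List α × List ℕ // (∀ x ∈ z.1, x ∈ Set.range e) ∧
    ∀ o, ¬ IsNegligible ρ f o z.1 z.2}
  have hstep : ∀ (k : ℕ) (z : S), ∃ z' : S, z.1.1 <+: z'.1.1 ∧
      z.1.1.length < z'.1.1.length ∧ e k ∈ z'.1.1 ∧ IsCompatible ρ f z'.1.1 z.1.2 ∧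
      ∃ n, z'.1.2 = z.1.2 ++ [n] := by
    rintro k ⟨⟨p, t⟩, hp, hn⟩
    obtain ⟨hpq, h⟩ := hQ p t hn
    obtain ⟨hc, n, hn'⟩ := h (Q p t ++ [e k]) (List.prefix_append _ _)
    refine ⟨⟨(Q p t ++ [e k], t ++ [n]), ?_, hn'⟩, hpq.trans (List.prefix_append _ _), ?_, by simp,
      hc, n, rfl⟩
    · intro x hx
      rcases List.mem_append.1 hx with hx | hx
      · exact hcl p hp (Set.mem_iUnion.2 ⟨t, hx⟩)
      · rw [List.mem_singleton.1 hx]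
        exact ⟨k, rfl⟩
    · have := hpq.length_le
      simp only [List.length_append, List.length_singleton]
      omega
  choose next hnext using hstep
  let z : ℕ → S := fun k => Nat.rec ⟨([], []), by simp, h₀⟩ next k
  have hz : ∀ k, z (k + 1) = next k (z k) := fun k => rfl
  have hlen₁ : ∀ k, k ≤ (z k).1.1.length := by
    intro k
    induction k with
    | zero => exact Nat.zero_le _
    | succ k ih => exact ih.trans_lt (hz k ▸ (hnext k (z k)).2.1)
  have hlen₂ : ∀ k, (z k).1.2.length = k := by
    intro k
    induction k with
    | zero => rfl
    | succ k ih =>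
      obtain ⟨n, hn⟩ := (hnext k (z k)).2.2.2.2
      rw [hz, hn, List.length_append, ih, List.length_singleton]
  obtain ⟨s, hs, hs'⟩ := exists_isInitialSegment (fun k => (z k).1.1)
    (fun k => (hnext k (z k)).1) hlen₁
  obtain ⟨x, hx, -⟩ := exists_isInitialSegment (fun k => (z k).1.2)
    (fun k => by
      obtain ⟨n, hn⟩ := (hnext k (z k)).2.2.2.2
      rw [hz, hn]
      exact List.prefix_append _ _) (fun k => (hlen₂ k).ge)
  refine ⟨s, Set.Subset.antisymm ?_ ?_, x, funext fun i => ?_⟩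
  · rintro _ ⟨i, rfl⟩
    exact (z (i + 1)).2.1 _ (hs' i)
  · rintro _ ⟨k, rfl⟩
    exact (hs (k + 1)).mem_range (hnext k (z k)).2.2.1
  · choose y hy hyf using fun k => (hnext k (z k)).2.2.2.1
    have hlim : Filter.Tendsto y Filter.atTop (nhds x) := by
      rw [tendsto_pi_nhds]
      intro i
      refine tendsto_const_nhds.congr' ?_
      filter_upwards [Filter.eventually_gt_atTop i] with k hk
      have hi : i < (z k).1.2.length := by rwa [hlen₂]
      rw [hx k i _ (List.getElem?_eq_getElem hi), hy k i _ (List.getElem?_eq_getElem hi)]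
    have h1 := tendsto_pi_nhds.1 ((hf.tendsto x).comp hlim) i
    refine tendsto_nhds_unique h1 (tendsto_const_nhds.congr' ?_)
    filter_upwards [Filter.eventually_ge_atTop i] with k hk
    have hi : i < (z (k + 1)).1.1.length := hk.trans_lt (hlen₁ (k + 1))
    rw [Function.comp_apply, Function.comp_apply, hyf k i _ (List.getElem?_eq_getElem hi),
      hs (k + 1) i _ (List.getElem?_eq_getElem hi)]

/-- For an analytic set `P` of sequences, either almost every countable set has an enumeration in
`P`, or almost every countable set has an enumeration outside `P`. -/
theorem exists_closure_dichotomy [TopologicalSpace Y] [T2Space Y] {P : Set (ℕ → Y)} (hP : AnalyticSet P) :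
    ∃ Φ : List α → Set α, (∀ l, (Φ l).Countable) ∧
      ((∀ A : Set α, A.Countable → A.Nonempty → IsClosedUnder Φ A →
        ∃ s : ℕ → α, Set.range s = A ∧ ρ ∘ s ∈ P) ∨
      (∀ A : Set α, A.Countable → A.Nonempty → IsClosedUnder Φ A →
        ∃ s : ℕ → α, Set.range s = A ∧ ρ ∘ s ∉ P)) := by
  rw [AnalyticSet] at hP
  obtain rfl | ⟨f, hf, rfl⟩ := hP
  · refine ⟨fun _ => ∅, fun _ => Set.countable_empty, Or.inr fun A hA hne _ => ?_⟩
    obtain ⟨s, hs⟩ := hA.exists_eq_range hne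
    exact ⟨s, hs.symm, Set.notMem_empty _⟩
  · by_cases h₀ : ∃ o, IsNegligible ρ f o [] []
    · obtain ⟨o, h₀⟩ := h₀
      obtain ⟨Φ, hΦ, h⟩ := exists_closure_of_isNegligible ρ f h₀
      exact ⟨Φ, hΦ, Or.inr h⟩
    · obtain ⟨Φ, hΦ, h⟩ := exists_closure_of_not_isNegligible ρ f hf (not_exists.1 h₀)
      exact ⟨Φ, hΦ, Or.inl h⟩

end Dichotomy

section Closure

theorem IsClosedUnder.sInter {α : Type*} {Φ : List α → Set α} {S : Set (Set α)}
    (hS : ∀ A ∈ S, IsClosedUnder Φ A) : IsClosedUnder Φ (⋂₀ S) := fun l hl =>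
  Set.subset_sInter fun A hA => hS A hA l fun x hx => hl x hx A hA

theorem exists_countable_isClosedUnder {α : Type*} {Φ : List α → Set α}
    (hΦ : ∀ l, (Φ l).Countable) {X : Set α} (hX : X.Countable) :
    ∃ Y : Set α, X ⊆ Y ∧ Y.Countable ∧ IsClosedUnder Φ Y := by
  let F : Set α → Set α := fun Y => Y ∪ ⋃ l : List Y, Φ (l.map Subtype.val)
  have hF : ∀ Y, Y.Countable → (F Y).Countable := fun Y hY => by
    have := hY.to_subtype
    exact hY.union (Set.countable_iUnion fun l => hΦ _)
  have hmono : Monotone fun n => F^[n] X := monotone_nat_of_le_succ fun n => by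
    rw [Function.iterate_succ_apply']
    exact Set.subset_union_left
  refine ⟨⋃ n, F^[n] X, Set.subset_iUnion (fun n => F^[n] X) 0, Set.countable_iUnion fun n => ?_,
    fun l hl => ?_⟩
  · induction n with
    | zero => exact hX
    | succ n ih =>
      rw [Function.iterate_succ_apply']
      exact hF _ ih
  · obtain ⟨n, hn⟩ : ∃ n, ∀ x ∈ l, x ∈ F^[n] X := by
      induction l with
      | nil => exact ⟨0, by simp⟩
      | cons a l ih =>
        obtain ⟨n, hn⟩ := ih fun x hx => hl x (List.mem_cons_of_mem _ hx)
        obtain ⟨m, hm⟩ := Set.mem_iUnion.1 (hl a List.mem_cons_self)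
        refine ⟨max n m, fun x hx => ?_⟩
        rcases List.mem_cons.1 hx with rfl | hx
        · exact hmono (le_max_right n m) hm
        · exact hmono (le_max_left n m) (hn x hx)
    refine Set.Subset.trans ?_ (Set.subset_iUnion (fun n => F^[n] X) (n + 1))
    rw [Function.iterate_succ_apply']
    lift l to List (F^[n] X) using hn
    exact (Set.subset_iUnion (fun l : List (F^[n] X) => Φ (l.map Subtype.val)) l).trans
      Set.subset_union_right

variable {G : Type*} [AddCommGroup G]

/-- The operation `Φ` enlarged so that closed sets are pure subgroups. -/
def pureHull (Φ : List G → Set G) (l : List G) : Set G :=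
  Φ l ∪ pureClosure (Submodule.span ℤ {x | x ∈ l})

theorem countable_pureHull [Module.IsTorsionFree ℤ G] {Φ : List G → Set G}
    (hΦ : ∀ l, (Φ l).Countable) (l : List G) : (pureHull Φ l).Countable := by
  refine (hΦ l).union ?_
  have h1 : ((Submodule.span ℤ {x | x ∈ l} : Submodule ℤ G) : Set G).Countable := by
    have : Countable {x | x ∈ l} := (List.finite_toSet l).countable
    rw [← Subtype.range_coe (s := {x | x ∈ l}), ← Finsupp.range_linearCombination]
    exact Set.countable_range _
  have h2 : ((pureClosure (Submodule.span ℤ {x | x ∈ l}) : Submodule ℤ G) : Set G) =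
      ⋃ m : {m : ℤ // m ≠ 0}, (fun x : G => m.1 • x) ⁻¹'
        (Submodule.span ℤ {x | x ∈ l} : Submodule ℤ G) := by
    ext x
    simp [mem_pureClosure]
  rw [h2]
  exact Set.countable_iUnion fun m => h1.preimage (smul_right_injective G m.2)

theorem IsClosedUnder.of_pureHull {Φ : List G → Set G} {A : Set G}
    (hA : IsClosedUnder (pureHull Φ) A) : IsClosedUnder Φ A :=
  fun l hl => Set.subset_union_left.trans (hA l hl)

theorem IsClosedUnder.exists_submodule {Φ : List G → Set G} {Y : Set G}
    (hY : IsClosedUnder (pureHull Φ) Y) : ∃ A : Submodule ℤ G, (A : Set G) = Y := by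
  have h : ∀ l : List G, (∀ x ∈ l, x ∈ Y) → ∀ y ∈ Submodule.span ℤ {x | x ∈ l}, y ∈ Y :=
    fun l hl y hy => hY l hl (Or.inr (le_pureClosure _ hy))
  refine ⟨⟨⟨⟨Y, fun {a b} ha hb => ?_⟩, ?_⟩, fun m a ha => ?_⟩, rfl⟩
  · exact h [a, b] (by simp [ha, hb]) _ (add_mem (Submodule.subset_span (by simp))
      (Submodule.subset_span (by simp)))
  · exact h [] (by simp) _ (zero_mem _)
  · exact h [a] (by simpa using ha) _ (Submodule.smul_mem _ _ (Submodule.subset_span (by simp)))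

theorem IsClosedUnder.mem_of_smul_mem {Φ : List G → Set G} {A : Submodule ℤ G}
    (hA : IsClosedUnder (pureHull Φ) (A : Set G)) (m : ℤ) (hm : m ≠ 0) (x : G)
    (hx : m • x ∈ A) : x ∈ A :=
  hA [m • x] (by simpa using hx) (Or.inr ⟨m, hm, Submodule.subset_span (by simp)⟩)

theorem isClosedUnder_sSup {Φ : List G → Set G} {S : Set (Submodule ℤ G)} (hne : S.Nonempty)
    (hdir : DirectedOn (· ≤ ·) S) (hS : ∀ A ∈ S, IsClosedUnder Φ (A : Set G)) :
    IsClosedUnder Φ ((sSup S : Submodule ℤ G) : Set G) := by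
  intro l hl
  obtain ⟨A, hA, hlA⟩ : ∃ A ∈ S, ∀ x ∈ l, x ∈ A := by
    induction l with
    | nil =>
      obtain ⟨A, hA⟩ := hne
      exact ⟨A, hA, by simp⟩
    | cons a l ih =>
      obtain ⟨A, hA, hlA⟩ := ih fun x hx => hl x (List.mem_cons_of_mem _ hx)
      obtain ⟨A', hA', ha⟩ := (Submodule.mem_sSup_of_directed hne hdir).1
        (hl a List.mem_cons_self)
      obtain ⟨C, hC, h1, h2⟩ := hdir A hA A' hA'
      refine ⟨C, hC, fun x hx => ?_⟩
      rcases List.mem_cons.1 hx with rfl | hx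
      · exact h2 ha
      · exact h1 (hlA x hx)
  exact (hS A hA l hlA).trans (le_sSup hA : A ≤ sSup S)

theorem countable_sSup {S : Set (Submodule ℤ G)} (hne : S.Nonempty) (hcount : S.Countable)
    (hdir : DirectedOn (· ≤ ·) S) (hS : ∀ A ∈ S, (A : Set G).Countable) :
    ((sSup S : Submodule ℤ G) : Set G).Countable := by
  refine (hcount.biUnion hS).mono fun x hx => ?_
  simpa using (Submodule.mem_sSup_of_directed hne hdir).1 hx

end Closure

section Main

variable {G : Type*} [AddCommGroup G]

theorem free_of_forall_not_isNonfreeWitness {I : Type} [LinearOrder I] [WellFoundedLT I]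
    (hI : ∀ i : I, (Set.Iic i).Countable) {g : I → G} (hg : Function.Surjective g)
    [Module.IsTorsionFree ℤ G] {Φ : List G → Set G} (hΦ : ∀ l, (Φ l).Countable)
    (hbot : ∀ n w, ¬ IsNonfreeWitness (⊥ : Submodule ℤ G) n w)
    (h : ∀ A : Submodule ℤ G, (A : Set G).Countable → IsClosedUnder (pureHull Φ) (A : Set G) →
      ∀ n w, ¬ IsNonfreeWitness A n w) : Module.Free ℤ G := by
  choose N hN using fun i : I => IsClosedUnder.exists_submodule
    (IsClosedUnder.sInter (Φ := pureHull Φ)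
      (S := {Y | g '' Set.Iic i ⊆ Y ∧ IsClosedUnder (pureHull Φ) Y}) fun A hA => hA.2)
  have hcl : ∀ i, IsClosedUnder (pureHull Φ) (N i : Set G) := fun i => by
    rw [hN i]
    exact IsClosedUnder.sInter fun A hA => hA.2
  have hgN : ∀ i, g i ∈ N i := fun i => by
    change g i ∈ (N i : Set G)
    rw [hN i]
    exact fun Y hY => hY.1 ⟨i, le_rfl, rfl⟩
  have hmono : Monotone N := fun i j hij => by
    change (N i : Set G) ⊆ N j
    rw [hN i, hN j]
    exact Set.sInter_subset_sInter fun Y hY =>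
      ⟨(Set.image_mono (Set.Iic_subset_Iic.2 hij)).trans hY.1, hY.2⟩
  have hcount : ∀ i, (N i : Set G).Countable := fun i => by
    obtain ⟨Y, hY, hYc, hYcl⟩ :=
      exists_countable_isClosedUnder (countable_pureHull hΦ) ((hI i).image g)
    rw [hN i]
    exact hYc.mono (Set.sInter_subset_of_mem ⟨hY, hYcl⟩)
  refine Module.Free.of_filtration N ?_ fun i => ?_
  · rw [eq_top_iff]
    intro x _
    obtain ⟨i, rfl⟩ := hg x
    exact Submodule.mem_iSup_of_mem i (hgN i)
  · have : Countable (N i) := (hcount i).to_subtype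
    have hle : (⨆ j < i, N j) ≤ N i := iSup₂_le fun j hj => hmono hj.le
    rcases (Set.Iio i).eq_empty_or_nonempty with hi | hi
    · have : (⨆ j < i, N j) = ⊥ := by
        rw [eq_bot_iff]
        exact iSup₂_le fun j hj => absurd (show j ∈ Set.Iio i from hj) (hi ▸ Set.notMem_empty j)
      rw [this]
      refine free_quotient_of_forall_not_isNonfreeWitness bot_le (fun m hm x hx => ?_) hbot
      exact (Submodule.mem_bot ℤ).2
        ((smul_eq_zero.1 ((Submodule.mem_bot ℤ).1 hx)).resolve_left hm)
    · have heq : (⨆ j < i, N j) = sSup (N '' Set.Iio i) := sSup_image.symm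
      have hdir : DirectedOn (· ≤ ·) (N '' Set.Iio i) := by
        rintro _ ⟨j, hj, rfl⟩ _ ⟨k, hk, rfl⟩
        exact ⟨N (max j k), ⟨_, max_lt hj hk, rfl⟩, hmono (le_max_left _ _),
          hmono (le_max_right _ _)⟩
      have hcl' : IsClosedUnder (pureHull Φ) ((⨆ j < i, N j : Submodule ℤ G) : Set G) := by
        rw [heq]
        refine isClosedUnder_sSup (hi.image N) hdir ?_
        rintro _ ⟨j, -, rfl⟩
        exact hcl j
      exact free_quotient_of_forall_not_isNonfreeWitness hle hcl'.mem_of_smul_mem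
        (h _ ((hcount i).mono hle) hcl')

theorem not_hasCharacterLifting_of_forall_isNonfreeWitness {I : Type} [LinearOrder I]
    [WellFoundedLT I] (hI : ∀ i : I, {j | j < i}.Countable) (hcard : Cardinal.continuum < #(Set I))
    [Module.IsTorsionFree ℤ G] {Φ : List G → Set G} (hΦ : ∀ l, (Φ l).Countable)
    (h : ∀ A : Submodule ℤ G, (A : Set G).Countable → IsClosedUnder (pureHull Φ) (A : Set G) →
      ∃ n w, IsNonfreeWitness A n w) : ¬ HasCharacterLifting G := by
  have hex : ∀ X : Set G, X.Countable → ∃ A : Submodule ℤ G, X ⊆ A ∧ (A : Set G).Countable ∧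
      IsClosedUnder (pureHull Φ) (A : Set G) := fun X hX => by
    obtain ⟨Y, hY, hYc, hYcl⟩ := exists_countable_isClosedUnder (countable_pureHull hΦ) hX
    obtain ⟨A, rfl⟩ := hYcl.exists_submodule
    exact ⟨A, hY, hYc, hYcl⟩
  refine not_hasCharacterLifting_of_nonlifting_steps hI hcard
    {A : Submodule ℤ G | (A : Set G).Countable ∧ IsClosedUnder (pureHull Φ) (A : Set G)}
    (fun A hA => hA.1) ?_ (fun S hS hne hc hchain => ?_) fun A hA => ?_
  · obtain ⟨A, -, hA⟩ := hex ∅ Set.countable_empty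
    exact ⟨A, hA⟩
  · exact ⟨countable_sSup hne hc hchain.directedOn fun A hA => (hS hA).1,
      isClosedUnder_sSup hne hchain.directedOn fun A hA => (hS hA).2⟩
  · obtain ⟨n, w, hw⟩ := h A hA.1 hA.2
    obtain ⟨χ, hχ, hlift⟩ := hw.exists_character
    obtain ⟨A', hsub, hA'⟩ := hex _ (hA.1.union (Set.countable_range w))
    refine ⟨A', hA', Set.subset_union_left.trans hsub, χ, hχ, fun k hk => ?_⟩
    obtain ⟨j, hj⟩ := hlift k hk
    exact ⟨w j, hsub (Or.inr ⟨j, rfl⟩), hj⟩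

theorem BorelCode.exists_isNonfreeWitness_dichotomy (c : BorelCode G) :
    ∃ Φ : List G → Set G, (∀ l, (Φ l).Countable) ∧
      ((∀ A : Submodule ℤ G, (A : Set G).Countable → IsClosedUnder Φ (A : Set G) →
        ∃ n w, IsNonfreeWitness A n w) ∨
      (∀ A : Submodule ℤ G, (A : Set G).Countable → IsClosedUnder Φ (A : Set G) →
        ∀ n w, ¬ IsNonfreeWitness A n w)) := by
  choose ρ hρ hqρ using c.surj
  obtain ⟨Φ, hΦ, h⟩ := exists_closure_dichotomy ρ c.analyticSet_isNonfreeWitness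
  have key : ∀ (A : Submodule ℤ G) (s : ℕ → G), Set.range s = A →
      Submodule.span ℤ (Set.range (c.q ∘ ρ ∘ s)) = A := fun A s hs => by
    have : c.q ∘ ρ ∘ s = s := funext fun i => hqρ (s i)
    rw [this, hs, Submodule.span_eq]
  refine ⟨Φ, hΦ, h.imp (fun h A hA hcl => ?_) fun h A hA hcl n w hw => ?_⟩
  · obtain ⟨s, hs, -, n, w, hw⟩ := h A hA ⟨0, zero_mem A⟩ hcl
    rw [key A s hs] at hw
    exact ⟨n, w, hw⟩
  · obtain ⟨s, hs, hP⟩ := h A hA ⟨0, zero_mem A⟩ hcl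
    refine hP ⟨fun i => hρ _, n, w, ?_⟩
    rwa [key A s hs]

theorem BorelCode.surjective_q (c : BorelCode G) : Function.Surjective c.q :=
  fun b => (c.surj b).imp fun _ h => h.2

theorem BorelCode.hasCharacterLifting.{u, v} {B : Type u} [AddCommGroup B] (c : BorelCode B)
    (hB : IsWhitehead.{u, v} B) : HasCharacterLifting B := by
  have : Small.{v} B := small_of_surjective c.surjective_q
  exact hB.hasCharacterLifting

end Main

/-- Assuming the continuum hypothesis, every Borel Whitehead group is free. -/
theorem borel_whitehead_free_of_CH
    (hch : (2 : Cardinal) ^ Cardinal.aleph 0 = Cardinal.aleph 1)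
    (B : Type*) [AddCommGroup B] (hcode : HasBorelCode B) (hwh : IsWhitehead B) :
    Module.Free ℤ B := by
  obtain ⟨c⟩ := hcode
  have hlift := c.hasCharacterLifting hwh
  have := hlift.isTorsionFree
  have hch₀ : Cardinal.continuum.{0} = Cardinal.aleph 1 := by
    apply Cardinal.lift_injective
    rw [Cardinal.lift_continuum, Cardinal.lift_aleph, Ordinal.lift_one, ← hch,
      Cardinal.aleph_zero, Cardinal.two_power_aleph0]
  let I := (Cardinal.aleph.{0} 1).ord.ToType
  have hmk : #I = Cardinal.continuum := by rw [hch₀, Cardinal.mk_ord_toType]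
  have hIio : ∀ i : I, (Set.Iio i).Countable := fun i => by
    rw [← Cardinal.le_aleph0_iff_set_countable, ← Order.lt_succ_iff, ← Cardinal.aleph_zero,
      Cardinal.succ_aleph]
    simpa [I] using Cardinal.mk_Iio_lt i (by simp [I])
  obtain ⟨e⟩ : Nonempty (I ≃ Cantor) := by
    rw [← Cardinal.eq, hmk]
    simp
  obtain ⟨Φ, hΦ, h | h⟩ := c.exists_isNonfreeWitness_dichotomy
  · refine absurd hlift (not_hasCharacterLifting_of_forall_isNonfreeWitness hIio ?_ hΦ
      fun A hA hcl => h A hA hcl.of_pureHull)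
    rw [Cardinal.mk_set, hmk]
    exact Cardinal.cantor _
  · refine free_of_forall_not_isNonfreeWitness (I := I) (fun i => ?_) (c.surjective_q.comp e.surjective) hΦ
      (fun n w hw => ?_) fun A hA hcl => h A hA hcl.of_pureHull
    · rw [← Set.Iio_insert]
      exact (hIio i).insert i
    · obtain ⟨χ, -, hχ⟩ := hw.exists_character
      obtain ⟨k, hk⟩ := hlift χ
      obtain ⟨j, hj⟩ := hχ k fun x hx => by rw [(Submodule.mem_bot ℤ).1 hx, map_zero]
      exact hj (hk _)
end

section
/- Every abelian group that has a Souslin code and is a Whitehead group is ℵ₂-free. -/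
open MeasureTheory Cardinal

/-- A Souslin code for an abelian group `B`: an analytic set `Bstar ⊆ Cantor`, an analytic
set `E ⊆ Cantor × Cantor` whose restriction to `Bstar × Bstar` is an equivalence relation,
and a surjection `q : Bstar → B` inducing the group structure, such that the graph of
addition is analytic. -/
structure SouslinCode (B : Type*) [AddCommGroup B] where
  Bstar : Set Cantor
  E : Set (Cantor × Cantor)
  q : Cantor → B
  analytic_Bstar : AnalyticSet Bstar
  analytic_E : AnalyticSet E
  refl : ∀ x ∈ Bstar, (x, x) ∈ E
  symm : ∀ x ∈ Bstar, ∀ y ∈ Bstar, (x, y) ∈ E → (y, x) ∈ E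
  trans : ∀ x ∈ Bstar, ∀ y ∈ Bstar, ∀ z ∈ Bstar, (x, y) ∈ E → (y, z) ∈ E → (x, z) ∈ E
  surj : ∀ b : B, ∃ x ∈ Bstar, q x = b
  q_eq_iff : ∀ x ∈ Bstar, ∀ y ∈ Bstar, (q x = q y ↔ (x, y) ∈ E)
  analytic_add : AnalyticSet {p : Cantor × Cantor × Cantor |
    p.1 ∈ Bstar ∧ p.2.1 ∈ Bstar ∧ p.2.2 ∈ Bstar ∧ q p.1 + q p.2.1 = q p.2.2}

/-- An abelian group has a Souslin code. -/
def HasSouslinCode (B : Type*) [AddCommGroup B] : Prop := Nonempty (SouslinCode B)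

/-- An abelian group is ℵ₂-free if every subgroup of cardinality at most ℵ₁ is a free
abelian group. -/
def Aleph2Free (B : Type*) [AddCommGroup B] : Prop :=
  ∀ K : AddSubgroup B, Cardinal.mk K ≤ Cardinal.aleph 1 → Module.Free ℤ K

namespace SouslinWhitehead

universe u v

/-- The divisible group `ℚ / ℤ`. -/
abbrev QZ : Type := AddCircle (1 : ℚ)

/-- Every character `B → ℚ / ℤ` lifts to a homomorphism `B → ℚ`. -/
def LiftsCharacters (B : Type*) [AddCommGroup B] : Prop :=
  ∀ χ : B →+ QZ, ∃ s : B →+ ℚ, ∀ b, ((s b : ℚ) : QZ) = χ b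

theorem baer_QZ : Module.Baer ℤ QZ := Module.Baer.of_divisible QZ

theorem baer_rat : Module.Baer ℤ ℚ := Module.Baer.of_divisible ℚ

theorem exists_extension {B C : Type*} [AddCommGroup B] [AddCommGroup C] (hC : Module.Baer ℤ C)
    (P : AddSubgroup B) (χ : P →+ C) : ∃ ψ : B →+ C, ∀ x : P, ψ x = χ x := by
  obtain ⟨ψ, hψ⟩ := hC.extension_property_addMonoidHom P.subtype Subtype.val_injective χ
  exact ⟨ψ, fun x ↦ DFunLike.congr_fun hψ x⟩

theorem exists_extension_of_quotient {B : Type*} [AddCommGroup B] (P : AddSubgroup B)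
    (M : AddSubgroup (B ⧸ P)) (χ : M →+ QZ) :
    ∃ ψ : B →+ QZ, (∀ x ∈ P, ψ x = 0) ∧
      ∀ x (hx : QuotientAddGroup.mk' P x ∈ M), ψ x = χ ⟨_, hx⟩ := by
  obtain ⟨ψ, hψ⟩ := exists_extension baer_QZ M χ
  refine ⟨ψ.comp (QuotientAddGroup.mk' P), fun x hx ↦ ?_, fun x hx ↦ hψ ⟨_, hx⟩⟩
  have : QuotientAddGroup.mk' P x = 0 := (QuotientAddGroup.eq_zero_iff x).2 hx
  simp only [AddMonoidHom.comp_apply, this, map_zero]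

theorem LiftsCharacters.torsionFree {B : Type*} [AddCommGroup B] (hB : LiftsCharacters B)
    {k : ℤ} (hk : k ≠ 0) {x : B} (hx : k • x = 0) : x = 0 := by
  by_contra hne
  obtain ⟨χ, hχ⟩ := CharacterModule.exists_character_apply_ne_zero_of_ne_zero hne
  obtain ⟨s, hs⟩ := hB χ
  have h1 : k • s x = 0 := by rw [← map_zsmul, hx, map_zero]
  have h2 : s x = 0 := by simpa [hk] using h1
  apply hχ
  have := hs x
  rw [h2] at this
  exact this.symm

theorem coe_QZ_eq_zero {x : ℚ} : (x : QZ) = 0 ↔ ∃ n : ℤ, x = n := by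
  rw [AddCircle.coe_eq_zero_iff]
  simp [eq_comm]

/-- The pullback of `ℚ → ℚ / ℤ` along a character. -/
def pullback {B : Type*} [AddCommGroup B] (χ : B →+ QZ) : AddSubgroup (B × ℚ) where
  carrier := {p | ((p.2 : ℚ) : QZ) = χ p.1}
  add_mem' := by
    intro a b ha hb
    simp only [Set.mem_ofPred_eq, Prod.snd_add, Prod.fst_add, map_add, AddCircle.coe_add] at *
    rw [ha, hb]
  zero_mem' := by simp
  neg_mem' := by
    intro a ha
    simp only [Set.mem_ofPred_eq, Prod.snd_neg, Prod.fst_neg, map_neg, AddCircle.coe_neg] at *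
    rw [ha]

theorem mem_pullback {B : Type*} [AddCommGroup B] {χ : B →+ QZ} {p : B × ℚ} :
    p ∈ pullback χ ↔ ((p.2 : ℚ) : QZ) = χ p.1 := Iff.rfl

theorem liftsCharacters_of_isWhitehead {B : Type u} [AddCommGroup B] [Small.{v} B]
    (h : IsWhitehead.{u, v} B) : LiftsCharacters B := by
  intro χ
  have : Small.{v} (pullback χ) := by
    have : Small.{v} (B × ℚ) := inferInstance
    exact small_subtype _ _
  let e : Shrink.{v} (pullback χ) ≃+ pullback χ := Shrink.addEquiv
  let f : Shrink.{v} (pullback χ) →+ B :=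
    (AddMonoidHom.fst B ℚ).comp ((pullback χ).subtype.comp e.toAddMonoidHom)
  have hf : ∀ x, f x = (e x).1.1 := fun _ ↦ rfl
  have hsurj : Function.Surjective f := by
    intro b
    obtain ⟨x, hx⟩ := QuotientAddGroup.mk_surjective (χ b)
    refine ⟨e.symm ⟨(b, x), hx⟩, ?_⟩
    rw [hf, e.apply_symm_apply]
  have hker : Nonempty (f.ker ≃+ ℤ) := by
    let g : ℤ →+ f.ker :=
      { toFun := fun n ↦ ⟨e.symm ⟨(0, n), by
          rw [mem_pullback, map_zero, coe_QZ_eq_zero]; exact ⟨n, rfl⟩⟩, by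
          rw [AddMonoidHom.mem_ker, hf, e.apply_symm_apply]⟩
        map_zero' := by
          apply Subtype.ext
          show e.symm _ = 0
          refine e.symm_apply_eq.2 ?_
          refine Eq.trans ?_ (map_zero e).symm
          apply Subtype.ext
          simp
        map_add' := by
          intro m n
          apply Subtype.ext
          show e.symm _ = e.symm _ + e.symm _
          rw [← map_add]
          congr 1
          apply Subtype.ext
          simp }
    refine ⟨(AddEquiv.ofBijective g ⟨?_, ?_⟩).symm⟩
    · intro m n hmn
      have h1 := congrArg Subtype.val hmn
      have h2 := congrArg Subtype.val (e.symm.injective h1)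
      simpa using h2
    · rintro ⟨x, hx⟩
      rw [AddMonoidHom.mem_ker, hf] at hx
      have h2 := mem_pullback.1 (e x).2
      rw [hx, map_zero, coe_QZ_eq_zero] at h2
      obtain ⟨n, hn⟩ := h2
      refine ⟨n, Subtype.ext ?_⟩
      show e.symm _ = x
      rw [e.symm_apply_eq]
      apply Subtype.ext
      exact Prod.ext hx.symm hn.symm
  obtain ⟨s, hs⟩ := h (Shrink.{v} (pullback χ)) f hsurj hker
  refine ⟨(AddMonoidHom.snd B ℚ).comp ((pullback χ).subtype.comp (e.toAddMonoidHom.comp s)),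
    fun b ↦ ?_⟩
  have h1 : f (s b) = b := DFunLike.congr_fun hs b
  have h2 := mem_pullback.1 (e (s b)).2
  rw [← hf, h1] at h2
  exact h2

/-- Homomorphisms that eventually agree pointwise on a subgroup glue to a homomorphism. -/
theorem exists_limit_character {G : Type*} [AddCommGroup G] (χ : ℕ → G →+ QZ)
    (W : ℕ → AddSubgroup G) (hW : Monotone W) (h : ∀ n, ∀ x ∈ W n, χ (n + 1) x = χ n x) :
    ∃ ψ : G →+ QZ, ∀ n, ∀ x ∈ W n, ψ x = χ n x := by
  have h' : ∀ n m, n ≤ m → ∀ x ∈ W n, χ m x = χ n x := by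
    intro n m hnm
    induction m, hnm using Nat.le_induction with
    | base => intros; rfl
    | succ m hnm ih => intro x hx; rw [h m x (hW hnm hx), ih x hx]
  have hex : ∀ x : (⨆ n, W n : AddSubgroup G), ∃ n, (x : G) ∈ W n := fun x ↦
    (AddSubgroup.mem_iSup_of_directed hW.directed_le).1 x.2
  choose N hN using hex
  let f : (⨆ n, W n : AddSubgroup G) →+ QZ := AddMonoidHom.mk' (fun x ↦ χ (N x) x) (by
    intro x y
    let m := max (N (x + y)) (max (N x) (N y))
    rw [← h' _ m (by simp [m]) _ (hN (x + y)), ← h' _ m (by simp [m]) _ (hN x),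
      ← h' _ m (by simp [m]) _ (hN y)]
    simp)
  obtain ⟨ψ, hψ⟩ := exists_extension baer_QZ _ f
  refine ⟨ψ, fun n x hx ↦ ?_⟩
  have hx' : x ∈ ⨆ n, W n := AddSubgroup.mem_iSup_of_mem n hx
  rw [hψ ⟨x, hx'⟩]
  change χ (N ⟨x, hx'⟩) x = χ n x
  rw [← h' _ (max n (N ⟨x, hx'⟩)) (by simp) _ (hN ⟨x, hx'⟩),
    ← h' _ (max n (N ⟨x, hx'⟩)) (by simp) _ hx]

theorem exists_character_separating {G : Type*} [AddCommGroup G] (W : AddSubgroup G) {x : G}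
    (hx : x ∉ W) : ∃ ψ : G →+ QZ, (∀ y ∈ W, ψ y = 0) ∧ ψ x ≠ 0 := by
  have hne : (QuotientAddGroup.mk' W x) ≠ 0 := fun h ↦ hx ((QuotientAddGroup.eq_zero_iff x).1 h)
  obtain ⟨χ, hχ⟩ : ∃ χ : G ⧸ W →+ QZ, χ (QuotientAddGroup.mk' W x) ≠ 0 :=
    CharacterModule.exists_character_apply_ne_zero_of_ne_zero hne
  refine ⟨χ.comp (QuotientAddGroup.mk' W), fun y hy ↦ ?_, hχ⟩
  have : QuotientAddGroup.mk' W y = 0 := (QuotientAddGroup.eq_zero_iff y).2 hy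
  simp only [AddMonoidHom.comp_apply, this, map_zero]

/-- A group that is not finitely generated has uncountably many characters. -/
theorem exists_character_notMem {G : Type*} [AddCommGroup G] (hG : ¬ AddGroup.FG G)
    {S : Set (G → QZ)} (hS : S.Countable) : ∃ χ : G →+ QZ, ⇑χ ∉ S := by
  rcases S.eq_empty_or_nonempty with rfl | hne
  · exact ⟨0, fun h ↦ h⟩
  obtain ⟨s, rfl⟩ := hS.exists_eq_range hne
  have step : ∀ (n : ℕ) (p : {W : AddSubgroup G // W.FG} × (G →+ QZ)),
      ∃ p' : {W : AddSubgroup G // W.FG} × (G →+ QZ), p.1.1 ≤ p'.1.1 ∧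
        (∀ x ∈ p.1.1, p'.2 x = p.2 x) ∧ ∃ x ∈ p'.1.1, p'.2 x ≠ s n x := by
    rintro n ⟨⟨W, hW⟩, χ⟩
    have : ∃ x, x ∉ W := by
      by_contra! hall
      apply hG
      rw [AddGroup.fg_def]
      convert hW
      exact ((AddSubgroup.eq_top_iff' W).2 hall).symm
    obtain ⟨x, hx⟩ := this
    obtain ⟨ψ, hψ, hψx⟩ := exists_character_separating W hx
    have hfg : (W ⊔ AddSubgroup.closure {x}).FG := hW.sup ⟨{x}, by simp⟩
    have hxm : x ∈ W ⊔ AddSubgroup.closure {x} :=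
      AddSubgroup.mem_sup_right (AddSubgroup.subset_closure rfl)
    by_cases hc : χ x = s n x
    · refine ⟨⟨⟨_, hfg⟩, χ + ψ⟩, le_sup_left, fun y hy ↦ ?_, x, hxm, ?_⟩
      · simp [hψ y hy]
      · simpa [hc] using hψx
    · exact ⟨⟨⟨_, hfg⟩, χ⟩, le_sup_left, fun y hy ↦ rfl, x, hxm, hc⟩
  choose F hF1 hF2 hF3 using step
  let p : ℕ → {W : AddSubgroup G // W.FG} × (G →+ QZ) :=
    fun n ↦ Nat.rec ⟨⟨⊥, ⟨∅, by simp⟩⟩, 0⟩ (fun n p ↦ F n p) n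
  obtain ⟨ψ, hψ⟩ := exists_limit_character (fun n ↦ (p n).2) (fun n ↦ (p n).1.1)
    (monotone_nat_of_le_succ fun n ↦ hF1 n (p n)) (fun n x hx ↦ hF2 n (p n) x hx)
  refine ⟨ψ, ?_⟩
  rintro ⟨n, hn⟩
  obtain ⟨x, hx, hne⟩ := hF3 n (p n)
  apply hne
  rw [hn, hψ (n + 1) x hx]

theorem countable_closure {B : Type*} [AddCommGroup B] {s : Set B} (hs : s.Countable) :
    (AddSubgroup.closure s : Set B).Countable := by
  have := hs.to_subtype
  have h : (AddSubgroup.closure s : Set B) ⊆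
      Set.range (Finsupp.linearCombination ℤ (Subtype.val : s → B)) := by
    intro x hx
    have : x ∈ Submodule.span ℤ (Set.range (Subtype.val : s → B)) := by
      rw [Subtype.range_coe, ← Submodule.mem_toAddSubgroup,
        Submodule.span_int_eq_addSubgroupClosure]
      exact hx
    rwa [← Finsupp.range_linearCombination] at this
  exact (Set.countable_range _).mono h

/-- A subgroup is pure when it is closed under division by nonzero integers. -/
def IsPure {B : Type*} [AddCommGroup B] (P : AddSubgroup B) : Prop :=
  ∀ k : ℤ, k ≠ 0 → ∀ x, k • x ∈ P → x ∈ P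

/-- No nontrivial integral functional on the tuple `a` is compatible with the divisibility
relations that `a` satisfies modulo `L`. -/
def Rigid {B : Type*} [AddCommGroup B] (L : AddSubgroup B) {n : ℕ} (a : Fin n → B) : Prop :=
  ∀ d : Fin n → ℤ, d ≠ 0 → ∃ (m : ℤ) (c : Fin n → ℤ) (ℓ u : B),
    ℓ ∈ L ∧ m • u = ℓ + ∑ j, c j • a j ∧ ¬ m ∣ ∑ j, c j * d j

theorem free_of_fg {G : Type*} [AddCommGroup G] (hG : AddGroup.FG G)
    (h : ∀ (k : ℤ) (x : G), k • x = 0 → k = 0 ∨ x = 0) : Module.Free ℤ G := by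
  have : Module.Finite ℤ G := Module.Finite.iff_addGroup_fg.2 hG
  have : Module.IsTorsionFree ℤ G := .of_smul_eq_zero h
  exact Module.free_of_finite_type_torsion_free'

theorem exists_functional {G : Type*} [AddCommGroup G] [Module.Free ℤ G] {x : G} (hx : x ≠ 0) :
    ∃ f : G →ₗ[ℤ] ℤ, f x ≠ 0 := by
  by_contra! h
  apply hx
  have b := Module.Free.chooseBasis ℤ G
  exact b.ext_elem fun i ↦ by simpa using h (b.coord i)

theorem Rigid.exists_subgroup {B : Type*} [AddCommGroup B] {L : AddSubgroup B} {n : ℕ}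
    {a : Fin n → B} (h : Rigid L a) (hL : (L : Set B).Countable) :
    ∃ M : AddSubgroup B, (M : Set B).Countable ∧
      (∀ s s' : B →+ ℚ, (∀ x ∈ L, s x = s' x) → (∀ j, s (a j) = s' (a j)) →
        ∀ x ∈ M, s x = s' x) ∧
      ∀ P : AddSubgroup B, IsPure P → L ≤ P → (∃ j, a j ∉ P) →
        ∀ S : Set (B → QZ), S.Countable →
          ∃ θ : B →+ QZ, (∀ x ∈ P, θ x = 0) ∧ ∀ g ∈ S, ∃ x ∈ M, θ x ≠ g x := by
  have hu : ∀ d : {d : Fin n → ℤ // d ≠ 0}, ∃ (m : ℤ) (c : Fin n → ℤ) (ℓ u : B),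
      ℓ ∈ L ∧ m • u = ℓ + ∑ j, c j • a j ∧ (¬ m ∣ ∑ j, c j * d.1 j) ∧ (m = 0 → u = 0) := by
    intro d
    obtain ⟨m, c, ℓ, u, h1, h2, h3⟩ := h d.1 d.2
    by_cases hm : m = 0
    · exact ⟨m, c, ℓ, 0, h1, by rw [← h2, hm]; simp, h3, fun _ ↦ rfl⟩
    · exact ⟨m, c, ℓ, u, h1, h2, h3, fun h ↦ absurd h hm⟩
  choose m c ℓ u hℓ hu hdvd hm using hu
  let M := AddSubgroup.closure ((L : Set B) ∪ Set.range a ∪ Set.range u)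
  have hLM : L ≤ M := fun x hx ↦ AddSubgroup.subset_closure (Or.inl (Or.inl hx))
  have haM : ∀ j, a j ∈ M := fun j ↦ AddSubgroup.subset_closure (Or.inl (Or.inr ⟨j, rfl⟩))
  have huM : ∀ d, u d ∈ M := fun d ↦ AddSubgroup.subset_closure (Or.inr ⟨d, rfl⟩)
  refine ⟨M, countable_closure ((hL.union (Set.countable_range a)).union (Set.countable_range u)),
    ?_, ?_⟩
  · intro s s' hs hsa x hx
    have hle : M ≤ AddMonoidHom.eqLocus s s' := by
      rw [AddSubgroup.closure_le]
      rintro y ((hy | ⟨j, rfl⟩) | ⟨d, rfl⟩)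
      · exact hs y hy
      · exact hsa j
      · change s (u d) = s' (u d)
        by_cases hd : m d = 0
        · rw [hm d hd, map_zero, map_zero]
        · have h1 := congrArg s (hu d)
          have h2 := congrArg s' (hu d)
          simp only [map_zsmul, map_add, map_sum, hsa, hs _ (hℓ d)] at h1 h2
          have h3 : m d • s (u d) = m d • s' (u d) := h1.trans h2.symm
          simpa [hd] using h3
    exact hle hx
  · intro P hP hLP hj S hS
    let π := QuotientAddGroup.mk' P
    have hker : ∀ x ∈ P, π x = 0 := fun x hx ↦ (QuotientAddGroup.eq_zero_iff x).2 hx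
    let A : AddSubgroup (B ⧸ P) := M.map π
    have hπA : ∀ x ∈ M, π x ∈ A := fun x hx ↦ AddSubgroup.mem_map_of_mem π hx
    have hfg : ¬ AddGroup.FG A := by
      intro hfg
      have hfree : Module.Free ℤ A := by
        apply free_of_fg hfg
        rintro k ⟨y, hy⟩ hk
        by_cases hk0 : k = 0
        · exact Or.inl hk0
        right
        obtain ⟨x, rfl⟩ := QuotientAddGroup.mk'_surjective P y
        have h1 := congrArg Subtype.val hk
        apply Subtype.ext
        simp only [AddSubgroup.coe_zsmul, ZeroMemClass.coe_zero] at h1 ⊢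
        rw [← map_zsmul] at h1
        exact (QuotientAddGroup.eq_zero_iff x).2
          (hP k hk0 x ((QuotientAddGroup.eq_zero_iff (k • x)).1 h1))
      obtain ⟨j, hj⟩ := hj
      have hne : (⟨π (a j), hπA _ (haM j)⟩ : A) ≠ 0 := fun h0 ↦
        hj ((QuotientAddGroup.eq_zero_iff (a j)).1 (congrArg Subtype.val h0))
      obtain ⟨f, hf⟩ := exists_functional hne
      let d : Fin n → ℤ := fun j ↦ f ⟨π (a j), hπA _ (haM j)⟩
      have hd : d ≠ 0 := fun h0 ↦ hf (congrFun h0 j)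
      apply hdvd ⟨d, hd⟩
      refine ⟨f ⟨π (u ⟨d, hd⟩), hπA _ (huM _)⟩, ?_⟩
      have h1 : m ⟨d, hd⟩ • (⟨π (u ⟨d, hd⟩), hπA _ (huM _)⟩ : A) =
          ∑ j, c ⟨d, hd⟩ j • (⟨π (a j), hπA _ (haM j)⟩ : A) := by
        apply Subtype.ext
        have := congrArg π (hu ⟨d, hd⟩)
        simp only [map_zsmul, map_add, map_sum, hker _ (hLP (hℓ _)), zero_add] at this
        simpa using this
      have h2 := congrArg f h1
      simp only [map_zsmul, map_sum, smul_eq_mul] at h2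
      exact h2.symm
    have hr : ∀ y : A, ∃ x ∈ M, π x = y := fun y ↦ AddSubgroup.mem_map.1 y.2
    choose r hrM hr using hr
    obtain ⟨χ, hχ⟩ := exists_character_notMem hfg (hS.image fun (g : B → QZ) (y : A) ↦ g (r y))
    obtain ⟨θ, hθP, hθ⟩ := exists_extension_of_quotient P A χ
    refine ⟨θ, hθP, fun g hg ↦ ?_⟩
    by_contra! hall
    apply hχ
    refine ⟨g, hg, ?_⟩
    funext y
    have : (⟨π (r y), hπA _ (hrM y)⟩ : A) = y := Subtype.ext (hr y)
    rw [← this, ← hθ (r y) (hπA _ (hrM y)), this, hall _ (hrM y)]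

/-- Characters vanishing on `P` can be chosen to avoid, up to translation, all reductions of
rational homomorphisms with prescribed values on `L`. -/
theorem Rigid.exists_subgroup_avoiding {B : Type*} [AddCommGroup B] {L : AddSubgroup B} {n : ℕ}
    {a : Fin n → B} (h : Rigid L a) (hL : (L : Set B).Countable) :
    ∃ M : AddSubgroup B, (M : Set B).Countable ∧
      ∀ P : AddSubgroup B, IsPure P → L ≤ P → (∃ j, a j ∉ P) →
        ∀ (h : B → ℚ) (χ : B →+ QZ), ∃ θ : B →+ QZ, (∀ x ∈ P, θ x = 0) ∧
          ∀ s : B →+ ℚ, (∀ x ∈ L, s x = h x) → ∃ x ∈ M, ((s x : ℚ) : QZ) ≠ χ x + θ x := by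
  classical
  obtain ⟨M, hM, hMdet, hθ⟩ := h.exists_subgroup hL
  refine ⟨M, hM, fun P hP hLP hj h χ ↦ ?_⟩
  let S : Set (B → QZ) := Set.range fun v : Fin n → ℚ ↦ fun x ↦
    if hs : ∃ s : B →+ ℚ, (∀ x ∈ L, s x = h x) ∧ ∀ j, s (a j) = v j then
      ((hs.choose x : ℚ) : QZ) - χ x else 0
  obtain ⟨θ, hθP, hθ⟩ := hθ P hP hLP hj S (Set.countable_range _)
  refine ⟨θ, hθP, fun s hs ↦ ?_⟩
  obtain ⟨x, hx, hne⟩ := hθ _ ⟨fun j ↦ s (a j), rfl⟩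
  have hex : ∃ s' : B →+ ℚ, (∀ x ∈ L, s' x = h x) ∧ ∀ j, s' (a j) = s (a j) :=
    ⟨s, hs, fun _ ↦ rfl⟩
  refine ⟨x, hx, fun heq ↦ hne ?_⟩
  dsimp only
  rw [dif_pos hex, ← hMdet s hex.choose (fun y hy ↦ (hs y hy).trans (hex.choose_spec.1 y hy).symm)
    (fun j ↦ (hex.choose_spec.2 j).symm) x hx, heq, add_sub_cancel_left]

/-- Groups in which rigid tuples vanish. -/
def NoRigid (G : Type*) [AddCommGroup G] : Prop :=
  ∀ (n : ℕ) (a : Fin n → G), Rigid ⊥ a → a = 0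

theorem LiftsCharacters.noRigid {B : Type*} [AddCommGroup B] (hB : LiftsCharacters B) :
    NoRigid B := by
  intro n a ha
  by_contra hne
  obtain ⟨M, -, hM⟩ := ha.exists_subgroup_avoiding (by simp)
  obtain ⟨j, hj⟩ : ∃ j, a j ≠ 0 := by simpa [funext_iff] using hne
  obtain ⟨θ, -, hθ⟩ := hM ⊥ (fun k hk x hx ↦ by
    simpa using hB.torsionFree hk (by simpa using hx)) le_rfl ⟨j, by simpa using hj⟩ 0 0
  obtain ⟨s, hs⟩ := hB θ
  obtain ⟨x, hx, hne⟩ := hθ s fun x hx ↦ by rw [AddSubgroup.mem_bot.1 hx, map_zero, Pi.zero_apply]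
  apply hne
  rw [hs, AddMonoidHom.zero_apply, zero_add]

/-- A character of `B`, regarded as an approximation valid on a subgroup. -/
abbrev Approx (B : Type u) [AddCommGroup B] : Type u := AddSubgroup B × (B →+ QZ)

/-- `p'` extends `p`: the domain is larger and the characters agree on the domain of `p`. -/
def Extends {B : Type u} [AddCommGroup B] (p p' : Approx B) : Prop :=
  p.1 ≤ p'.1 ∧ ∀ x ∈ p.1, p'.2 x = p.2 x

theorem Extends.refl {B : Type u} [AddCommGroup B] (p : Approx B) : Extends p p :=
  ⟨le_rfl, fun _ _ ↦ rfl⟩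

theorem Extends.trans {B : Type u} [AddCommGroup B] {p q r : Approx B} (h : Extends p q)
    (h' : Extends q r) : Extends p r :=
  ⟨h.1.trans h'.1, fun x hx ↦ (h'.2 x (h.1 hx)).trans (h.2 x hx)⟩

theorem exists_extends_chain {B : Type u} [AddCommGroup B] (c : Set (Approx B)) :
    ∃ q : Approx B, c.Nonempty → (∀ p ∈ c, ∀ p' ∈ c, Extends p p' ∨ Extends p' p) →
      (∀ p ∈ c, Extends p q) ∧ ∀ x ∈ q.1, ∃ p ∈ c, x ∈ p.1 := by
  by_cases hc : c.Nonempty ∧ ∀ p ∈ c, ∀ p' ∈ c, Extends p p' ∨ Extends p' p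
  swap
  · exact ⟨⟨⊥, 0⟩, fun h h' ↦ absurd ⟨h, h'⟩ hc⟩
  obtain ⟨⟨p₀, hp₀⟩, hchain⟩ := hc
  have hdir : ∀ p ∈ c, ∀ p' ∈ c, ∃ q ∈ c, Extends p q ∧ Extends p' q := by
    intro p hp p' hp'
    rcases hchain p hp p' hp' with h | h
    · exact ⟨p', hp', h, Extends.refl _⟩
    · exact ⟨p, hp, Extends.refl _, h⟩
  let D : AddSubgroup B :=
    { carrier := {x | ∃ p ∈ c, x ∈ p.1}
      zero_mem' := ⟨p₀, hp₀, zero_mem _⟩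
      neg_mem' := by
        rintro x ⟨p, hp, hx⟩
        exact ⟨p, hp, neg_mem hx⟩
      add_mem' := by
        rintro x y ⟨p, hp, hx⟩ ⟨p', hp', hy⟩
        obtain ⟨q, hq, h, h'⟩ := hdir p hp p' hp'
        exact ⟨q, hq, add_mem (h.1 hx) (h'.1 hy)⟩ }
  have hD : ∀ x : D, ∃ p ∈ c, (x : B) ∈ p.1 := fun x ↦ x.2
  choose N hNc hN using hD
  have key : ∀ p ∈ c, ∀ x (hx : x ∈ p.1) (hxD : x ∈ D), (N ⟨x, hxD⟩).2 x = p.2 x := by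
    intro p hp x hx hxD
    obtain ⟨q, hq, h, h'⟩ := hdir p hp _ (hNc ⟨x, hxD⟩)
    rw [← h.2 x hx, ← h'.2 x (hN ⟨x, hxD⟩)]
  let f : D →+ QZ := AddMonoidHom.mk' (fun x ↦ (N x).2 x) (by
    rintro ⟨x, hx⟩ ⟨y, hy⟩
    obtain ⟨q, hq, h, h'⟩ := hdir _ (hNc ⟨x, hx⟩) _ (hNc ⟨y, hy⟩)
    have hxq := h.1 (hN ⟨x, hx⟩)
    have hyq := h'.1 (hN ⟨y, hy⟩)
    change (N ⟨x + y, _⟩).2 (x + y) = (N ⟨x, hx⟩).2 x + (N ⟨y, hy⟩).2 y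
    rw [key q hq _ (add_mem hxq hyq), key q hq _ hxq, key q hq _ hyq, map_add])
  obtain ⟨ψ, hψ⟩ := exists_extension baer_QZ D f
  refine ⟨⟨D, ψ⟩, fun _ _ ↦ ⟨fun p hp ↦ ⟨fun x hx ↦ ⟨p, hp, hx⟩, fun x hx ↦ ?_⟩, fun x hx ↦ hx⟩⟩
  exact (hψ ⟨x, ⟨p, hp, hx⟩⟩).trans (key p hp x hx _)

/-- The subgroup of elements having a nonzero multiple in `D`. -/
def pureClosure {B : Type u} [AddCommGroup B] (D : AddSubgroup B) : AddSubgroup B where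
  carrier := {x | ∃ k : ℤ, k ≠ 0 ∧ k • x ∈ D}
  zero_mem' := ⟨1, one_ne_zero, by simp⟩
  neg_mem' := by
    rintro x ⟨k, hk, hx⟩
    exact ⟨k, hk, by rw [smul_neg]; exact neg_mem hx⟩
  add_mem' := by
    rintro x y ⟨k, hk, hx⟩ ⟨l, hl, hy⟩
    refine ⟨k * l, mul_ne_zero hk hl, ?_⟩
    rw [smul_add, mul_smul, mul_comm, mul_smul]
    rw [smul_comm k l x]
    exact add_mem (zsmul_mem hx l) (by rw [smul_comm l k y]; exact zsmul_mem hy k)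

theorem le_pureClosure {B : Type u} [AddCommGroup B] (D : AddSubgroup B) : D ≤ pureClosure D :=
  fun x hx ↦ ⟨1, one_ne_zero, by simpa using hx⟩

theorem isPure_pureClosure {B : Type u} [AddCommGroup B] (D : AddSubgroup B) :
    IsPure (pureClosure D) := by
  rintro k hk x ⟨l, hl, hx⟩
  exact ⟨l * k, mul_ne_zero hl hk, by rwa [mul_smul]⟩

theorem mk_pureClosure_le {B : Type u} [AddCommGroup B]
    (htf : ∀ (k : ℤ) (x : B), k ≠ 0 → k • x = 0 → x = 0) (D : AddSubgroup B) :
    #(pureClosure D) ≤ max ℵ₀ #D := by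
  have h : ∀ x : pureClosure D, ∃ k : ℤ, k ≠ 0 ∧ k • (x : B) ∈ D := fun x ↦ x.2
  choose k hk hkD using h
  have hinj : Function.Injective fun x ↦
      ((ULift.up (k x), ⟨k x • (x : B), hkD x⟩) : ULift.{u} ℤ × D) := by
    intro x y hxy
    simp only [Prod.mk.injEq, ULift.up.injEq, Subtype.mk.injEq] at hxy
    apply Subtype.ext
    apply sub_eq_zero.1
    apply htf (k x) _ (hk x)
    rw [smul_sub, hxy.2, hxy.1, sub_self]
  have := Cardinal.mk_le_of_injective hinj
  simp only [mk_prod, lift_id, mk_eq_aleph0] at this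
  exact this.trans (mul_le_of_le (le_max_left _ _) (le_max_left _ _) (le_max_right _ _))

theorem mk_sup_le {B : Type u} [AddCommGroup B] (D M : AddSubgroup B) (hM : (M : Set B).Countable) :
    #(D ⊔ M : AddSubgroup B) ≤ max ℵ₀ #D := by
  have hsurj : Function.Surjective fun p : D × M ↦
      (⟨p.1 + p.2, add_mem (AddSubgroup.mem_sup_left p.1.2) (AddSubgroup.mem_sup_right p.2.2)⟩ :
        (D ⊔ M : AddSubgroup B)) := by
    rintro ⟨x, hx⟩
    obtain ⟨y, hy, z, hz, rfl⟩ := AddSubgroup.mem_sup.1 hx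
    exact ⟨⟨⟨y, hy⟩, ⟨z, hz⟩⟩, rfl⟩
  have h1 := Cardinal.mk_le_of_surjective hsurj
  have h2 : #M ≤ ℵ₀ := Cardinal.le_aleph0_iff_set_countable.2 hM
  simp only [mk_prod, lift_id] at h1
  exact h1.trans (mul_le_of_le (le_max_left _ _) (le_max_right _ _) (h2.trans (le_max_left _ _)))

/-- There is no family of continuum many tuples that are rigid over a fixed countable subgroup. -/
theorem LiftsCharacters.not_rigid_family {B : Type u} [AddCommGroup B] (hB : LiftsCharacters B)
    {L : AddSubgroup B} (hL : (L : Set B).Countable) {n : ℕ} (a : (ℕ → Bool) → Fin n → B)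
    (ha : Function.Injective a) (hrig : ∀ η, Rigid L (a η)) : False := by
  have hext : ∀ P : AddSubgroup B, #P < 𝔠 → ∃ η j, a η j ∉ P := by
    intro P hP
    by_contra! hall
    have hinj : Function.Injective fun η : ULift.{u} (ℕ → Bool) ↦
        fun j ↦ (⟨a η.down j, hall η.down j⟩ : P) := by
      intro η η' h
      apply ULift.down_injective
      apply ha
      funext j
      exact congrArg Subtype.val (congrFun h j)
    have h1 := Cardinal.mk_le_of_injective hinj
    have h2 : #(ULift.{u} (ℕ → Bool)) = 𝔠 := by simp
    rw [h2] at h1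
    have h3 : #(Fin n → P) ≤ max #P ℵ₀ := by
      simpa using power_nat_le_max (c := #P) (n := n)
    exact absurd (h1.trans h3) (not_le.2 (max_lt hP aleph0_lt_continuum))
  -- one step of the construction
  have step : ∀ (h : B → ℚ) (p : Approx B), ∃ p' : Approx B, Extends p p' ∧
      (L ≤ p.1 → #p.1 < 𝔠 → #p'.1 ≤ max ℵ₀ #p.1 ∧
        ∀ s : B →+ ℚ, (∀ x ∈ L, s x = h x) → ∃ x ∈ p'.1, ((s x : ℚ) : QZ) ≠ p'.2 x) := by
    intro h p
    by_cases hp : L ≤ p.1 ∧ #p.1 < 𝔠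
    swap
    · exact ⟨p, Extends.refl p, fun h h' ↦ absurd ⟨h, h'⟩ hp⟩
    obtain ⟨hLp, hcard⟩ := hp
    obtain ⟨η, j, hj⟩ := hext (pureClosure p.1) (lt_of_le_of_lt
      (mk_pureClosure_le (fun k x hk hx ↦ hB.torsionFree hk hx) p.1)
      (max_lt aleph0_lt_continuum hcard))
    obtain ⟨M, hM, hMθ⟩ := (hrig η).exists_subgroup_avoiding hL
    obtain ⟨θ, hθP, hθ⟩ := hMθ (pureClosure p.1) (isPure_pureClosure _)
      (hLp.trans (le_pureClosure _)) ⟨j, hj⟩ h p.2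
    refine ⟨⟨p.1 ⊔ M, p.2 + θ⟩, ⟨le_sup_left, fun x hx ↦ ?_⟩, fun _ _ ↦ ⟨mk_sup_le _ _ hM,
      fun s hs ↦ ?_⟩⟩
    · simp [hθP x (le_pureClosure _ hx)]
    · obtain ⟨x, hx, hne⟩ := hθ s hs
      exact ⟨x, AddSubgroup.mem_sup_right hx, hne⟩
  choose step hstep1 hstep2 using step
  choose ub hub using exists_extends_chain (B := B)
  let I : Type u := (Cardinal.ord 𝔠).ToType
  obtain ⟨e, he⟩ : ∃ e : I → L → ℤ, Function.Surjective e := by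
    have hle : #(L → ℤ) ≤ #I := by
      have : #L ≤ ℵ₀ := Cardinal.le_aleph0_iff_set_countable.2 hL
      rw [mk_ord_toType]
      simp only [mk_pi, prod_const, mk_eq_aleph0, lift_aleph0, lift_uzero]
      calc (ℵ₀ : Cardinal.{u}) ^ #L ≤ ℵ₀ ^ (ℵ₀ : Cardinal.{u}) :=
            power_le_power_left aleph0_ne_zero this
        _ ≤ 𝔠 := by simp
    obtain ⟨f⟩ := hle
    exact ⟨_, Function.invFun_surjective f.injective⟩
  let ext : (L → ℤ) → B → ℚ := fun h x ↦ by
    classical exact if hx : x ∈ L then (h ⟨x, hx⟩ : ℚ) else 0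
  have hext' : ∀ h x (hx : x ∈ L), ext h x = h ⟨x, hx⟩ := by
    intro h x hx
    simp [ext, hx]
  let base : Approx B := ⟨L, 0⟩
  let F : I → Approx B := WellFoundedLT.fix (fun i (F : ∀ j, j < i → Approx B) ↦
    step (ext (e i)) (ub ({p | ∃ j, ∃ hj : j < i, F j hj = p} ∪ {base})))
  have hF : ∀ i, F i = step (ext (e i)) (ub (F '' Set.Iio i ∪ {base})) := by
    intro i
    change WellFoundedLT.fix _ _ = _
    rw [WellFoundedLT.fix_eq]
    congr 3
    ext p
    simp [F]
  have hκ : ∀ i : I, max ℵ₀ #(Set.Iio i) < 𝔠 := fun i ↦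
    max_lt aleph0_lt_continuum (by simpa [I] using mk_Iio_lt i (by simp [I]))
  have main : ∀ i, (∀ j < i, Extends (F j) (F i)) ∧ Extends base (F i) ∧
      #(F i).1 ≤ max ℵ₀ #(Set.Iio i) ∧
        ∀ s : B →+ ℚ, (∀ x ∈ L, s x = ext (e i) x) →
          ∃ x ∈ (F i).1, ((s x : ℚ) : QZ) ≠ (F i).2 x := by
    intro i
    induction i using WellFoundedLT.induction with
    | ind i ih =>
    let c := F '' Set.Iio i ∪ {base}
    obtain ⟨hq1, hq2⟩ := hub c ⟨base, Or.inr rfl⟩ (by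
      rintro p (⟨j, hj, rfl⟩ | rfl) p' (⟨k, hk, rfl⟩ | rfl)
      · rcases lt_trichotomy j k with h | rfl | h
        · exact Or.inl ((ih k hk).1 j h)
        · exact Or.inl (Extends.refl _)
        · exact Or.inr ((ih j hj).1 k h)
      · exact Or.inr (ih j hj).2.1
      · exact Or.inl (ih k hk).2.1
      · exact Or.inl (Extends.refl _))
    have hbase : Extends base (ub c) := hq1 base (Or.inr rfl)
    have hcard : #(ub c).1 ≤ max ℵ₀ #(Set.Iio i) := by
      have h1 : ((ub c).1 : Set B) ⊆ ⋃ p ∈ c, (p.1 : Set B) := by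
        intro x hx
        obtain ⟨p, hp, hxp⟩ := hq2 x hx
        simp only [Set.mem_iUnion]
        exact ⟨p, hp, hxp⟩
      have h2 : #c ≤ max ℵ₀ #(Set.Iio i) := by
        refine (mk_union_le _ _).trans (add_le_of_le (le_max_left _ _)
          (mk_image_le.trans (le_max_right _ _)) ?_)
        rw [mk_singleton]
        exact one_le_aleph0.trans (le_max_left _ _)
      have h3 : ∀ p ∈ c, #(p.1 : Set B) ≤ max ℵ₀ #(Set.Iio i) := by
        rintro p (⟨j, hj, rfl⟩ | rfl)
        · refine (ih j hj).2.2.1.trans (max_le_max le_rfl (mk_le_mk_of_subset ?_))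
          exact Set.Iio_subset_Iio (le_of_lt hj)
        · exact (Cardinal.le_aleph0_iff_set_countable.2 hL).trans (le_max_left _ _)
      refine (mk_le_mk_of_subset h1).trans ((mk_biUnion_le _ _).trans
          (mul_le_of_le (le_max_left _ _) h2 ?_))
      exact ciSup_le' fun p ↦ h3 p.1 p.2
    have hgood := hstep2 (ext (e i)) (ub c) hbase.1 (lt_of_le_of_lt hcard (hκ i))
    have hle := hstep1 (ext (e i)) (ub c)
    rw [hF i]
    exact ⟨fun j hj ↦ (hq1 _ (Or.inl ⟨j, hj, rfl⟩)).trans hle, hbase.trans hle,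
      hgood.1.trans (max_le (le_max_left _ _) hcard), hgood.2⟩
  obtain ⟨hq1, -⟩ := hub (Set.range F ∪ {base}) ⟨base, Or.inr rfl⟩ (by
    rintro p (⟨j, rfl⟩ | rfl) p' (⟨k, rfl⟩ | rfl)
    · rcases lt_trichotomy j k with h | rfl | h
      · exact Or.inl ((main k).1 j h)
      · exact Or.inl (Extends.refl _)
      · exact Or.inr ((main j).1 k h)
    · exact Or.inr (main j).2.1
    · exact Or.inl (main k).2.1
    · exact Or.inl (Extends.refl _))
  set q := ub (Set.range F ∪ {base})
  obtain ⟨s, hs⟩ := hB q.2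
  have hint : ∀ x : L, ∃ m : ℤ, s x = m := by
    intro x
    rw [← coe_QZ_eq_zero, hs, (hq1 base (Or.inr rfl)).2 x x.2]
    rfl
  choose h hh using hint
  obtain ⟨i, hi⟩ := he h
  obtain ⟨x, hx, hne⟩ := (main i).2.2.2 s (fun x hx ↦ by rw [hext' _ x hx, hi]; exact hh ⟨x, hx⟩)
  exact hne ((hs x).trans ((hq1 _ (Or.inl ⟨i, rfl⟩)).2 x hx))

section PerfectSet
open Topology Filter

theorem isOpen_setOf_forall_separated_notMem {X : Type*} [TopologicalSpace X] {F : Set (X × X)}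
    (hF : IsClosed F) (m : ℕ) :
    IsOpen {φ : C(ℕ → Bool, X) | ∀ a b : ℕ → Bool, (∃ i < m, a i ≠ b i) → (φ a, φ b) ∉ F} := by
  have hK : IsClosed {p : (ℕ → Bool) × (ℕ → Bool) | ∃ i < m, p.1 i ≠ p.2 i} := by
    have : {p : (ℕ → Bool) × (ℕ → Bool) | ∃ i < m, p.1 i ≠ p.2 i} =
        ⋃ i ∈ Set.Iio m, {p | p.1 i ≠ p.2 i} := by ext; simp
    rw [this]
    refine (Set.finite_Iio m).isClosed_biUnion fun i _ ↦ ?_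
    exact (isClosed_discrete {q : Bool × Bool | q.1 ≠ q.2}).preimage
      (f := fun p : (ℕ → Bool) × (ℕ → Bool) ↦ (p.1 i, p.2 i)) (by fun_prop)
  have hT : IsClosed {q : C(ℕ → Bool, X) × ((ℕ → Bool) × (ℕ → Bool)) |
      q.2 ∈ {p : (ℕ → Bool) × (ℕ → Bool) | ∃ i < m, p.1 i ≠ p.2 i} ∧
        (q.1 q.2.1, q.1 q.2.2) ∈ F} := by
    refine (hK.preimage continuous_snd).inter (hF.preimage ?_)
    fun_prop
  have := (isClosedMap_fst_of_compactSpace _ hT).isOpen_compl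
  convert this using 1
  ext φ
  simp only [Set.mem_ofPred_eq, Set.mem_compl_iff, Set.mem_image, Prod.exists, not_exists]
  constructor
  · rintro h φ' a b ⟨⟨h1, h2⟩, rfl⟩
    exact h a b h1 h2
  · intro h a b hab hF
    exact h φ a b ⟨⟨hab, hF⟩, rfl⟩

theorem exists_separated_tuple {X ι : Type*} [TopologicalSpace X] [Finite ι]
    [BaireSpace (ι → X)]
    {F : Set (X × X)} (hF : IsClosed F) (hF' : IsNowhereDense F) (U : ι → Set X)
    (hU : ∀ i, IsOpen (U i)) (hne : ∀ i, (U i).Nonempty) :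
    ∃ y : ι → X, (∀ i, y i ∈ U i) ∧ ∀ i j, i ≠ j → (y i, y j) ∉ F := by
  classical
  have hd : Dense (⋂ p : {p : ι × ι // p.1 ≠ p.2}, {y : ι → X | (y p.1.1, y p.1.2) ∉ F}) := by
    apply dense_iInter_of_isOpen
    · intro p
      exact hF.isOpen_compl.preimage (by fun_prop)
    · rintro ⟨⟨i, j⟩, hij⟩
      rw [dense_iff_inter_open]
      rintro O hO ⟨y, hy⟩
      obtain ⟨u, hu, huO⟩ := isOpen_pi_iff'.1 hO y hy
      have hFd : Dense Fᶜ := by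
        rw [← interior_eq_empty_iff_dense_compl, ← hF.isNowhereDense_iff]
        exact hF'
      obtain ⟨⟨a, b⟩, hab, habF⟩ := hFd.inter_open_nonempty (u i ×ˢ u j)
        ((hu i).1.prod (hu j).1) ⟨(y i, y j), (hu i).2, (hu j).2⟩
      refine ⟨Function.update (Function.update y i a) j b, huO ?_, ?_⟩
      · intro k _
        by_cases hkj : k = j
        · subst hkj; simpa using hab.2
        · by_cases hki : k = i
          · subst hki; simpa [hkj] using hab.1
          · simpa [hkj, hki] using (hu k).2
      · simpa [Function.update_of_ne hij] using habF
  obtain ⟨y, hyU, hy⟩ := hd.inter_open_nonempty (Set.univ.pi U)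
    (isOpen_set_pi Set.finite_univ fun i _ ↦ hU i) (Set.univ_pi_nonempty_iff.2 hne)
  exact ⟨y, fun i ↦ hyU i trivial, fun i j hij ↦ Set.mem_iInter.1 hy ⟨(i, j), hij⟩⟩

/-- A meagre relation on a nonempty Polish space admits a continuous injection of the Cantor
space whose distinct values are unrelated. -/
theorem exists_cantor_unrelated {X : Type*} [TopologicalSpace X] [PolishSpace X] [Nonempty X]
    {R : Set (X × X)} (hR : IsMeagre R) :
    ∃ φ : (ℕ → Bool) → X, ∀ a b, a ≠ b → (φ a, φ b) ∉ R := by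
  let := TopologicalSpace.upgradeIsCompletelyMetrizable X
  obtain ⟨S, hS, hSc, hRS⟩ := isMeagre_iff_countable_union_isNowhereDense.1 hR
  have : Countable S := hSc.to_subtype
  have hd : Dense (⋂ q : S × ℕ, {φ : C(ℕ → Bool, X) | ∀ a b : ℕ → Bool,
      (∃ i < q.2, a i ≠ b i) → (φ a, φ b) ∉ closure q.1.1}) := by
    apply dense_iInter_of_isOpen
    · rintro ⟨F, m⟩
      exact isOpen_setOf_forall_separated_notMem isClosed_closure m
    · rintro ⟨⟨F, hF⟩, m⟩
      rw [Metric.dense_iff]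
      intro φ r hr
      obtain ⟨M, hM⟩ := exists_subset_nhds_of_isCompact
        (V := fun M : ℕ ↦ {p : (ℕ → Bool) × (ℕ → Bool) | ∀ i < M, p.1 i = p.2 i})
        (U := {p | dist (φ p.1) (φ p.2) < r / 2})
        (directed_of_isDirected_le fun M N hMN p hp i hi ↦ hp i (lt_of_lt_of_le hi hMN))
        (fun M ↦ by
          apply IsClosed.isCompact
          simp only [Set.ofPred_forall]
          exact isClosed_iInter fun i ↦ isClosed_iInter fun _ ↦
            isClosed_eq (by fun_prop) (by fun_prop))
        (by
          rintro ⟨a, b⟩ hab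
          simp only [Set.mem_iInter, Set.mem_ofPred_eq] at hab
          have : a = b := funext fun i ↦ hab (i + 1) i (Nat.lt_succ_self i)
          subst this
          apply IsOpen.mem_nhds
          · exact isOpen_lt (by fun_prop) continuous_const
          · simpa using hr)
      let N := max M m
      let e : (Fin N → Bool) → ℕ → Bool := fun s i ↦ if h : i < N then s ⟨i, h⟩ else false
      have : BaireSpace ((Fin N → Bool) → X) := inferInstance
      obtain ⟨y, hyU, hy⟩ := exists_separated_tuple (F := closure F) isClosed_closure
        (hS F hF).closure (fun s : Fin N → Bool ↦ Metric.ball (φ (e s)) (r / 2))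
        (fun _ ↦ Metric.isOpen_ball) (fun s ↦ ⟨_, Metric.mem_ball_self (by linarith)⟩)
      have hcont : Continuous fun a : ℕ → Bool ↦ y fun i : Fin N ↦ a i :=
        (continuous_of_discreteTopology (f := y)).comp (by fun_prop)
      refine ⟨⟨fun a ↦ y fun i ↦ a i, hcont⟩, ?_, ?_⟩
      · rw [Metric.mem_ball, ContinuousMap.dist_lt_iff hr]
        intro a
        have h1 := hyU fun i ↦ a i
        rw [Metric.mem_ball] at h1
        have h2 : dist (φ (e fun i : Fin N ↦ a i)) (φ a) < r / 2 := hM (a := (_, a)) (by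
          intro i hi
          have : i < N := lt_of_lt_of_le hi (le_max_left _ _)
          exact dif_pos this)
        have := dist_triangle (y fun i : Fin N ↦ a i) (φ (e fun i : Fin N ↦ a i)) (φ a)
        change dist (y fun i : Fin N ↦ a i) (φ a) < r
        linarith
      · rintro a b ⟨i, hi, hab⟩
        refine hy _ _ fun h ↦ hab ?_
        exact congrFun h ⟨i, lt_of_lt_of_le hi (le_max_right _ _)⟩
  have : Nonempty C(ℕ → Bool, X) := ‹Nonempty X›.map (ContinuousMap.const _)
  obtain ⟨φ, hφ⟩ := hd.nonempty
  refine ⟨φ, fun a b hab hmem ↦ ?_⟩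
  obtain ⟨F, hF, hFm⟩ := hRS hmem
  obtain ⟨i, hi⟩ := Function.ne_iff.1 hab
  exact Set.mem_iInter.1 hφ (⟨F, hF⟩, i + 1) a b ⟨i, Nat.lt_succ_self i, hi⟩ (subset_closure hFm)

end PerfectSet

section Category
open Topology Filter

/-- The points all of whose neighbourhoods meet `A` in a nonmeagre set. -/
def nonmeagrePoints {Y : Type*} [TopologicalSpace Y] (A : Set Y) : Set Y :=
  {p | ∀ U : Set Y, IsOpen U → p ∈ U → ¬ IsMeagre (A ∩ U)}

theorem isClosed_nonmeagrePoints {Y : Type*} [TopologicalSpace Y] (A : Set Y) :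
    IsClosed (nonmeagrePoints A) := by
  rw [← isOpen_compl_iff, isOpen_iff_forall_mem_open]
  intro p hp
  simp only [nonmeagrePoints, Set.mem_compl_iff, Set.mem_ofPred_eq, not_forall, not_not] at hp
  obtain ⟨U, hU, hpU, hm⟩ := hp
  exact ⟨U, fun q hq h ↦ h U hU hq hm, hU, hpU⟩

theorem nonmeagrePoints_subset_closure {Y : Type*} [TopologicalSpace Y] (A : Set Y) :
    nonmeagrePoints A ⊆ closure A := by
  intro p hp
  rw [mem_closure_iff]
  intro U hU hpU
  rw [Set.inter_comm]
  by_contra h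
  rw [Set.not_nonempty_iff_eq_empty] at h
  exact hp U hU hpU (h ▸ IsMeagre.empty)

theorem isMeagre_diff_nonmeagrePoints {Y : Type*} [TopologicalSpace Y]
    [SecondCountableTopology Y] (A : Set Y) : IsMeagre (A \ nonmeagrePoints A) := by
  let 𝓑 := TopologicalSpace.countableBasis Y
  have h𝓑 := TopologicalSpace.isBasis_countableBasis Y
  have hc : Countable 𝓑 := (TopologicalSpace.countable_countableBasis Y).to_subtype
  refine IsMeagre.mono (s := ⋃ U : {U : 𝓑 // IsMeagre (A ∩ U.1)}, A ∩ U.1.1) ?_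
    (isMeagre_iUnion fun U ↦ U.2)
  rintro p ⟨hpA, hp⟩
  simp only [nonmeagrePoints, Set.mem_ofPred_eq, not_forall, not_not] at hp
  obtain ⟨U, hU, hpU, hm⟩ := hp
  obtain ⟨V, hV, hpV, hVU⟩ := h𝓑.exists_subset_of_mem_open hpU hU
  exact Set.mem_iUnion.2 ⟨⟨⟨V, hV⟩, hm.mono (Set.inter_subset_inter_right _ hVU)⟩, hpA, hpV⟩

theorem isNowhereDense_nonmeagrePoints_diff {Y : Type*} [TopologicalSpace Y]
    [SecondCountableTopology Y] {A : Set Y} {A' : ℕ → Set Y} (hA : A ⊆ ⋃ k, A' k) :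
    IsNowhereDense (nonmeagrePoints A \ ⋃ k, nonmeagrePoints (A' k)) := by
  set E := nonmeagrePoints A \ ⋃ k, nonmeagrePoints (A' k)
  by_contra hE
  obtain ⟨p, hp⟩ := Set.nonempty_iff_ne_empty.2 hE
  set V := interior (closure E)
  have hVA : V ⊆ nonmeagrePoints A := interior_subset.trans
    (closure_minimal Set.sdiff_subset (isClosed_nonmeagrePoints A))
  have h1 : ∃ k, ¬ IsMeagre (A' k ∩ V) := by
    by_contra! h
    refine hVA hp V isOpen_interior hp ((isMeagre_iUnion h).mono ?_)
    rw [← Set.iUnion_inter]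
    exact Set.inter_subset_inter_left _ hA
  obtain ⟨k, hk⟩ := h1
  have h2 : (interior (nonmeagrePoints (A' k) ∩ closure V)).Nonempty := by
    by_contra h
    rw [Set.not_nonempty_iff_eq_empty, ← IsClosed.isNowhereDense_iff
      ((isClosed_nonmeagrePoints _).inter isClosed_closure)] at h
    refine hk (((isMeagre_diff_nonmeagrePoints (A' k)).union h.isMeagre).mono ?_)
    rintro q ⟨hqA, hqV⟩
    by_cases hq : q ∈ nonmeagrePoints (A' k)
    · exact Or.inr ⟨hq, subset_closure hqV⟩
    · exact Or.inl ⟨hqA, hq⟩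
  obtain ⟨q, hq⟩ := h2
  have hqE : q ∈ closure E :=
    closure_minimal interior_subset isClosed_closure (interior_subset hq).2
  obtain ⟨r, hr, hrE⟩ := mem_closure_iff.1 hqE _ isOpen_interior hq
  exact hrE.2 (Set.mem_iUnion.2 ⟨k, (interior_subset hr).1⟩)

/-- A nonmeagre analytic set is comeagre in some nonempty open set. -/
theorem exists_isOpen_isMeagre_diff {Y : Type*} [TopologicalSpace Y] [T2Space Y]
    [SecondCountableTopology Y] {R : Set Y} (hR : AnalyticSet R) (hm : ¬ IsMeagre R) :
    ∃ O : Set Y, IsOpen O ∧ O.Nonempty ∧ IsMeagre (O \ R) := by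
  rw [AnalyticSet] at hR
  rcases hR with rfl | ⟨f, hf, rfl⟩
  · exact absurd IsMeagre.empty hm
  let Rw : List ℕ → Set Y := fun w ↦ f '' {x | (List.range w.length).map x = w}
  have hsplit : ∀ w, Rw w ⊆ ⋃ k, Rw (w ++ [k]) := by
    rintro w _ ⟨x, hx, rfl⟩
    refine Set.mem_iUnion.2 ⟨x w.length, x, ?_, rfl⟩
    simp only [Set.mem_ofPred_eq, List.length_append, List.length_singleton,
      List.range_succ, List.map_append, List.map_singleton] at hx ⊢
    rw [hx]
  let Z := ⋃ w, nonmeagrePoints (Rw w) \ ⋃ k, nonmeagrePoints (Rw (w ++ [k]))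
  have hZ : IsMeagre Z := isMeagre_iUnion fun w ↦
    (isNowhereDense_nonmeagrePoints_diff (hsplit w)).isMeagre
  have hR0 : Rw [] = Set.range f := by simp [Rw]
  have hsub : nonmeagrePoints (Set.range f) \ Z ⊆ Set.range f := by
    rintro p ⟨hp, hpZ⟩
    have hnext : ∀ w, p ∈ nonmeagrePoints (Rw w) → ∃ k, p ∈ nonmeagrePoints (Rw (w ++ [k])) := by
      intro w hw
      by_contra h
      exact hpZ (Set.mem_iUnion.2 ⟨w, hw, fun h' ↦ h (Set.mem_iUnion.1 h')⟩)
    choose! g hg using hnext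
    let W : ℕ → List ℕ := fun n ↦ Nat.rec [] (fun _ w ↦ w ++ [g w]) n
    have hW : ∀ n, W (n + 1) = W n ++ [g (W n)] := fun n ↦ rfl
    let x : ℕ → ℕ := fun n ↦ g (W n)
    have hWx : ∀ n, W n = (List.range n).map x := by
      intro n
      induction n with
      | zero => rfl
      | succ n ih => rw [hW, List.range_succ, List.map_append, ← ih]; rfl
    have hpW : ∀ n, p ∈ nonmeagrePoints (Rw (W n)) := by
      intro n
      induction n with
      | zero => change p ∈ nonmeagrePoints (Rw []); rwa [hR0]
      | succ n ih => exact hg _ ih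
    refine ⟨x, ?_⟩
    by_contra hne
    obtain ⟨U, V, hU, hV, hxU, hpV, hd⟩ := t2_separation hne
    have hpre : f ⁻¹' U ∈ 𝓝 x := hf.continuousAt.preimage_mem_nhds (hU.mem_nhds hxU)
    obtain ⟨n, hn⟩ : ∃ n, PiNat.cylinder x n ⊆ f ⁻¹' U := by
      obtain ⟨n, hn⟩ := (PiNat.isTopologicalBasis_cylinders (fun _ : ℕ ↦ ℕ)).mem_nhds_iff.1 hpre
      obtain ⟨⟨y, m, rfl⟩, hx, hsub⟩ := hn
      exact ⟨m, by rwa [PiNat.mem_cylinder_iff_eq.1 hx]⟩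
    obtain ⟨q, hqV, z, hz, rfl⟩ := mem_closure_iff.1
      (nonmeagrePoints_subset_closure _ (hpW n)) V hV hpV
    refine Set.disjoint_left.1 hd (hn ?_) hqV
    intro i hi
    simp only [hWx, Set.mem_ofPred_eq, List.length_map, List.length_range] at hz
    exact (List.map_inj_left.1 hz) i (List.mem_range.2 hi)
  have hQ : (interior (nonmeagrePoints (Set.range f))).Nonempty := by
    by_contra h
    rw [Set.not_nonempty_iff_eq_empty, ← IsClosed.isNowhereDense_iff
      (isClosed_nonmeagrePoints _)] at h
    refine hm (((isMeagre_diff_nonmeagrePoints (Set.range f)).union h.isMeagre).mono ?_)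
    intro q hq
    by_cases hq' : q ∈ nonmeagrePoints (Set.range f)
    · exact Or.inr hq'
    · exact Or.inl ⟨hq, hq'⟩
  refine ⟨_, isOpen_interior, hQ, hZ.mono ?_⟩
  rintro q ⟨hq, hqR⟩
  by_contra hqZ
  exact hqR (hsub ⟨interior_subset hq, hqZ⟩)

/-- Almost all vertical sections of a closed nowhere dense set are nowhere dense. -/
theorem isMeagre_setOf_section {X Y : Type*} [TopologicalSpace X] [TopologicalSpace Y]
    [SecondCountableTopology Y] {F : Set (X × Y)} (hF : IsClosed F) (hF' : IsNowhereDense F) :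
    IsMeagre {x | ¬ IsNowhereDense {y | (x, y) ∈ F}} := by
  let 𝓑 := TopologicalSpace.countableBasis Y
  have h𝓑 := TopologicalSpace.isBasis_countableBasis Y
  have hc : Countable 𝓑 := (TopologicalSpace.countable_countableBasis Y).to_subtype
  refine IsMeagre.mono (s := ⋃ U : 𝓑, {x | ∀ y ∈ U.1, (x, y) ∈ F}) ?_ (isMeagre_iUnion ?_)
  · intro x hx
    have hcl : IsClosed {y | (x, y) ∈ F} := hF.preimage (by fun_prop)
    simp only [Set.mem_ofPred_eq, hcl.isNowhereDense_iff] at hx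
    obtain ⟨y, hy⟩ := Set.nonempty_iff_ne_empty.2 hx
    obtain ⟨V, hV, hyV, hVU⟩ := h𝓑.exists_subset_of_mem_open hy isOpen_interior
    exact Set.mem_iUnion.2 ⟨⟨V, hV⟩, fun z hz ↦ interior_subset (s := {y | (x, y) ∈ F}) (hVU hz)⟩
  · rintro ⟨U, hU⟩
    apply IsNowhereDense.isMeagre
    have hcl : IsClosed {x | ∀ y ∈ U, (x, y) ∈ F} := by
      simp only [Set.ofPred_forall]
      exact isClosed_biInter fun y _ ↦ hF.preimage (by fun_prop)
    rw [hcl.isNowhereDense_iff]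
    by_contra hne
    obtain ⟨x, hx⟩ := Set.nonempty_iff_ne_empty.2 hne
    obtain ⟨y, hy⟩ := TopologicalSpace.nonempty_of_mem_countableBasis hU
    have hsub : interior {x | ∀ y ∈ U, (x, y) ∈ F} ×ˢ U ⊆ F := by
      rintro ⟨a, b⟩ ⟨ha, hb⟩
      exact interior_subset ha b hb
    have : (x, y) ∈ interior F := interior_maximal hsub
      (isOpen_interior.prod (h𝓑.isOpen hU)) ⟨hx, hy⟩
    rw [hF.isNowhereDense_iff.1 hF'] at this
    exact this

/-- An analytic relation with meagre sections is meagre. -/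
theorem isMeagre_of_sections {X : Type*} [TopologicalSpace X] [PolishSpace X]
    {R : Set (X × X)} (hR : AnalyticSet R) (hs : ∀ x, IsMeagre {y | (x, y) ∈ R}) :
    IsMeagre R := by
  by_contra hm
  obtain ⟨O, hO, ⟨⟨x₀, y₀⟩, hxy⟩, hOR⟩ := exists_isOpen_isMeagre_diff hR hm
  obtain ⟨U, V, hU, hV, hx₀, hy₀, hUV⟩ := isOpen_prod_iff.1 hO x₀ y₀ hxy
  obtain ⟨S, hS, hSc, hsub⟩ := isMeagre_iff_countable_union_isNowhereDense.1 hOR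
  have : Countable S := hSc.to_subtype
  have hbad : IsMeagre (⋃ F : S, {x | ¬ IsNowhereDense {y | (x, y) ∈ closure F.1}}) :=
    isMeagre_iUnion fun F ↦ isMeagre_setOf_section isClosed_closure (hS F.1 F.2).closure
  have hex : ∃ x ∈ U, ∀ F : S, IsNowhereDense {y | (x, y) ∈ closure F.1} := by
    by_contra! h
    refine not_isMeagre_of_isOpen hU ⟨x₀, hx₀⟩ (hbad.mono fun x hx ↦ ?_)
    exact Set.mem_iUnion.2 (h x hx)
  obtain ⟨x, hxU, hx⟩ := hex
  have h2 : IsMeagre (⋃ F : S, {y | (x, y) ∈ closure F.1}) :=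
    isMeagre_iUnion fun F ↦ (hx F).isMeagre
  refine not_isMeagre_of_isOpen hV ⟨y₀, hy₀⟩ (((hs x).union h2).mono fun y hy ↦ ?_)
  by_cases hyR : (x, y) ∈ R
  · exact Or.inl hyR
  · obtain ⟨F, hF, hFm⟩ := hsub ⟨hUV ⟨hxU, hy⟩, hyR⟩
    exact Or.inr (Set.mem_iUnion.2 ⟨⟨F, hF⟩, subset_closure hFm⟩)

end Category

/-- A module which is the union of a well-ordered filtration with free successive quotients
is free. -/
theorem free_of_filtration {R V ι : Type*} [Ring R] [AddCommGroup V] [Module R V] [LinearOrder ι]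
    [WellFoundedLT ι] (M : ι → Submodule R V) (htop : ∀ x, ∃ i, x ∈ M i)
    (hfree : ∀ i, Module.Free R ((M i).map (⨆ j : Set.Iio i, M j).mkQ)) : Module.Free R V := by
  set N : ι → Submodule R V := fun i ↦ ⨆ j : Set.Iio i, M j with hN
  let b := fun i ↦ Module.Free.chooseBasis R ((M i).map (N i).mkQ)
  have hlift : ∀ i j, ∃ x ∈ M i, (N i).mkQ x = b i j := fun i j ↦ (b i j).2
  choose c hcM hcb using hlift
  let J := fun i ↦ Module.Free.ChooseBasisIndex R ((M i).map (N i).mkQ)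
  let w : (Σ i, J i) → V := fun σ ↦ c σ.1 σ.2
  have hMN : ∀ i j, i < j → M i ≤ N j := fun i j hij ↦
    le_iSup (fun k : Set.Iio j ↦ M k) ⟨i, hij⟩
  have hli : LinearIndependent R w := by
    rw [linearIndependent_iff']
    intro s g hg
    classical
    by_contra! hne
    obtain ⟨σ₀, hσ₀, hgσ₀⟩ := hne
    obtain ⟨σ, hσ, hmax⟩ := (s.filter (fun σ ↦ g σ ≠ 0)).exists_max_image (fun σ ↦ σ.1)
      ⟨σ₀, Finset.mem_filter.2 ⟨hσ₀, hgσ₀⟩⟩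
    rw [Finset.mem_filter] at hσ
    have h0 := congrArg (N σ.1).mkQ hg
    rw [map_sum, map_zero] at h0
    have hb : LinearIndependent R fun j ↦ ((b σ.1 j : (M σ.1).map (N σ.1).mkQ) : V ⧸ N σ.1) :=
      (b σ.1).linearIndependent.map' (Submodule.subtype _) (Submodule.ker_subtype _)
    rw [linearIndependent_iff'] at hb
    let φ : J σ.1 → Σ i, J i := fun j ↦ ⟨σ.1, j⟩
    have hφ : Function.Injective φ := sigma_mk_injective
    refine hσ.2 (hb (s.preimage φ hφ.injOn)
      (fun j ↦ g ⟨σ.1, j⟩) ?_ σ.2 (Finset.mem_preimage.2 hσ.1))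
    rw [← h0]
    simp only [← hcb]
    rw [← Finset.sum_preimage φ s hφ.injOn
      (fun τ ↦ (N σ.1).mkQ (g τ • w τ))]
    · exact Finset.sum_congr rfl fun j _ ↦ by rw [map_smul]
    · intro τ hτ hτr
      by_cases hgτ : g τ = 0
      · rw [hgτ, zero_smul, map_zero]
      · have hle := hmax τ (Finset.mem_filter.2 ⟨hτ, hgτ⟩)
        have hlt : τ.1 < σ.1 := lt_of_le_of_ne hle fun h ↦ hτr (by
          obtain ⟨i, j⟩ := τ
          subst h
          exact ⟨j, rfl⟩)
        rw [Submodule.mkQ_apply, Submodule.Quotient.mk_eq_zero]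
        exact (N σ.1).smul_mem _ (hMN _ _ hlt (hcM _ _))
  have hspan : ∀ i, M i ≤ Submodule.span R (Set.range w) := by
    intro i
    induction i using WellFoundedLT.induction with
    | ind i ih =>
    have hNi : N i ≤ Submodule.span R (Set.range w) := iSup_le fun j ↦ ih j j.2
    intro x hx
    have hx' := (b i).mem_span ⟨(N i).mkQ x, Submodule.mem_map_of_mem hx⟩
    have h2 : (N i).mkQ x ∈ (Submodule.span R (Set.range w)).map (N i).mkQ := by
      have := Submodule.mem_map_of_mem (f := Submodule.subtype _) hx'
      rw [Submodule.map_span] at this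
      refine (Submodule.span_le.2 ?_ : _ ≤ _) this
      rintro _ ⟨_, ⟨j, rfl⟩, rfl⟩
      exact ⟨w ⟨i, j⟩, Submodule.subset_span ⟨_, rfl⟩, hcb i j⟩
    obtain ⟨y, hy, hxy⟩ := h2
    have : x - y ∈ N i := by
      rw [← Submodule.Quotient.mk_eq_zero, ← Submodule.mkQ_apply, map_sub, hxy, sub_self]
    have h3 := add_mem (hNi this) hy
    rwa [sub_add_cancel] at h3
  exact Module.Free.of_basis (Module.Basis.mk hli fun x _ ↦
    (htop x).elim fun i hi ↦ hspan i hi)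

theorem NoRigid.torsionFree {G : Type*} [AddCommGroup G] (hG : NoRigid G) (k : ℤ) (x : G)
    (hk : k ≠ 0) (hx : k • x = 0) : x = 0 := by
  refine congrFun (hG 1 (fun _ ↦ x) fun d hd ↦ ⟨0, fun _ ↦ k, 0, 0, zero_mem _, ?_, ?_⟩) 0
  · simp [hx]
  · have : d 0 ≠ 0 := fun h ↦ hd (funext fun j ↦ by rw [Subsingleton.elim j 0, h]; rfl)
    simp [hk, this]

theorem NoRigid.fg_of_finiteRank {G : Type*} [AddCommGroup G] (hG : NoRigid G) {n : ℕ}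
    (a : Fin n → G) (V : Submodule ℤ G)
    (hV : ∀ x ∈ V, ∃ (m : ℤ) (c : Fin n → ℤ), m ≠ 0 ∧ m • x = ∑ j, c j • a j) : V.FG := by
  induction n generalizing V with
  | zero =>
    have : V = ⊥ := by
      refine (Submodule.eq_bot_iff _).2 fun x hx ↦ ?_
      obtain ⟨m, c, hm, h⟩ := hV x hx
      exact hG.torsionFree m x hm (by simpa using h)
    rw [this]
    exact Submodule.fg_bot
  | succ n ih =>
    by_cases ha : a = 0
    · have : V = ⊥ := by
        refine (Submodule.eq_bot_iff _).2 fun x hx ↦ ?_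
        obtain ⟨m, c, hm, h⟩ := hV x hx
        exact hG.torsionFree m x hm (by simpa [ha] using h)
      rw [this]
      exact Submodule.fg_bot
    have hr : ¬ Rigid ⊥ a := fun h ↦ ha (hG _ a h)
    unfold Rigid at hr
    push Not at hr
    obtain ⟨d, hd, hdiv⟩ := hr
    replace hdiv : ∀ (m : ℤ) (c : Fin (n + 1) → ℤ) (u : G), m • u = ∑ j, c j • a j →
        m ∣ ∑ j, c j * d j := fun m c u h ↦ hdiv m c 0 u (zero_mem _) (by rw [zero_add, h])
    obtain ⟨f, hf⟩ : ∃ f : G →+ ℚ, ∀ c : Fin (n + 1) → ℤ,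
        f (∑ j, c j • a j) = ((∑ j, c j * d j : ℤ) : ℚ) := by
      let T : (Fin (n + 1) → ℤ) →+ G :=
        { toFun := fun c ↦ ∑ j, c j • a j
          map_zero' := by simp
          map_add' := fun x y ↦ by simp [add_smul, Finset.sum_add_distrib] }
      let D : (Fin (n + 1) → ℤ) →+ ℚ :=
        { toFun := fun c ↦ ((∑ j, c j * d j : ℤ) : ℚ)
          map_zero' := by simp
          map_add' := fun x y ↦ by simp [add_mul, Finset.sum_add_distrib] }
      have hker : T.rangeRestrict.ker ≤ D.ker := by
        intro c hc
        have hc' : ∑ j, c j • a j = 0 := congrArg Subtype.val hc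
        have := hdiv 0 c 0 (by rw [hc', smul_zero])
        simpa [D] using congrArg (Int.cast : ℤ → ℚ) (zero_dvd_iff.1 this)
      obtain ⟨f, hf⟩ := exists_extension baer_rat T.range
        (T.rangeRestrict.liftOfSurjective T.rangeRestrict_surjective ⟨D, hker⟩)
      refine ⟨f, fun c ↦ ?_⟩
      have h1 := hf (T.rangeRestrict c)
      have h2 := T.rangeRestrict.liftOfRightInverse_comp_apply _
        (Function.rightInverse_surjInv T.rangeRestrict_surjective) ⟨D, hker⟩ c
      exact h1.trans h2
    have hint : ∀ x ∈ V, ∃ t : ℤ, f x = t := by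
      intro x hx
      obtain ⟨m, c, hm, h⟩ := hV x hx
      obtain ⟨t, ht⟩ := hdiv m c x h
      refine ⟨t, ?_⟩
      have h1 := hf c
      rw [← h, map_zsmul, ht, zsmul_eq_mul] at h1
      have hm' : (m : ℚ) ≠ 0 := by exact_mod_cast hm
      push_cast at h1
      exact mul_left_cancel₀ hm' h1
    refine Submodule.fg_of_fg_map_of_fg_inf_ker f.toIntLinearMap ?_ ?_
    · have hle : V.map f.toIntLinearMap ≤
          LinearMap.range (Algebra.linearMap ℤ ℚ) := by
        rintro _ ⟨x, hx, rfl⟩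
        obtain ⟨t, ht⟩ := hint x hx
        exact ⟨t, by simp [ht]⟩
      have hfin : IsNoetherian ℤ (LinearMap.range (Algebra.linearMap ℤ ℚ)) := inferInstance
      exact Submodule.FG.of_le_of_isNoetherian hle
    · obtain ⟨j₀, hj₀⟩ := Function.ne_iff.1 hd
      refine ih (fun j ↦ d j₀ • a (j₀.succAbove j) - d (j₀.succAbove j) • a j₀) _ ?_
      rintro x ⟨hxV, hxf⟩
      obtain ⟨m, c, hm, h⟩ := hV x hxV
      refine ⟨d j₀ * m, fun j ↦ c (j₀.succAbove j), mul_ne_zero hj₀ hm, ?_⟩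
      have hfx : f x = 0 := hxf
      have h0 : ∑ j, c j * d j = 0 := by
        have := hf c
        rw [← h, map_zsmul, hfx, smul_zero] at this
        exact_mod_cast this.symm
      rw [Fin.sum_univ_succAbove _ j₀] at h0 h
      rw [mul_smul, h]
      simp only [smul_sub, smul_add, Finset.sum_sub_distrib, Finset.smul_sum, smul_smul]
      rw [← Finset.sum_smul, show ∑ j, c (j₀.succAbove j) * d (j₀.succAbove j) = -(c j₀ * d j₀) by
        linarith, neg_smul, sub_neg_eq_add, mul_comm (d j₀), add_comm]
      simp only [mul_comm (d j₀)]

theorem NoRigid.free_of_countable {G : Type*} [AddCommGroup G] [Countable G] (hG : NoRigid G) :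
    Module.Free ℤ G := by
  obtain ⟨e, he⟩ := exists_surjective_nat G
  let M : ℕ → Submodule ℤ G := fun k ↦ AddSubgroup.toIntSubmodule
    (pureClosure (AddSubgroup.closure (Set.range fun j : Fin (k + 1) ↦ e j)))
  have hmemM : ∀ k x, x ∈ M k ↔ ∃ m : ℤ, m ≠ 0 ∧
      m • x ∈ AddSubgroup.closure (Set.range fun j : Fin (k + 1) ↦ e j) := fun _ _ ↦ Iff.rfl
  have hpure : ∀ k (t : ℤ) x, t ≠ 0 → t • x ∈ M k → x ∈ M k := fun k t x ht hx ↦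
    isPure_pureClosure _ t ht x hx
  have hmono : Monotone M := by
    intro i j hij x hx
    obtain ⟨m, hm, h⟩ := (hmemM i x).1 hx
    refine (hmemM j x).2 ⟨m, hm, AddSubgroup.closure_mono ?_ h⟩
    rintro _ ⟨t, rfl⟩
    exact ⟨⟨t, by omega⟩, rfl⟩
  have hfg : ∀ k, (M k).FG := by
    intro k
    refine hG.fg_of_finiteRank (fun j : Fin (k + 1) ↦ e j) _ fun x hx ↦ ?_
    obtain ⟨m, hm, h⟩ := (hmemM k x).1 hx
    have h' : m • x ∈ Submodule.span ℤ (Set.range fun j : Fin (k + 1) ↦ e j) := by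
      rw [← Submodule.mem_toAddSubgroup,
        Submodule.span_int_eq_addSubgroupClosure]
      exact h
    obtain ⟨c, hc⟩ := (Submodule.mem_span_range_iff_exists_fun ℤ).1 h'
    exact ⟨m, c, hm, hc.symm⟩
  refine free_of_filtration M (fun x ↦ ?_) fun k ↦ ?_
  · obtain ⟨k, rfl⟩ := he x
    exact ⟨k, (hmemM _ _).2 ⟨1, one_ne_zero, by
      rw [one_smul]
      exact AddSubgroup.subset_closure ⟨Fin.last k, by simp⟩⟩⟩
  · set N := ⨆ j : Set.Iio k, M j with hN
    have hNpure : ∀ (t : ℤ) x, t ≠ 0 → t • x ∈ N → x ∈ N := by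
      rcases k with _ | k
      · have : N = ⊥ := by
          rw [hN, iSup_eq_bot]
          rintro ⟨j, hj⟩
          exact absurd hj (Nat.not_lt_zero j)
        rw [this]
        intro t x ht hx
        exact hG.torsionFree t x ht hx
      · have : N = M k := le_antisymm
          (iSup_le fun j ↦ hmono (Nat.lt_succ_iff.1 j.2))
          (le_iSup (fun j : Set.Iio (k + 1) ↦ M j) ⟨k, Nat.lt_succ_self k⟩)
        rw [this]
        exact hpure k
    refine free_of_fg ?_ ?_
    · rw [← Module.Finite.iff_addGroup_fg, Module.Finite.iff_fg]
      exact (hfg k).map _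
    · rintro t ⟨_, x, hx, rfl⟩ h
      by_cases ht : t = 0
      · exact Or.inl ht
      · right
        have h1 : N.mkQ (t • x) = 0 := by
          rw [map_smul]; exact congrArg Subtype.val h
        rw [Submodule.mkQ_apply, Submodule.Quotient.mk_eq_zero] at h1
        exact Subtype.ext ((Submodule.Quotient.mk_eq_zero N).2 (hNpure t x ht h1))

/-- `N` is closed, relative to `K`, under the set-valued finitary operation `F`. -/
def ClosedUnder {B : Type*} [AddCommGroup B] (K : AddSubgroup B) (F : List B → Set B)
    (N : AddSubgroup B) : Prop :=
  ∀ l : List B, (∀ x ∈ l, x ∈ N) → ∀ x ∈ F l, x ∈ K → x ∈ N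

/-- The smallest subgroup containing `S` and closed under `F` relative to `K`. -/
def hull {B : Type*} [AddCommGroup B] (K : AddSubgroup B) (F : List B → Set B) (S : Set B) :
    AddSubgroup B :=
  sInf {N | S ⊆ N ∧ ClosedUnder K F N}

section hull
variable {B : Type*} [AddCommGroup B] {K : AddSubgroup B} {F : List B → Set B} {S : Set B}

theorem subset_hull : S ⊆ hull K F S := fun _ hx ↦
  AddSubgroup.mem_sInf.2 fun _ hN ↦ hN.1 hx

theorem hull_le {N : AddSubgroup B} (hS : S ⊆ N) (hN : ClosedUnder K F N) : hull K F S ≤ N :=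
  sInf_le ⟨hS, hN⟩

theorem closedUnder_hull : ClosedUnder K F (hull K F S) := fun l hl x hx hxK ↦
  AddSubgroup.mem_sInf.2 fun _ hN ↦
    hN.2 l (fun y hy ↦ (hull_le hN.1 hN.2) (hl y hy)) x hx hxK

theorem hull_mono {T : Set B} (h : S ⊆ T) : hull K F S ≤ hull K F T :=
  hull_le (h.trans subset_hull) closedUnder_hull

theorem countable_hull (hF : ∀ l, (F l).Countable) (hS : S.Countable) :
    (hull K F S : Set B).Countable := by
  let step : Set B → Set B := fun T ↦
    AddSubgroup.closure (T ∪ ⋃ l ∈ {l : List B | ∀ x ∈ l, x ∈ T}, F l)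
  have hstep : ∀ T, T ⊆ step T := fun T ↦
    Set.subset_union_left.trans AddSubgroup.subset_closure
  have hstepc : ∀ T : Set B, T.Countable → (step T).Countable := fun T hT ↦ by
    have := hT.to_subtype
    have hlist : {l : List B | ∀ x ∈ l, x ∈ T}.Countable := by
      rw [← Set.range_list_map_coe]
      exact Set.countable_range _
    exact countable_closure (hT.union
      (hlist.biUnion fun l _ ↦ hF l))
  let T : ℕ → Set B := fun k ↦ step^[k + 1] S
  have hT1 : ∀ k, T (k + 1) = step (T k) := fun k ↦ Function.iterate_succ_apply' _ _ _
  have hTmono : Monotone T := monotone_nat_of_le_succ fun k ↦ by rw [hT1]; exact hstep _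
  have hTc : ∀ k, (T k).Countable := by
    intro k
    induction k with
    | zero => exact hstepc _ hS
    | succ k ih => rw [hT1]; exact hstepc _ ih
  have hTadd : ∀ k, ∃ H : AddSubgroup B, T k = H := by
    intro k
    rcases k with _ | k
    · exact ⟨_, rfl⟩
    · rw [hT1]; exact ⟨_, rfl⟩
  choose H hH using hTadd
  have hHmono : Monotone H := fun i j hij ↦ by
    rw [← SetLike.coe_subset_coe, ← hH, ← hH]; exact hTmono hij
  have hmem : ∀ x, x ∈ (⨆ k, H k) ↔ ∃ k, x ∈ T k := fun x ↦ by
    rw [AddSubgroup.mem_iSup_of_directed hHmono.directed_le]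
    simp only [hH, SetLike.mem_coe]
  have hcount : ((⨆ k, H k : AddSubgroup B) : Set B).Countable := by
    have : ((⨆ k, H k : AddSubgroup B) : Set B) = ⋃ k, T k := by ext x; simp [hmem x]
    rw [this]
    exact Set.countable_iUnion hTc
  refine hcount.mono (hull_le ?_ ?_)
  · exact fun x hx ↦ (hmem x).2 ⟨0, hstep S hx⟩
  · intro l hl x hx _
    have : ∃ k, ∀ y ∈ l, y ∈ T k := by
      clear hx
      induction l with
      | nil => exact ⟨0, by simp⟩
      | cons y l ih =>
        obtain ⟨k, hk⟩ := ih fun z hz ↦ hl z (List.mem_cons_of_mem _ hz)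
        obtain ⟨k', hk'⟩ := (hmem y).1 (hl y List.mem_cons_self)
        refine ⟨max k k', fun z hz ↦ ?_⟩
        rcases List.mem_cons.1 hz with rfl | hz
        · exact hTmono (le_max_right _ _) hk'
        · exact hTmono (le_max_left _ _) (hk z hz)
    obtain ⟨k, hk⟩ := this
    refine (hmem x).2 ⟨k + 1, ?_⟩
    rw [hT1]
    exact AddSubgroup.subset_closure (Or.inr (Set.mem_biUnion (show l ∈ _ from hk) hx))

end hull

/-- There is an `n`-tuple from `K`, not contained in `N`, which is rigid over `N`. -/
def IsBad {B : Type*} [AddCommGroup B] (K : AddSubgroup B) (n : ℕ) (N : AddSubgroup B) : Prop :=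
  ∃ a : Fin n → B, (∀ j, a j ∈ K) ∧ (∃ j, a j ∉ N) ∧ Rigid N a

theorem noRigid_quotient {B : Type*} [AddCommGroup B] {K N : AddSubgroup B}
    (hN : ∀ n, ¬ IsBad K n N) (N' P : Submodule ℤ K) (hNN' : ∀ x : K, x ∈ N' ↔ (x : B) ∈ N) :
    NoRigid (P.map N'.mkQ) := by
  intro n a ha
  have hx : ∀ j, ∃ x : K, N'.mkQ x = a j := fun j ↦ by
    obtain ⟨x, -, hx⟩ := (a j).2
    exact ⟨x, hx⟩
  choose x hx using hx
  have hr : Rigid N fun j ↦ (x j : B) := by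
    intro d hd
    obtain ⟨m, c, ℓ, ⟨_, u, huP, rfl⟩, hℓ, hu, hm⟩ := ha d hd
    rw [AddSubgroup.mem_bot] at hℓ
    subst hℓ
    have h1 : m • u - ∑ j, c j • x j ∈ N' := by
      rw [← Submodule.Quotient.mk_eq_zero, ← Submodule.mkQ_apply]
      simp only [map_sub, map_smul, map_sum, hx]
      have := congrArg Subtype.val hu
      rw [sub_eq_zero]
      simpa using this
    refine ⟨m, c, _, u, (hNN' _).1 h1, ?_, hm⟩
    simp
  by_contra hne
  refine hN n ⟨_, fun j ↦ (x j).2, ?_, hr⟩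
  by_contra! hall
  refine hne (funext fun j ↦ Subtype.ext ?_)
  rw [← hx]
  exact (Submodule.Quotient.mk_eq_zero N').2 ((hNN' _).2 (hall j))

theorem free_of_not_isBad {B : Type*} [AddCommGroup B] (hB : NoRigid B) {K : AddSubgroup B}
    (hK : #K ≤ aleph 1) {F : List B → Set B} (hF : ∀ l, (F l).Countable)
    (h : ∀ N ≤ K, ClosedUnder K F N → ∀ n, ¬ IsBad K n N) : Module.Free ℤ K := by
  let ι := (aleph 1).ord.ToType
  obtain ⟨e⟩ : Nonempty (K ↪ ι) := by
    rw [← Cardinal.le_def, mk_ord_toType]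
    exact hK
  let S : ι → Set B := fun i ↦ (↑) '' {x : K | e x ≤ i}
  have hSc : ∀ i, (S i).Countable := fun i ↦ by
    refine Set.Countable.image ?_ _
    have : (Set.Iic i).Countable := by
      rw [← Set.Iio_insert]
      refine Set.Countable.insert _ ?_
      have hlt := Cardinal.mk_Iio_lt i (by simp [ι])
      rwa [mk_ord_toType, lt_aleph_one_iff, le_aleph0_iff_set_countable] at hlt
    exact this.preimage_of_injOn e.injective.injOn
  have hSK : ∀ i, S i ⊆ K := by
    rintro i _ ⟨x, -, rfl⟩
    exact x.2
  let P : ι → Submodule ℤ K := fun i ↦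
    AddSubgroup.toIntSubmodule ((hull K F (S i)).addSubgroupOf K)
  have hP : ∀ i (x : K), x ∈ P i ↔ (x : B) ∈ hull K F (S i) := fun _ _ ↦ Iff.rfl
  have hPmono : Monotone P := fun i j hij x hx ↦
    (hP j x).2 (hull_mono (Set.image_mono fun y hy ↦ le_trans hy hij) ((hP i x).1 hx))
  refine free_of_filtration P (fun x ↦ ⟨e x, (hP _ _).2 (subset_hull ⟨x, le_refl (e x), rfl⟩)⟩)
    fun i ↦ ?_
  set N' := ⨆ j : Set.Iio i, P j with hN'
  let N : AddSubgroup B := N'.toAddSubgroup.map K.subtype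
  have hNN' : ∀ x : K, x ∈ N' ↔ (x : B) ∈ N := fun x ↦ by
    simp [N, AddSubgroup.mem_map]
  have hNK : N ≤ K := by
    rintro _ ⟨x, -, rfl⟩
    exact x.2
  have hbad : ∀ n, ¬ IsBad K n N := by
    by_cases hne : Nonempty (Set.Iio i)
    · refine h N hNK fun l hl x hx hxK ↦ ?_
      have hmem : ∀ y : K, (y : B) ∈ N ↔ ∃ j : Set.Iio i, (y : B) ∈ hull K F (S j) := fun y ↦ by
        rw [← hNN', hN', Submodule.mem_iSup_of_directed]
        · exact Iff.rfl
        · exact (hPmono.comp (Subtype.mono_coe _)).directed_le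
      have : ∃ j : Set.Iio i, ∀ y ∈ l, y ∈ hull K F (S j) := by
        clear hx
        induction l with
        | nil => exact ⟨hne.some, by simp⟩
        | cons y l ih =>
          obtain ⟨k, hk⟩ := ih fun z hz ↦ hl z (List.mem_cons_of_mem _ hz)
          have hyN := hl y List.mem_cons_self
          obtain ⟨k', hk'⟩ := (hmem ⟨y, hNK hyN⟩).1 hyN
          refine ⟨max k k', fun z hz ↦ ?_⟩
          rcases List.mem_cons.1 hz with rfl | hz
          · exact hPmono (show (k' : ι) ≤ (max k k' : Set.Iio i) from le_max_right k k')
              (show (⟨z, hNK hyN⟩ : K) ∈ P k' from hk')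
          · have hzN := hl z (List.mem_cons_of_mem _ hz)
            exact hPmono (show (k : ι) ≤ (max k k' : Set.Iio i) from le_max_left k k')
              (show (⟨z, hNK hzN⟩ : K) ∈ P k from hk z hz)
      obtain ⟨j, hj⟩ := this
      exact (hmem ⟨x, hxK⟩).2 ⟨j, closedUnder_hull l hj x hx hxK⟩
    · have : N = ⊥ := by
        have : IsEmpty (Set.Iio i) := not_nonempty_iff.1 hne
        have : N' = ⊥ := by rw [hN', iSup_of_empty]
        simp [N, this, AddSubgroup.map_bot]
      rw [this]
      rintro n ⟨a, -, ⟨j, hj⟩, ha⟩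
      exact hj (by rw [hB n a ha]; simp)
  have hnr := noRigid_quotient hbad N' (P i) hNN'
  have hcount : Countable ((P i).map N'.mkQ) := by
    have : (P i : Set K).Countable :=
      (countable_hull hF (hSc i)).preimage Subtype.val_injective
    exact (this.image N'.mkQ).to_subtype
  exact hnr.free_of_countable

/-- A family of subgroups is large (stationary) if it meets every closed unbounded set of
countable subgroups. -/
def Large {B : Type*} [AddCommGroup B] (K : AddSubgroup B) (𝒜 : Set (AddSubgroup B)) : Prop :=
  ∀ F : List B → Set B, (∀ l, (F l).Countable) → ∃ N ∈ 𝒜, ClosedUnder K F N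

section Large
variable {B : Type*} [AddCommGroup B] {K : AddSubgroup B} {𝒜 𝒞 : Set (AddSubgroup B)}

theorem Large.mono (h : Large K 𝒜) (h' : 𝒜 ⊆ 𝒞) : Large K 𝒞 := fun F hF ↦
  let ⟨N, hN, hNF⟩ := h F hF
  ⟨N, h' hN, hNF⟩

theorem Large.nonempty (h : Large K 𝒜) : 𝒜.Nonempty :=
  let ⟨N, hN, _⟩ := h (fun _ ↦ ∅) fun _ ↦ Set.countable_empty
  ⟨N, hN⟩

theorem Large.exists_subset (h : Large K 𝒜) {S : Set B} (hS : S.Countable) (hSK : S ⊆ K) :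
    ∃ N ∈ 𝒜, S ⊆ N :=
  let ⟨N, hN, hNF⟩ := h (fun _ ↦ S) fun _ ↦ hS
  ⟨N, hN, fun x hx ↦ hNF [] (by simp) x hx (hSK hx)⟩

theorem exists_closure_of_not_large {I : Type*} [Countable I] {𝒜 : I → Set (AddSubgroup B)}
    (h : ∀ i, ¬ Large K (𝒜 i)) : ∃ F : List B → Set B, (∀ l, (F l).Countable) ∧
      ∀ N, ClosedUnder K F N → ∀ i, N ∉ 𝒜 i := by
  unfold Large at h
  push Not at h
  choose F hF hFN using h
  refine ⟨fun l ↦ ⋃ i, F i l, fun l ↦ Set.countable_iUnion fun i ↦ hF i l,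
    fun N hN i hNi ↦ hFN i N hNi fun l hl x hx hxK ↦ hN l hl x (Set.mem_iUnion.2 ⟨i, hx⟩) hxK⟩

theorem Large.exists_of_iUnion {I : Type*} [Countable I] {𝒜 : I → Set (AddSubgroup B)}
    (h : Large K (⋃ i, 𝒜 i)) : ∃ i, Large K (𝒜 i) := by
  by_contra! hc
  obtain ⟨F, hF, hFN⟩ := exists_closure_of_not_large hc
  obtain ⟨N, hN, hNF⟩ := h F hF
  obtain ⟨i, hi⟩ := Set.mem_iUnion.1 hN
  exact hFN N hNF i hi

theorem Large.exists_fiber (h : Large K 𝒜) {f : AddSubgroup B → B} (hf : ∀ N ∈ 𝒜, f N ∈ N) :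
    ∃ k, Large K {N ∈ 𝒜 | f N = k} := by
  by_contra! hc
  unfold Large at hc
  push Not at hc
  choose F hF hFN using hc
  let F' : List B → Set B := fun l ↦ match l with
    | [] => ∅
    | k :: l => F k l
  obtain ⟨N, hN, hNF⟩ := h F' fun l ↦ by
    rcases l with _ | ⟨k, l⟩
    · exact Set.countable_empty
    · exact hF k l
  refine hFN (f N) N ⟨hN, rfl⟩ fun l hl x hx hxK ↦ hNF (f N :: l) (fun y hy ↦ ?_) x hx hxK
  rcases List.mem_cons.1 hy with rfl | hy
  · exact hf N hN
  · exact hl y hy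

theorem Large.exists_fiber_prod {C : Type*} [Countable C] (h : Large K 𝒜)
    {f : AddSubgroup B → B × C} (hf : ∀ N ∈ 𝒜, (f N).1 ∈ N) :
    ∃ k, Large K {N ∈ 𝒜 | f N = k} := by
  obtain ⟨k, hk⟩ := h.exists_fiber (f := fun N ↦ (f N).1) hf
  obtain ⟨c, hc⟩ := Large.exists_of_iUnion (I := C)
    (𝒜 := fun c ↦ {N ∈ 𝒜 | f N = (k, c)}) (hk.mono fun N hN ↦
      Set.mem_iUnion.2 ⟨(f N).2, hN.1, Prod.ext hN.2 rfl⟩)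
  exact ⟨_, hc⟩

theorem Large.diff_iUnion {I : Type*} [Countable I] {𝒞 : I → Set (AddSubgroup B)}
    (h : Large K 𝒜) (hc : ∀ i, ¬ Large K (𝒞 i)) : Large K {N ∈ 𝒜 | ∀ i, N ∉ 𝒞 i} := by
  have : Large K (⋃ o : Option I, (o.elim {N ∈ 𝒜 | ∀ i, N ∉ 𝒞 i} 𝒞 : Set (AddSubgroup B))) := by
    refine h.mono fun N hN ↦ ?_
    by_cases hi : ∀ i, N ∉ 𝒞 i
    · exact Set.mem_iUnion.2 ⟨none, hN, hi⟩
    · push Not at hi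
      obtain ⟨i, hi⟩ := hi
      exact Set.mem_iUnion.2 ⟨some i, hi⟩
  obtain ⟨o, ho⟩ := this.exists_of_iUnion
  rcases o with _ | i
  · exact ho
  · exact absurd ho (hc i)

end Large

theorem exists_countable_closed {B I C : Type*} [AddCommGroup B] [Countable I] [Countable C]
    (T : List (I × (B × C)) → Set B) (hT : ∀ p, (T p).Countable) :
    ∃ L : AddSubgroup B, (L : Set B).Countable ∧ ∀ p, (∀ e ∈ p, e.2.1 ∈ L) → T p ⊆ L := by
  let F : List B → Set B := fun l ↦ ⋃ p ∈ {p : List (I × (B × C)) | p.map (·.2.1) = l}, T p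
  have hF : ∀ l, (F l).Countable := by
    refine fun l ↦ Set.Countable.biUnion ?_ fun p _ ↦ hT p
    have hinj : Set.InjOn (fun p : List (I × (B × C)) ↦ p.map fun e ↦ (e.1, e.2.2))
        {p | p.map (·.2.1) = l} := by
      intro p hp p' hp' h
      change p.map _ = _ at hp
      change p'.map _ = _ at hp'
      rw [← hp'] at hp
      clear hp'
      induction p generalizing p' with
      | nil => exact (List.map_eq_nil_iff.1 hp.symm).symm
      | cons e p ih =>
        rcases p' with _ | ⟨e', p'⟩
        · simp at hp
        · simp only [List.map_cons, List.cons.injEq, Prod.mk.injEq] at hp h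
          rw [ih h.2 hp.2, show e = e' from Prod.ext h.1.1 (Prod.ext hp.1 h.1.2)]
    exact Set.countable_of_injective_of_countable_image hinj (Set.to_countable _)
  refine ⟨hull ⊤ F ∅, countable_hull hF Set.countable_empty, fun p hp x hx ↦ ?_⟩
  refine closedUnder_hull (p.map (·.2.1)) (fun y hy ↦ ?_) x
    (Set.mem_biUnion (show p ∈ {p' : List (I × (B × C)) | p'.map (·.2.1) = p.map (·.2.1)} from rfl)
      hx) trivial
  obtain ⟨e, he, rfl⟩ := List.mem_map.1 hy
  exact hp e he

theorem exists_finite_testing {B : Type*} [AddCommGroup B] (m : ℤ) (Λ : Set B) :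
    ∃ Λ₀ : Set B, Λ₀ ⊆ Λ ∧ Λ₀.Finite ∧ ∀ b : B, (∀ ℓ ∈ Λ₀, ∃ u : B, m • u = ℓ + b) →
      ∀ ℓ ∈ Λ, ∃ u : B, m • u = ℓ + b := by
  by_cases h : ∃ ℓ ∈ Λ, ∃ ℓ' ∈ Λ, ¬ ∃ u : B, m • u = ℓ - ℓ'
  · obtain ⟨ℓ, hℓ, ℓ', hℓ', hne⟩ := h
    refine ⟨{ℓ, ℓ'}, Set.pair_subset hℓ hℓ', by simp, fun b hb ↦ ?_⟩
    obtain ⟨u, hu⟩ := hb ℓ (by simp)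
    obtain ⟨u', hu'⟩ := hb ℓ' (by simp)
    exact absurd ⟨u - u', by rw [smul_sub, hu, hu']; abel⟩ hne
  · push Not at h
    rcases Λ.eq_empty_or_nonempty with rfl | ⟨ℓ, hℓ⟩
    · exact ⟨∅, subset_rfl, Set.finite_empty, by simp⟩
    · refine ⟨{ℓ}, by simpa, Set.finite_singleton _, fun b hb ℓ' hℓ' ↦ ?_⟩
      obtain ⟨u, hu⟩ := hb ℓ rfl
      obtain ⟨v, hv⟩ := h ℓ' hℓ' ℓ hℓ
      exact ⟨u + v, by rw [smul_add, hu, hv]; abel⟩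

/-- The inclusion `L × C → B × C`. -/
def incl {B C : Type*} [AddCommGroup B] {L : AddSubgroup B} (a : L × C) : B × C := (a.1, a.2)

/-- The finite partial function `p` is realised by the data `g N` for a large set of `N ∈ 𝒜`. -/
def LargeNode {B I C : Type*} [AddCommGroup B] (K : AddSubgroup B) (𝒜 : Set (AddSubgroup B))
    (g : AddSubgroup B → I → B × C) (p : List (I × (B × C))) : Prop :=
  Large K {N ∈ 𝒜 | ∀ e ∈ p, g N e.1 = e.2}

section LargeNode
variable {B I C : Type*} [AddCommGroup B] {K : AddSubgroup B} {𝒜 : Set (AddSubgroup B)}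
  {g : AddSubgroup B → I → B × C} {p p' : List (I × (B × C))}

theorem LargeNode.of_subset (h : LargeNode K 𝒜 g p) (h' : p' ⊆ p) : LargeNode K 𝒜 g p' :=
  h.mono fun _ hN ↦ ⟨hN.1, fun e he ↦ hN.2 e (h' he)⟩

theorem LargeNode.eq (h : LargeNode K 𝒜 g p) {i : I} {a a' : B × C} (ha : (i, a) ∈ p)
    (ha' : (i, a') ∈ p) : a = a' := by
  obtain ⟨N, -, hN⟩ := h.nonempty
  exact (hN _ ha).symm.trans (hN _ ha')

theorem LargeNode.exists_cons [Countable C] (hg : ∀ N ∈ 𝒜, ∀ i, (g N i).1 ∈ N)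
    (h : LargeNode K 𝒜 g p) (i : I) : ∃ a, LargeNode K 𝒜 g ((i, a) :: p) := by
  obtain ⟨a, ha⟩ := Large.exists_fiber_prod h (f := fun N ↦ g N i) fun N hN ↦ hg N hN.1 i
  refine ⟨a, ha.mono ?_⟩
  rintro N ⟨⟨hN, hNp⟩, hNa⟩
  refine ⟨hN, fun e he ↦ ?_⟩
  rcases List.mem_cons.1 he with rfl | he
  · exact hNa
  · exact hNp e he

theorem LargeNode.typical [Countable I] [Countable C] (hg : ∀ N ∈ 𝒜, ∀ i, (g N i).1 ∈ N)
    (h : LargeNode K 𝒜 g p) :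
    Large K {N ∈ 𝒜 | (∀ e ∈ p, g N e.1 = e.2) ∧ ∀ i, LargeNode K 𝒜 g ((i, g N i) :: p)} := by
  refine (Large.diff_iUnion (I := I) (𝒞 := fun i ↦ {N ∈ 𝒜 | (∀ e ∈ p, g N e.1 = e.2) ∧
    ¬ LargeNode K 𝒜 g ((i, g N i) :: p)}) h fun i hi ↦ ?_).mono ?_
  · obtain ⟨a, ha⟩ := hi.exists_fiber_prod (f := fun N ↦ g N i) fun N hN ↦ hg N hN.1 i
    obtain ⟨N, hN, hNa⟩ := ha.nonempty
    refine hN.2.2 ?_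
    rw [hNa]
    refine ha.mono ?_
    rintro N ⟨⟨hN, hNp, -⟩, hNa⟩
    refine ⟨hN, fun e he ↦ ?_⟩
    rcases List.mem_cons.1 he with rfl | he
    · exact hNa
    · exact hNp e he
  · rintro N ⟨⟨hN, hNp⟩, hNi⟩
    refine ⟨hN, hNp, fun i ↦ ?_⟩
    by_contra hc
    exact hNi i ⟨hN, hNp, hc⟩

theorem LargeNode.exists_branch [Countable I] [Nonempty I] {L : AddSubgroup B}
    (hL : ∀ p, (∀ e ∈ p, e.2.1 ∈ L) → LargeNode K 𝒜 g p → ∀ i,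
      ∃ a : L × C, LargeNode K 𝒜 g ((i, incl a) :: p))
    (hp : LargeNode K 𝒜 g p) (hpL : ∀ e ∈ p, e.2.1 ∈ L) :
    ∃ y : I → L × C, (∀ s : List I, LargeNode K 𝒜 g (s.map fun i ↦ (i, incl (y i)))) ∧
      ∀ e ∈ p, e.2 = incl (y e.1) := by
  obtain ⟨ι, hι⟩ := exists_surjective_nat I
  let Node := {p : List (I × (B × C)) // (∀ e ∈ p, e.2.1 ∈ L) ∧ LargeNode K 𝒜 g p}
  have hL' : ∀ (p : Node) i, ∃ a : L × C, LargeNode K 𝒜 g ((i, incl a) :: p.1) :=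
    fun p i ↦ hL p.1 p.2.1 p.2.2 i
  choose a ha using hL'
  let P : ℕ → Node := fun k ↦ Nat.rec ⟨p, hpL, hp⟩ (fun k q ↦
    ⟨(ι k, incl (a q (ι k))) :: q.1, by
      intro e he
      rcases List.mem_cons.1 he with rfl | he
      · exact (a q (ι k)).1.2
      · exact q.2.1 e he, ha q (ι k)⟩) k
  have hP1 : ∀ k, (P (k + 1)).1 = (ι k, incl (a (P k) (ι k))) :: (P k).1 :=
    fun k ↦ rfl
  have hmono : ∀ {i j}, i ≤ j → (P i).1 ⊆ (P j).1 := by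
    intro i j hij
    induction hij with
    | refl => exact fun _ h ↦ h
    | step _ ih => rw [hP1]; exact fun _ h ↦ List.mem_cons_of_mem _ (ih h)
  choose κ hκ using hι
  let y : I → L × C := fun i ↦ a (P (κ i)) i
  have hy : ∀ i, (i, incl (y i)) ∈ (P (κ i + 1)).1 := by
    intro i
    rw [hP1, hκ]
    exact List.mem_cons_self
  refine ⟨y, fun s ↦ ?_, fun e he ↦ ?_⟩
  · have : ∃ k, (s.map fun i ↦ (i, incl (y i))) ⊆ (P k).1 := by
      induction s with
      | nil => exact ⟨0, by simp⟩
      | cons i s ih =>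
        obtain ⟨k, hk⟩ := ih
        refine ⟨max k (κ i + 1), ?_⟩
        rw [List.map_cons, List.cons_subset]
        exact ⟨hmono (le_max_right _ _) (hy i), fun _ h ↦ hmono (le_max_left _ _) (hk h)⟩
    obtain ⟨k, hk⟩ := this
    exact (P k).2.2.of_subset hk
  · have h0 : p ⊆ (P (κ e.1 + 1)).1 := by
      have h00 : (P 0).1 = p := rfl
      rw [← h00]
      exact hmono (i := 0) (j := κ e.1 + 1) (Nat.zero_le _)
    exact (P (κ e.1 + 1)).2.2.eq (i := e.1) (h0 he) (hy e.1)

end LargeNode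

section BranchSpace
open Topology Filter

theorem isOpen_cylinder {I A : Type*} [TopologicalSpace A] [DiscreteTopology A] (s : List I)
    (y : I → A) : IsOpen {y' : I → A | ∀ i ∈ s, y' i = y i} := by
  have : {y' : I → A | ∀ i ∈ s, y' i = y i} = ⋂ i ∈ {i | i ∈ s}, (fun y' ↦ y' i) ⁻¹' {y i} := by
    ext; simp
  rw [this]
  exact (List.finite_toSet s).isOpen_biInter fun i _ ↦
    (isOpen_discrete _).preimage (continuous_apply i)

theorem exists_cylinder_subset {I A : Type*} [TopologicalSpace A] {U : Set (I → A)}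
    (hU : IsOpen U) {y : I → A} (hy : y ∈ U) :
    ∃ s : List I, ∀ y', (∀ i ∈ s, y' i = y i) → y' ∈ U := by
  obtain ⟨s, u, hu, hsU⟩ := isOpen_pi_iff.1 hU y hy
  refine ⟨s.toList, fun y' hy' ↦ hsU fun i hi ↦ ?_⟩
  rw [hy' i (by simpa using hi)]
  exact (hu i hi).2

/-- Indices for the coded witnesses of rigidity of an `n`-tuple. -/
abbrev WitIndex (n : ℕ) : Type := {d : Fin n → ℤ // d ≠ 0} × ℕ

/-- The countable part of the coded witnesses of rigidity of an `n`-tuple. -/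
abbrev WitData (n : ℕ) : Type := (ℤ × (Fin n → ℤ)) × ℕ

/-- The element of the group given by `v` and `a` is divisible as prescribed by `v`. -/
def Wit {B : Type*} [AddCommGroup B] {n : ℕ} (a : Fin n → B) (v : B × WitData n) : Prop :=
  ∃ u : B, v.2.1.1 • u = v.1 + ∑ j, v.2.1.2 j • a j

/-- The divisibility prescribed by `v` fails for the integral functional `d`. -/
def NonDiv {B : Type*} {n : ℕ} (d : Fin n → ℤ) (v : B × WitData n) : Prop :=
  ¬ v.2.1.1 ∣ ∑ j, v.2.1.2 j * d j

theorem Wit.unique {B : Type*} [AddCommGroup B] (hB : NoRigid B) {n : ℕ} {a a' : Fin n → B}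
    (v : {d : Fin n → ℤ // d ≠ 0} → B × WitData n) (ha : ∀ d, Wit a (v d))
    (ha' : ∀ d, Wit a' (v d)) (hv : ∀ d, NonDiv d.1 (v d)) : a = a' := by
  refine sub_eq_zero.1 (hB n (a - a') fun d hd ↦ ?_)
  obtain ⟨u, hu⟩ := ha ⟨d, hd⟩
  obtain ⟨u', hu'⟩ := ha' ⟨d, hd⟩
  refine ⟨_, (v ⟨d, hd⟩).2.1.2, 0, u - u', zero_mem _, ?_, hv ⟨d, hd⟩⟩
  rw [smul_sub, hu, hu']
  simp [smul_sub]

theorem exists_branch_space {B : Type*} [AddCommGroup B] [TopologicalSpace B] [DiscreteTopology B]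
    (hB : NoRigid B) {n : ℕ} {K : AddSubgroup B} {𝒜 : Set (AddSubgroup B)} (h𝒜 : Large K 𝒜)
    (g : AddSubgroup B → WitIndex n → B × WitData n) (t : AddSubgroup B → Fin n → B)
    (hg : ∀ N ∈ 𝒜, ∀ i, (g N i).1 ∈ N)
    (ht : ∀ N ∈ 𝒜, ∀ d, Wit (t N) (g N (d, 0)) ∧ NonDiv d.1 (g N (d, 0)))
    (htK : ∀ N ∈ 𝒜, ∀ j, t N j ∈ K) (htN : ∀ N ∈ 𝒜, ∃ j, t N j ∉ N) :
    ∃ (L : AddSubgroup B) (X : Set (WitIndex n → L × WitData n)), (L : Set B).Countable ∧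
      IsClosed X ∧ X.Nonempty ∧ (∀ y ∈ X, (fun i ↦ incl (y i)) ∈ closure (g '' 𝒜)) ∧
      ∀ a : Fin n → B, IsMeagre {y : X | ∀ d, Wit a (incl (y.1 (d, 0)))} := by
  have hne : Nonempty (WitIndex n) := by
    obtain ⟨N, hN⟩ := h𝒜.nonempty
    obtain ⟨j, -⟩ := htN N hN
    exact ⟨⟨fun _ ↦ 1, fun h ↦ one_ne_zero (congrFun h j)⟩, 0⟩
  have hch : ∀ p i, LargeNode K 𝒜 g p → ∃ a, LargeNode K 𝒜 g ((i, a) :: p) :=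
    fun p i hp ↦ hp.exists_cons hg i
  choose! ch hch using hch
  have hmiss : ∀ (p : List (WitIndex n × (B × WitData n))) (i : WitIndex n) (γ : WitData n),
      ∃ Λ₀ : Set B, Λ₀ ⊆ {ℓ | LargeNode K 𝒜 g ((i, (ℓ, γ)) :: p)} ∧ Λ₀.Finite ∧ ∀ b : B,
        (∀ ℓ ∈ Λ₀, ∃ u : B, γ.1.1 • u = ℓ + b) →
        ∀ ℓ ∈ {ℓ | LargeNode K 𝒜 g ((i, (ℓ, γ)) :: p)}, ∃ u : B, γ.1.1 • u = ℓ + b :=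
    fun p i γ ↦ exists_finite_testing _ _
  choose Λ hΛ hΛfin hΛmiss using hmiss
  obtain ⟨L, hLc, hL⟩ := exists_countable_closed
    (fun p ↦ Set.range (fun i ↦ (ch p i).1) ∪ ⋃ i, ⋃ γ, Λ p i γ) fun p ↦
      (Set.countable_range _).union (Set.countable_iUnion fun i ↦ Set.countable_iUnion fun γ ↦
        (hΛfin p i γ).countable)
  have hLch : ∀ p, (∀ e ∈ p, e.2.1 ∈ L) → LargeNode K 𝒜 g p → ∀ i,
      ∃ a : L × WitData n, LargeNode K 𝒜 g ((i, incl a) :: p) := fun p hpL hp i ↦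
    ⟨(⟨(ch p i).1, hL p hpL (Or.inl ⟨i, rfl⟩)⟩, (ch p i).2), hch p i hp⟩
  let X : Set (WitIndex n → L × WitData n) :=
    {y | ∀ s : List (WitIndex n), LargeNode K 𝒜 g (s.map fun i ↦ (i, incl (y i)))}
  refine ⟨L, X, hLc, ?_, ?_, fun y hy ↦ ?_, fun a ↦ ?_⟩
  · rw [← isOpen_compl_iff, isOpen_iff_mem_nhds]
    intro y hy
    obtain ⟨s, hs⟩ := not_forall.1 (show ¬ ∀ s : List _, _ from hy)
    refine Filter.mem_of_superset ((isOpen_cylinder s y).mem_nhds fun _ _ ↦ rfl) fun y' hy' hX ↦ ?_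
    have : (s.map fun i ↦ (i, incl (y' i))) = s.map fun i ↦ (i, incl (y i)) :=
      List.map_congr_left fun i hi ↦ by rw [hy' i hi]
    exact hs (this ▸ hX s)
  · obtain ⟨y, hy, -⟩ := LargeNode.exists_branch (p := []) hLch
      (h𝒜.mono fun N hN ↦ ⟨hN, by simp⟩) (by simp)
    exact ⟨y, hy⟩
  · rw [mem_closure_iff]
    intro U hU hyU
    obtain ⟨s, hs⟩ := exists_cylinder_subset hU hyU
    obtain ⟨N, hN, hNs⟩ := (hy s).nonempty
    exact ⟨g N, hs _ fun i hi ↦ hNs _ (List.mem_map_of_mem hi), N, hN, rfl⟩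
  · set Q : Set X := {y | ∀ d, Wit a (incl (y.1 (d, 0)))} with hQ
    have hQc : IsClosed Q := by
      have : Q = ⋂ d, (fun y : X ↦ y.1 (d, 0)) ⁻¹' {v | Wit a (incl v)} := by
        ext; simp [hQ]
      rw [this]
      exact isClosed_iInter fun d ↦ (isClosed_discrete _).preimage
        ((continuous_apply _).comp continuous_subtype_val)
    refine IsNowhereDense.isMeagre ?_
    rw [hQc.isNowhereDense_iff, Set.eq_empty_iff_forall_notMem]
    intro y hy
    obtain ⟨U, hUQ, hU, hyU⟩ := mem_interior.1 hy
    obtain ⟨V, hV, rfl⟩ := isOpen_induced_iff.1 hU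
    obtain ⟨s, hs⟩ := exists_cylinder_subset hV hyU
    set p := s.map fun i ↦ (i, incl (y.1 i)) with hp
    have hpL : ∀ e ∈ p, e.2.1 ∈ L := by
      intro e he
      obtain ⟨i, -, rfl⟩ := List.mem_map.1 he
      exact (y.1 i).1.2
    have hpbig : LargeNode K 𝒜 g p := y.2 s
    have hkey : ∀ N ∈ 𝒜, (∀ i, LargeNode K 𝒜 g ((i, g N i) :: p)) → a = t N := by
      intro N hN hNp
      refine Wit.unique hB (fun d ↦ g N (d, 0)) (fun d ↦ ?_) (fun d ↦ (ht N hN d).1)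
        fun d ↦ (ht N hN d).2
      refine hΛmiss p (d, 0) (g N (d, 0)).2 _ (fun ℓ hℓ ↦ ?_) (g N (d, 0)).1 (hNp (d, 0))
      have hℓL : ℓ ∈ L := hL p hpL (Or.inr (Set.mem_iUnion₂.2 ⟨_, _, hℓ⟩))
      obtain ⟨y', hy', hy'p⟩ := LargeNode.exists_branch hLch (hΛ _ _ _ hℓ) (by
        intro e he
        rcases List.mem_cons.1 he with rfl | he
        · exact hℓL
        · exact hpL e he)
      have hincl : Function.Injective (incl : L × WitData n → B × WitData n) := by
        rintro ⟨x, c⟩ ⟨x', c'⟩ h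
        have h1 := congrArg Prod.fst h
        have h2 := congrArg Prod.snd h
        exact Prod.ext (Subtype.ext h1) h2
      have hmem : (⟨y', hy'⟩ : X) ∈ Q := hUQ (hs y' fun i hi ↦ hincl
        (hy'p (i, incl (y.1 i)) (List.mem_cons_of_mem _ (List.mem_map_of_mem hi))).symm)
      have := hmem d
      rwa [← hy'p _ List.mem_cons_self] at this
    have htyp := hpbig.typical hg
    obtain ⟨N, hN, -, hNp⟩ := htyp.nonempty
    have haK : Set.range a ⊆ K := by
      rw [hkey N hN hNp]
      rintro _ ⟨j, rfl⟩
      exact htK N hN j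
    obtain ⟨N', ⟨hN', -, hN'p⟩, haN'⟩ := htyp.exists_subset (Set.countable_range a) haK
    obtain ⟨j, hj⟩ := htN N' hN'
    rw [← hkey N' hN' hN'p] at hj
    exact hj (haN' ⟨j, rfl⟩)

end BranchSpace

section Coding
open Topology Filter

instance polishSpace_of_countable {X : Type*} [TopologicalSpace X] [DiscreteTopology X]
    [Countable X] : PolishSpace X where

theorem polishSpace_prod {X Y : Type*} [TopologicalSpace X] [TopologicalSpace Y]
    (_ : PolishSpace X) (_ : PolishSpace Y) : PolishSpace (X × Y) := inferInstance

theorem analyticSet_inter {X : Type*} [TopologicalSpace X] [T2Space X] {s t : Set X}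
    (hs : AnalyticSet s) (ht : AnalyticSet t) : AnalyticSet (s ∩ t) := by
  rw [Set.inter_eq_iInter]
  exact .iInter fun b ↦ by cases b <;> assumption

theorem analyticSet_exists {X Y : Type*} [TopologicalSpace X] [TopologicalSpace Y]
    {s : Set (X × Y)} (hs : AnalyticSet s) : AnalyticSet {x | ∃ y, (x, y) ∈ s} := by
  convert! hs.image_of_continuous continuous_fst
  ext x
  simp

variable {B : Type*} [AddCommGroup B] (S : SouslinCode B)

/-- The codes of linear combinations with coefficients `c`. -/
def combGraph {n : ℕ} (c : Fin n → ℤ) : Set ((Fin n → Cantor) × Cantor) :=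
  {p | ((∀ j, p.1 j ∈ S.Bstar) ∧ p.2 ∈ S.Bstar) ∧ S.q p.2 = ∑ j, c j • S.q (p.1 j)}

/-- The graph of addition on codes. -/
def addGraph : Set (Cantor × Cantor × Cantor) :=
  {p | p.1 ∈ S.Bstar ∧ p.2.1 ∈ S.Bstar ∧ p.2.2 ∈ S.Bstar ∧ S.q p.1 + S.q p.2.1 = S.q p.2.2}

theorem analyticSet_addGraph : AnalyticSet (addGraph S) := S.analytic_add

theorem analyticSet_codes (n : ℕ) :
    AnalyticSet {p : (Fin n → Cantor) × Cantor | (∀ j, p.1 j ∈ S.Bstar) ∧ p.2 ∈ S.Bstar} := by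
  have : {p : (Fin n → Cantor) × Cantor | (∀ j, p.1 j ∈ S.Bstar) ∧ p.2 ∈ S.Bstar} =
      ⋂ o : Option (Fin n), (fun p : (Fin n → Cantor) × Cantor ↦ o.elim p.2 p.1) ⁻¹' S.Bstar := by
    ext p
    simp [Set.iInter_option, and_comm]
  rw [this]
  refine .iInter fun o ↦ S.analytic_Bstar.preimage ?_
  cases o
  · exact continuous_snd
  · exact (continuous_apply _).comp continuous_fst

theorem analyticSet_combGraph {n : ℕ} (c : Fin n → ℤ) : AnalyticSet (combGraph S c) := by
  let H : AddSubgroup (Fin n → ℤ) :=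
    { carrier := {c | AnalyticSet (combGraph S c)}
      zero_mem' := by
        change AnalyticSet (combGraph S 0)
        convert! analyticSet_inter (analyticSet_codes S n) ((analyticSet_addGraph S).preimage
          (f := fun p : (Fin n → Cantor) × Cantor ↦ (p.2, p.2, p.2)) (by fun_prop))
        ext p
        simp +contextual [combGraph, addGraph]
      add_mem' := by
        intro c c' hc hc'
        change AnalyticSet (combGraph S (c + c'))
        convert! analyticSet_exists (X := (Fin n → Cantor) × Cantor) (Y := Cantor × Cantor)
          (analyticSet_inter (AnalyticSet.preimage hc (f := fun w ↦ (w.1.1, w.2.1)) (by fun_prop))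
            (analyticSet_inter
              (AnalyticSet.preimage hc' (f := fun w ↦ (w.1.1, w.2.2)) (by fun_prop))
              ((analyticSet_addGraph S).preimage
                (f := fun w ↦ (w.2.1, w.2.2, w.1.2)) (by fun_prop))))
        ext ⟨x, z⟩
        constructor
        · rintro ⟨⟨hx, hz⟩, h⟩
          obtain ⟨z₁, hz₁, h₁⟩ := S.surj (∑ j, c j • S.q (x j))
          obtain ⟨z₂, hz₂, h₂⟩ := S.surj (∑ j, c' j • S.q (x j))
          refine ⟨(z₁, z₂), ⟨⟨hx, hz₁⟩, h₁⟩, ⟨⟨hx, hz₂⟩, h₂⟩, hz₁, hz₂, hz, ?_⟩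
          change S.q z₁ + S.q z₂ = S.q z
          rw [h, h₁, h₂]
          simp [add_smul, Finset.sum_add_distrib]
        · rintro ⟨⟨z₁, z₂⟩, ⟨⟨hx, -⟩, h₁⟩, ⟨-, h₂⟩, -, -, hz, h⟩
          refine ⟨⟨hx, hz⟩, ?_⟩
          change S.q z₁ + S.q z₂ = S.q z at h
          change S.q z₁ = ∑ j, c j • S.q (x j) at h₁
          change S.q z₂ = ∑ j, c' j • S.q (x j) at h₂
          change S.q z = _
          rw [← h, h₁, h₂]
          simp [add_smul, Finset.sum_add_distrib]
      neg_mem' := by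
        intro c hc
        change AnalyticSet (combGraph S (-c))
        convert! analyticSet_exists (X := (Fin n → Cantor) × Cantor) (Y := Cantor × Cantor)
          (analyticSet_inter (AnalyticSet.preimage hc (f := fun w ↦ (w.1.1, w.2.1)) (by fun_prop))
            (analyticSet_inter
              ((analyticSet_addGraph S).preimage
                (f := fun w ↦ (w.2.1, w.1.2, w.2.2)) (by fun_prop))
              ((analyticSet_addGraph S).preimage
                (f := fun w ↦ (w.2.2, w.2.2, w.2.2)) (by fun_prop))))
        ext ⟨x, z⟩
        constructor
        · rintro ⟨⟨hx, hz⟩, h⟩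
          obtain ⟨z₁, hz₁, h₁⟩ := S.surj (∑ j, c j • S.q (x j))
          obtain ⟨z₀, hz₀, h₀⟩ := S.surj 0
          refine ⟨(z₁, z₀), ⟨⟨hx, hz₁⟩, h₁⟩, ⟨hz₁, hz, hz₀, ?_⟩, hz₀, hz₀, hz₀, ?_⟩
          · change S.q z₁ + S.q z = S.q z₀
            rw [h, h₁, h₀]
            simp
          · change S.q z₀ + S.q z₀ = S.q z₀
            rw [h₀, add_zero]
        · rintro ⟨⟨z₁, z₀⟩, ⟨⟨hx, -⟩, h₁⟩, ⟨-, hz, -, h⟩, -, -, -, h₀⟩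
          refine ⟨⟨hx, hz⟩, ?_⟩
          change S.q z₁ + S.q z = S.q z₀ at h
          change S.q z₁ = ∑ j, c j • S.q (x j) at h₁
          change S.q z₀ + S.q z₀ = S.q z₀ at h₀
          rw [_root_.add_eq_left] at h₀
          rw [h₀, h₁] at h
          change S.q z = _
          rw [eq_neg_of_add_eq_zero_right h]
          simp }
  have hsingle : ∀ j, Pi.single j 1 ∈ H := by
    intro j
    change AnalyticSet (combGraph S (Pi.single j 1))
    convert! analyticSet_inter (analyticSet_codes S n) (S.analytic_E.preimage
      (f := fun p : (Fin n → Cantor) × Cantor ↦ (p.2, p.1 j)) (by fun_prop))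
    ext ⟨x, z⟩
    refine and_congr_right fun hx ↦ ?_
    change S.q z = ∑ i, (Pi.single j 1 : Fin n → ℤ) i • S.q (x i) ↔ (z, x j) ∈ S.E
    rw [← S.q_eq_iff z hx.2 (x j) (hx.1 j), Finset.sum_eq_single j]
    · simp
    · intro i _ hij
      simp [hij]
    · simp
  have hc : c = ∑ j, c j • Pi.single j 1 := by
    ext i
    simp [Finset.sum_apply, Pi.single_apply]
  change c ∈ H
  rw [hc]
  exact sum_mem fun j _ ↦ zsmul_mem (hsingle j) _

/-- The codes of tuples satisfying a prescribed divisibility relation. -/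
def divGraph (n : ℕ) : Set (((Fin n → Cantor) × Cantor) × (ℤ × (Fin n → ℤ))) :=
  {z | (∀ j, z.1.1 j ∈ S.Bstar) ∧ z.1.2 ∈ S.Bstar ∧
    ∃ u : B, z.2.1 • u = S.q z.1.2 + ∑ j, z.2.2 j • S.q (z.1.1 j)}

theorem analyticSet_divGraph (n : ℕ) : AnalyticSet (divGraph S n) := by
  have hmc : ∀ mc : ℤ × (Fin n → ℤ), AnalyticSet {p : (Fin n → Cantor) × Cantor |
      (p, mc) ∈ divGraph S n} := by
    rintro ⟨m, c⟩
    have h₃ : PolishSpace (Cantor × Cantor × Cantor) := inferInstance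
    have hP : PolishSpace (((Fin n → Cantor) × Cantor) × Cantor × Cantor × Cantor) :=
      polishSpace_prod inferInstance h₃
    convert! analyticSet_exists (X := (Fin n → Cantor) × Cantor) (Y := Cantor × Cantor × Cantor)
      (analyticSet_inter ((analyticSet_combGraph S (fun _ : Fin 1 ↦ m)).preimage
          (f := fun w ↦ (fun _ ↦ w.2.1, w.2.2.1)) (by fun_prop))
        (analyticSet_inter ((analyticSet_combGraph S c).preimage
            (f := fun w ↦ (w.1.1, w.2.2.2)) (by fun_prop))
          ((analyticSet_addGraph S).preimage
            (f := fun w ↦ (w.1.2, w.2.2.2, w.2.2.1)) (by fun_prop))))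
    rename_i p
    obtain ⟨x, k⟩ := p
    constructor
    · rintro ⟨hx, hk, u, hu⟩
      obtain ⟨v, hv, rfl⟩ := S.surj u
      obtain ⟨z, hz, h⟩ := S.surj (m • S.q v)
      obtain ⟨z', hz', h'⟩ := S.surj (∑ j, c j • S.q (x j))
      refine ⟨(v, z, z'), ⟨⟨fun _ ↦ hv, hz⟩, ?_⟩, ⟨⟨hx, hz'⟩, h'⟩, hk, hz', hz, ?_⟩
      · change S.q z = ∑ j : Fin 1, m • S.q v
        simp [h]
      · change S.q k + S.q z' = S.q z
        rw [h, h']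
        exact hu.symm
    · rintro ⟨⟨v, z, z'⟩, ⟨-, h⟩, ⟨⟨hx, -⟩, h'⟩, hk, -, -, h''⟩
      refine ⟨hx, hk, S.q v, ?_⟩
      change S.q z = ∑ j : Fin 1, m • S.q v at h
      change S.q z' = ∑ j, c j • S.q (x j) at h'
      change S.q k + S.q z' = S.q z at h''
      change m • S.q v = S.q k + ∑ j, c j • S.q (x j)
      rw [← h', h'', h]
      simp
  have : divGraph S n = ⋃ mc, (fun p ↦ (p, mc)) '' {p | (p, mc) ∈ divGraph S n} := by
    ext ⟨p, mc⟩
    simp only [Set.mem_iUnion, Set.mem_image, Prod.mk.injEq]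
    exact ⟨fun h ↦ ⟨mc, p, h, rfl, rfl⟩, by rintro ⟨_, _, h, rfl, rfl⟩; exact h⟩
  rw [this]
  exact .iUnion fun mc ↦ (hmc mc).image_of_continuous (by fun_prop)

end Coding

section Main
open Topology Filter

theorem exists_coded_witnesses {B : Type*} [AddCommGroup B] (S : SouslinCode B) {n : ℕ}
    {κ : B → Cantor} (hκ : ∀ b, κ b ∈ S.Bstar ∧ S.q (κ b) = b)
    {f : (ℕ → ℕ) → ((Fin n → Cantor) × Cantor) × (ℤ × (Fin n → ℤ))}
    (hf : Set.range f = divGraph S n) {N : AddSubgroup B} {t : Fin n → B} (ht : Rigid N t)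
    (d : {d : Fin n → ℤ // d ≠ 0}) :
    ∃ (v : B × (ℤ × (Fin n → ℤ))) (w : ℕ → ℕ), v.1 ∈ N ∧
      f w = ((fun j ↦ κ (t j), κ v.1), v.2) ∧ ¬ v.2.1 ∣ ∑ j, v.2.2 j * d.1 j := by
  obtain ⟨m, c, ℓ, u, hℓ, hu, hm⟩ := ht d.1 d.2
  have : (((fun j ↦ κ (t j), κ ℓ), (m, c)) :
      ((Fin n → Cantor) × Cantor) × (ℤ × (Fin n → ℤ))) ∈ divGraph S n :=
    ⟨fun j ↦ (hκ _).1, (hκ _).1, u, by simpa [(hκ _).2] using hu⟩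
  rw [← hf] at this
  obtain ⟨w, hw⟩ := this
  exact ⟨(ℓ, (m, c)), w, hℓ, hw, hm⟩

theorem not_large_isBad {B : Type*} [AddCommGroup B] (S : SouslinCode B) (hB : LiftsCharacters B)
    (K : AddSubgroup B) (n : ℕ) : ¬ Large K {N | N ≤ K ∧ IsBad K n N} := by
  intro h𝒜
  set 𝒜 := {N | N ≤ K ∧ IsBad K n N} with h𝒜def
  let _ : TopologicalSpace B := ⊥
  have _ : DiscreteTopology B := ⟨rfl⟩
  have hκ : ∀ b, ∃ x, x ∈ S.Bstar ∧ S.q x = b := fun b ↦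
    let ⟨x, hx, h⟩ := S.surj b
    ⟨x, hx, h⟩
  choose κ hκ using hκ
  obtain ⟨f, hfc, hf⟩ : ∃ f : (ℕ → ℕ) → ((Fin n → Cantor) × Cantor) × (ℤ × (Fin n → ℤ)),
      Continuous f ∧ Set.range f = divGraph S n := by
    have h := analyticSet_divGraph S n
    rw [AnalyticSet] at h
    refine h.resolve_left (Set.Nonempty.ne_empty ⟨((fun _ ↦ κ 0, κ 0), (0, 0)), ?_⟩)
    exact ⟨fun _ ↦ (hκ 0).1, (hκ 0).1, 0, by simp [(hκ 0).2]⟩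
  have hbad : ∀ N, N ∈ 𝒜 → ∃ a : Fin n → B, (∀ j, a j ∈ K) ∧ (∃ j, a j ∉ N) ∧ Rigid N a :=
    fun N hN ↦ hN.2
  choose! t htK htN ht using hbad
  have hvw := fun N (hN : N ∈ 𝒜) ↦ exists_coded_witnesses S hκ hf (ht N hN)
  choose! v w hvN hfw hv using hvw
  let g : AddSubgroup B → WitIndex n → B × WitData n := fun N i ↦
    ((v N i.1).1, ((v N i.1).2, w N i.1 i.2))
  obtain ⟨N₀, hN₀⟩ := h𝒜.nonempty
  obtain ⟨j₀, -⟩ := htN N₀ hN₀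
  have hn : Nonempty (Fin n) := ⟨j₀⟩
  let d₀ : {d : Fin n → ℤ // d ≠ 0} := ⟨fun _ ↦ 1, fun h ↦ one_ne_zero (congrFun h j₀)⟩
  have hwit : ∀ (x : Fin n → Cantor) (b : B) (γ : WitData n),
      ((x, κ b), γ.1) ∈ divGraph S n → Wit (fun j ↦ S.q (x j)) (b, γ) := by
    rintro x b γ ⟨-, -, u, hu⟩
    exact ⟨u, by simpa [(hκ b).2] using hu⟩
  obtain ⟨L, X, hLc, hXc, hXne, hXg, hXm⟩ := exists_branch_space hB.noRigid h𝒜 g t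
    (fun N hN i ↦ hvN N hN i.1) (fun N hN d ↦ ⟨by
      have := hwit (fun j ↦ κ (t N j)) (v N d).1 ((v N d).2, w N d 0) (by
        rw [← hf]
        exact ⟨_, hfw N hN d⟩)
      simpa only [(hκ _).2] using this, hv N hN d⟩) htK htN
  let W : (WitIndex n → B × WitData n) → {d : Fin n → ℤ // d ≠ 0} → ℕ → ℕ :=
    fun h d j ↦ (h (d, j)).2.2
  have hWc : ∀ d, Continuous fun h ↦ W h d := fun d ↦ continuous_pi fun j ↦ by
    simp only [W]
    fun_prop
  have hlim : ∀ h ∈ closure (g '' 𝒜), ∀ d, NonDiv d.1 (h (d, 0)) ∧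
      f (W h d) = (((f (W h d₀)).1.1, κ (h (d, 0)).1), (h (d, 0)).2.1) := by
    have hκc : Continuous κ := continuous_of_discreteTopology
    have hclosed : IsClosed {h : WitIndex n → B × WitData n | ∀ d, NonDiv d.1 (h (d, 0)) ∧
        f (W h d) = (((f (W h d₀)).1.1, κ (h (d, 0)).1), (h (d, 0)).2.1)} := by
      simp only [Set.ofPred_forall, Set.ofPred_and]
      refine isClosed_iInter fun d ↦ IsClosed.inter ?_ ?_
      · exact (isClosed_discrete {v : B × WitData n | NonDiv d.1 v}).preimage
          (f := fun h : WitIndex n → B × WitData n ↦ h (d, 0)) (by fun_prop)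
      · have h1 := hfc.comp (hWc d)
        have h2 := hfc.comp (hWc d₀)
        refine isClosed_eq h1 (((continuous_fst.comp (continuous_fst.comp h2)).prodMk
          (hκc.comp ?_)).prodMk ?_) <;> fun_prop
    refine closure_minimal ?_ hclosed
    rintro _ ⟨N, hN, rfl⟩ d
    refine ⟨hv N hN d, ?_⟩
    change f (w N d) = (((f (w N d₀)).1.1, κ (v N d).1), (v N d).2)
    rw [hfw N hN d, hfw N hN d₀]
  have hLcount : Countable L := hLc.to_subtype
  have hXp : PolishSpace X := hXc.polishSpace
  have hXn : Nonempty X := hXne.to_subtype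
  let ext : X → WitIndex n → B × WitData n := fun y i ↦ incl (y.1 i)
  have hextc : Continuous ext := continuous_pi fun i ↦
    (continuous_of_discreteTopology (f := (incl : L × WitData n → B × WitData n))).comp
      ((continuous_apply i).comp continuous_subtype_val)
  let x : X → Fin n → Cantor := fun y ↦ (f (W (ext y) d₀)).1.1
  have hxc : Continuous x :=
    continuous_fst.comp (continuous_fst.comp (hfc.comp ((hWc d₀).comp hextc)))
  have hlim' : ∀ (y : X) d, NonDiv d.1 (ext y (d, 0)) ∧
      ((x y, κ (ext y (d, 0)).1), (ext y (d, 0)).2.1) ∈ divGraph S n := fun y d ↦ by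
    obtain ⟨h1, h2⟩ := hlim _ (hXg y.1 y.2) d
    exact ⟨h1, by rw [← hf]; exact ⟨_, h2⟩⟩
  let a : X → Fin n → B := fun y j ↦ S.q (x y j)
  have hwita : ∀ (y : X) d, Wit (a y) (ext y (d, 0)) := fun y d ↦ hwit _ _ _ (hlim' y d).2
  have hxB : ∀ (y : X) j, x y j ∈ S.Bstar := fun y j ↦ (hlim' y d₀).2.1 j
  let R : Set (X × X) := {z | a z.1 = a z.2}
  have hR : AnalyticSet R := by
    have : R = ⋂ j, (fun z : X × X ↦ (x z.1 j, x z.2 j)) ⁻¹' S.E := by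
      ext z
      simp only [Set.mem_iInter, Set.mem_preimage, ← S.q_eq_iff _ (hxB _ _) _ (hxB _ _)]
      exact funext_iff
    rw [this]
    exact .iInter fun j ↦ S.analytic_E.preimage (by fun_prop)
  have hRm : IsMeagre R := isMeagre_of_sections hR fun y ↦ by
    have hm := hXm (a y)
    refine hm.mono ?_
    intro y' hy' d
    change a y = a y' at hy'
    rw [hy']
    exact hwita y' d
  obtain ⟨φ, hφ⟩ := exists_cantor_unrelated hRm
  refine hB.not_rigid_family hLc (fun η ↦ a (φ η)) (fun η η' h ↦ ?_) fun η d hd ↦ ?_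
  · by_contra hne
    exact hφ η η' hne h
  · obtain ⟨u, hu⟩ := hwita (φ η) ⟨d, hd⟩
    exact ⟨_, _, _, u, ((φ η).1 (⟨d, hd⟩, 0)).1.2, hu, (hlim' (φ η) ⟨d, hd⟩).1⟩

theorem LiftsCharacters.aleph2Free {B : Type*} [AddCommGroup B] (hB : LiftsCharacters B)
    (hcode : HasSouslinCode B) : Aleph2Free B := by
  obtain ⟨S⟩ := hcode
  intro K hK
  obtain ⟨F, hF, hFN⟩ := exists_closure_of_not_large (not_large_isBad S hB K)
  exact free_of_not_isBad hB.noRigid hK hF fun N hNK hN n hbad ↦ hFN N hN n ⟨hNK, hbad⟩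

end Main

theorem aleph2Free_of_isWhitehead {B : Type u} [AddCommGroup B] (hcode : HasSouslinCode B)
    (hwh : IsWhitehead.{u, v} B) : Aleph2Free B := by
  have : Small.{v} B := by
    obtain ⟨S⟩ := hcode
    refine small_of_surjective (f := fun x : ULift.{v} Cantor ↦ S.q x.down) fun b ↦ ?_
    obtain ⟨x, -, hx⟩ := S.surj b
    exact ⟨⟨x⟩, hx⟩
  exact (liftsCharacters_of_isWhitehead hwh).aleph2Free hcode

end SouslinWhitehead

/-- Every Souslin Whitehead group is ℵ₂-free. -/
theorem souslin_whitehead_aleph2Free (B : Type*) [AddCommGroup B]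
    (hcode : HasSouslinCode B) (hwh : IsWhitehead B) :
    Aleph2Free B := by
  exact SouslinWhitehead.aleph2Free_of_isWhitehead hcode hwh
end
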